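/- Let X₁,…,Xₙ be i.i.d. from a non-degenerate probability measure μ on ℝ with E[e^{λ|X₁|^p}]<∞ for some p∈[1,∞] and all λ>0, and let {Qₙ} be symmetric matrices with zero diagonal such that δ_□(W_{Qₙ},W)→0 for some W∈𝒲 and limsup_{n→∞}‖W_{Qₙ}‖_{qΔ}<∞ for some q>1 with 1/p+1/q≤1. Then G_{1,W}(f) is well-defined and finite for every f∈ℒ, and the random multilinear form N₁(H,Qₙ,X) = n^{−v} Σ_{(i₁,…,i_v)∈S(n,v)} (Π_{a=1}^v X_{i_a}) (Π_{(a,b)∈E(H)} Qₙ(i_a,i_b)) satisfies a large deviation principle at speed n with the good rate function I₁(t) = inf{ ∫₀¹ γ(β(f(x))) dx : f∈ℒ, ∫₀¹ γ(β(f(x)))dx < ∞, G_{1,W}(f) = t }. -/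

import Mathlib

open MeasureTheory Filter Set
open scoped ENNReal NNReal

noncomputable section

/-- The uniform probability measure on `[0,1]`. -/
def unif01 : Measure ℝ := volume.restrict (Set.Icc 0 1)

instance : IsProbabilityMeasure unif01 :=
  ⟨by rw [unif01, Measure.restrict_apply_univ, Real.volume_Icc]; norm_num⟩

/-- The `L^r` norm (`r : ℝ≥0∞`) of a kernel, viewed as a function on `[0,1]²`. -/
def kerNorm (W : ℝ → ℝ → ℝ) (r : ℝ≥0∞) : ℝ≥0∞ :=
  eLpNorm (fun z : ℝ × ℝ => W z.1 z.2) r (unif01.prod unif01)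

/-- The (strong) cut distance `d_□` between two kernels on `[0,1]²`. -/
def cutDist (W₁ W₂ : ℝ → ℝ → ℝ) : ℝ :=
  ⨆ S : {S : Set ℝ // MeasurableSet S}, ⨆ T : {T : Set ℝ // MeasurableSet T},
    |∫ x in Set.Icc (0:ℝ) 1 ∩ S.1, ∫ y in Set.Icc (0:ℝ) 1 ∩ T.1, (W₁ x y - W₂ x y)|

/-- A Lebesgue-measure-preserving bijection of `[0,1]`. -/
def MPB (σ : ℝ → ℝ) : Prop :=
  Set.BijOn σ (Set.Icc 0 1) (Set.Icc 0 1) ∧ MeasurePreserving σ unif01 unif01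

/-- The weak cut distance `δ_□`. -/
def weakCutDist (W₁ W₂ : ℝ → ℝ → ℝ) : ℝ :=
  ⨅ σ : {σ : ℝ → ℝ // MPB σ}, cutDist (fun x y => W₁ (σ.1 x) (σ.1 y)) W₂

/-- The step kernel `W_{Q_n}` associated to an `n × n` matrix `Q`:
it equals `Q i j` when `⌈n x⌉ = i, ⌈n y⌉ = j`. -/
def stepKernel (n : ℕ) (Q : Fin n → Fin n → ℝ) : ℝ → ℝ → ℝ := fun x y =>
  ∑ i : Fin n, ∑ j : Fin n,
    if x ∈ Set.Ioc (((i : ℕ) : ℝ)/n) ((((i : ℕ) : ℝ)+1)/n) ∧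
       y ∈ Set.Ioc (((j : ℕ) : ℝ)/n) ((((j : ℕ) : ℝ)+1)/n)
    then Q i j else 0

/-- Product over the edges of `H` (each edge counted once) of `f a b`. -/
def edgeProd {v : ℕ} (G : SimpleGraph (Fin v)) [DecidableRel G.Adj]
    (f : Fin v → Fin v → ℝ) : ℝ :=
  ∏ p ∈ Finset.univ.filter (fun p : Fin v × Fin v => G.Adj p.1 p.2 ∧ p.1 < p.2), f p.1 p.2

/-- The number of edges `|E(H)|`. -/
def edgeCard {v : ℕ} (G : SimpleGraph (Fin v)) [DecidableRel G.Adj] : ℕ :=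
  (Finset.univ.filter (fun p : Fin v × Fin v => G.Adj p.1 p.2 ∧ p.1 < p.2)).card

/-- The inhomogeneous U-statistic `U_n(X)` (sum over distinct indices). -/
def Ustat {X : Type*} {v : ℕ} (G : SimpleGraph (Fin v)) [DecidableRel G.Adj]
    (φ : (Fin v → X) → ℝ) (n : ℕ) (Q : Fin n → Fin n → ℝ) (x : Fin n → X) : ℝ :=
  (∑ i ∈ Finset.univ.filter (fun i : Fin v → Fin n => Function.Injective i),
      φ (x ∘ i) * edgeProd G (fun a b => Q (i a) (i b))) / (n : ℝ) ^ v

/-- The inhomogeneous V-statistic `V_n(X)` (sum over all indices). -/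
def Vstat {X : Type*} {v : ℕ} (G : SimpleGraph (Fin v)) [DecidableRel G.Adj]
    (φ : (Fin v → X) → ℝ) (n : ℕ) (Q : Fin n → Fin n → ℝ) (x : Fin n → X) : ℝ :=
  (∑ i : Fin v → Fin n, φ (x ∘ i) * edgeProd G (fun a b => Q (i a) (i b))) / (n : ℝ) ^ v

open Classical in
/-- Kullback-Leibler divergence `D(ν | ρ) ∈ [0,∞]`. -/
def KLdiv {α : Type*} [MeasurableSpace α] (ν ρ : Measure α) : ℝ≥0∞ :=
  if ν ≪ ρ ∧ Integrable (llr ν ρ) ν then ENNReal.ofReal (∫ a, llr ν ρ a ∂ν) else ⊤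

open Classical in
/-- `ν` itself if it is a probability measure, junk value `0` otherwise. -/
def probOr {α : Type*} [MeasurableSpace α] (ν : Measure α) : Measure α :=
  if IsProbabilityMeasure ν then ν else 0

instance {α : Type*} [MeasurableSpace α] (ν : Measure α) : SigmaFinite (probOr ν) := by
  unfold probOr
  split_ifs with h
  · haveI := h; infer_instance
  · infer_instance

/-- `v`-fold product of a (probability) measure. -/
def piProb {α : Type*} [MeasurableSpace α] (v : ℕ) (ν : Measure α) : Measure (Fin v → α) :=
  Measure.pi fun _ => probOr ν

/-- The functional `T_{W,φ}(ν) = E[φ(B₁,…,B_v) ∏_{(a,b) ∈ E(H)} W(A_a,A_b)]`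
for `(A_a,B_a)` i.i.d. with law `ν`. -/
def TWphi {X : Type*} [MeasurableSpace X] {v : ℕ} (G : SimpleGraph (Fin v))
    [DecidableRel G.Adj] (W : ℝ → ℝ → ℝ) (φ : (Fin v → X) → ℝ)
    (ν : Measure (ℝ × X)) : ℝ :=
  ∫ z : Fin v → ℝ × X,
    φ (fun a => (z a).2) * edgeProd G (fun a b => W (z a).1 (z b).1) ∂(piProb v ν)

/-- Membership in `𝒯ℳ`: probability measures on `[0,1] × 𝒳` whose first marginal
is uniform on `[0,1]`. -/
def inTM {X : Type*} [MeasurableSpace X] (ν : Measure (ℝ × X)) : Prop :=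
  IsProbabilityMeasure ν ∧ ν.map Prod.fst = unif01

/-- The rate function `I₀(t) = inf { D(ν|ρ) : ν ∈ 𝒯ℳ, D(ν|ρ) < ∞, T_{W,φ}(ν) = t }`. -/
def rate0 {X : Type*} [MeasurableSpace X] {v : ℕ} (G : SimpleGraph (Fin v))
    [DecidableRel G.Adj] (W : ℝ → ℝ → ℝ) (φ : (Fin v → X) → ℝ) (μ : Measure X)
    (t : ℝ) : ℝ≥0∞ :=
  ⨅ ν : {ν : Measure (ℝ × X) //
      inTM ν ∧ KLdiv ν (unif01.prod μ) ≠ ⊤ ∧ TWphi G W φ ν = t},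
    KLdiv ν.1 (unif01.prod μ)

/-- Tail assumption (T): `E_μ[e^{λ ψ(X)^p}] < ∞` for all `λ > 0`; for `p = ∞`
it means `ψ` is bounded. -/
def TailCond {X : Type*} [MeasurableSpace X] (μ : Measure X) (ψ : X → ℝ)
    (p : ℝ≥0∞) : Prop :=
  if p = ⊤ then ∃ C : ℝ, ∀ x, ψ x ≤ C
  else ∀ lam : ℝ, 0 < lam →
    ∫⁻ x, ENNReal.ofReal (Real.exp (lam * ψ x ^ p.toReal)) ∂μ < ⊤

/-- A sequence of random elements `T n` defined on probability spaces `(Ω n, P n)`,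
taking values in a topological space `E`, satisfies a large deviation principle at
speed `n` with good rate function `I`. -/
def SatisfiesLDP {E : Type*} [TopologicalSpace E] {Ω : ℕ → Type*}
    [∀ n, MeasurableSpace (Ω n)] (P : ∀ n, Measure (Ω n)) (T : ∀ n, Ω n → E)
    (I : E → ℝ≥0∞) : Prop :=
  (∀ c : ℝ≥0∞, c ≠ ⊤ → IsCompact {x | I x ≤ c}) ∧
  ∀ F : Set E, MeasurableSet[borel E] F →
    (-(⨅ x ∈ interior F, (I x : EReal)) ≤
      Filter.atTop.liminf fun n : ℕ =>
        (((n : ℝ)⁻¹ : ℝ) : EReal) * ENNReal.log (P n {ω | T n ω ∈ F})) ∧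
    (Filter.atTop.limsup (fun n : ℕ =>
        (((n : ℝ)⁻¹ : ℝ) : EReal) * ENNReal.log (P n {ω | T n ω ∈ F})) ≤
      -(⨅ x ∈ closure F, (I x : EReal)))

end
/-- The cumulant generating function `α(θ) = log ∫ e^{θx} dμ(x)`. -/
noncomputable def cgf' (μ : Measure ℝ) (θ : ℝ) : ℝ := Real.log (∫ x, Real.exp (θ * x) ∂μ)

/-- `𝒩 = α'(ℝ)`, the range of the derivative of the cgf. -/
def Ncal (μ : Measure ℝ) : Set ℝ := Set.range (deriv (cgf' μ))

/-- The function `u ↦ γ(β(u))` appearing in the multilinear rate function. On `cl(𝒩)`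
it coincides (by convex duality) with the Legendre transform `sup_θ {θu − α(θ)}`,
which is the formula used here; its values lie in `[0,∞]`. -/
noncomputable def gammaBeta (μ : Measure ℝ) (u : ℝ) : ℝ≥0∞ :=
  ⨆ θ : ℝ, ENNReal.ofReal (θ * u - cgf' μ θ)

/-- The class `ℒ` of measurable `f : [0,1] → cl(𝒩)` with `∫₀¹ |f|^p < ∞`. -/
def Lcal (μ : Measure ℝ) (p : ℝ≥0∞) : Set (ℝ → ℝ) :=
  {f | Measurable f ∧ (∀ u ∈ Set.Icc (0 : ℝ) 1, f u ∈ closure (Ncal μ)) ∧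
    eLpNorm f p unif01 < ⊤}

/-- The functional `G_{1,W}(f) = ∫_{[0,1]^v} ∏_{(a,b) ∈ E(H)} W(x_a,x_b) ∏_a f(x_a) dx`. -/
noncomputable def G1 {v : ℕ} (G : SimpleGraph (Fin v)) [DecidableRel G.Adj]
    (W : ℝ → ℝ → ℝ) (f : ℝ → ℝ) : ℝ :=
  ∫ x : Fin v → ℝ, edgeProd G (fun a b => W (x a) (x b)) * ∏ a, f (x a)
    ∂(Measure.pi fun _ : Fin v => unif01)

/-- The rate function `I₁` for multilinear forms. -/
noncomputable def rate1 {v : ℕ} (G : SimpleGraph (Fin v)) [DecidableRel G.Adj]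
    (W : ℝ → ℝ → ℝ) (μ : Measure ℝ) (p : ℝ≥0∞) (t : ℝ) : ℝ≥0∞ :=
  ⨅ f : {f : ℝ → ℝ // f ∈ Lcal μ p ∧ (∫⁻ u, gammaBeta μ (f u) ∂unif01) ≠ ⊤ ∧
      G1 G W f = t},
    ∫⁻ u, gammaBeta μ (f.1 u) ∂unif01

section
open MeasureTheory Filter Set
open scoped ENNReal NNReal

/-! ### Part A: Finner's inequality and product-measure tools -/

theorem finner_aux {κ ι : Type*} [Fintype κ] [DecidableEq κ] (ν : Measure ℝ) [IsProbabilityMeasure ν]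
    (E : Finset ι) (F : ι → (κ → ℝ) → ℝ≥0∞) (hF : ∀ e, Measurable (F e))
    (dep : ι → Finset κ)
    (hdep : ∀ e, ∀ x y : κ → ℝ, (∀ a ∈ dep e, x a = y a) → F e x = F e y)
    (D : ℕ) (hD : 1 ≤ D) (hdeg : ∀ a, (E.filter (fun e => a ∈ dep e)).card ≤ D)
    (s : Finset κ) (x : κ → ℝ) :
    lmarginal (fun _ => ν) s (fun x => ∏ e ∈ E, F e x) x ≤
      ∏ e ∈ E, (lmarginal (fun _ => ν) s (fun x => F e x ^ D) x) ^ ((D : ℝ)⁻¹) := by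
  have hD0 : (0:ℝ) < D := by exact_mod_cast hD
  induction s using Finset.induction_on generalizing x with
  | empty =>
    simp only [lmarginal_empty]
    refine Finset.prod_le_prod' fun e _ => ?_
    rw [← ENNReal.rpow_natCast, ← ENNReal.rpow_mul, mul_inv_cancel₀ hD0.ne', ENNReal.rpow_one]
  | insert a s ha ih =>
    have hmeas : Measurable (fun x => ∏ e ∈ E, F e x) :=
      Finset.measurable_prod _ fun e _ => hF e
    rw [lmarginal_insert _ hmeas ha]
    set g : ι → (κ → ℝ) → ℝ≥0∞ := fun e => lmarginal (fun _ => ν) s (fun x => F e x ^ D) with hg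
    have hgm : ∀ e, Measurable (g e) := fun e => Measurable.lmarginal _ ((hF e).pow_const D)
    have hind : ∀ e, a ∉ dep e → ∀ t, g e (Function.update x a t) = g e x := by
      intro e hae t
      simp only [hg, lmarginal]
      congr 1
      ext y
      congr 1
      apply hdep
      intro b hb
      have hba : b ≠ a := fun h => hae (h ▸ hb)
      simp [Function.updateFinset, Function.update_of_ne hba]
    have hins : ∀ e, lmarginal (fun _ => ν) (insert a s) (fun x => F e x ^ D) x =
        ∫⁻ t, g e (Function.update x a t) ∂ν := by
      intro e
      rw [lmarginal_insert _ ((hF e).pow_const D) ha]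
    calc ∫⁻ t, lmarginal (fun _ => ν) s (fun x => ∏ e ∈ E, F e x) (Function.update x a t) ∂ν
        ≤ ∫⁻ t, ∏ e ∈ E, (g e (Function.update x a t)) ^ ((D : ℝ)⁻¹) ∂ν :=
          lintegral_mono fun t => ih _
      _ = ∫⁻ t, (∏ e ∈ E.filter (fun e => ¬ a ∈ dep e), (g e x) ^ ((D : ℝ)⁻¹)) *
            ((1:ℝ≥0∞) ^ (1 - (E.filter (fun e => a ∈ dep e)).card * (D:ℝ)⁻¹) *
              ∏ e ∈ E.filter (fun e => a ∈ dep e), (g e (Function.update x a t)) ^ ((D : ℝ)⁻¹)) ∂ν := by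
          congr 1
          ext t
          rw [ENNReal.one_rpow, one_mul, mul_comm,
            ← Finset.prod_filter_mul_prod_filter_not E (fun e => a ∈ dep e)]
          congr 1
          refine Finset.prod_congr rfl fun e he => ?_
          rw [hind e (Finset.mem_filter.1 he).2]
      _ ≤ (∏ e ∈ E.filter (fun e => ¬ a ∈ dep e), (g e x) ^ ((D : ℝ)⁻¹)) *
            ((∫⁻ _, (1:ℝ≥0∞) ∂ν) ^ (1 - (E.filter (fun e => a ∈ dep e)).card * (D:ℝ)⁻¹) *
              ∏ e ∈ E.filter (fun e => a ∈ dep e),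
                (∫⁻ t, g e (Function.update x a t) ∂ν) ^ ((D : ℝ)⁻¹)) := by
          have hm : ∀ e, Measurable fun t => g e (Function.update x a t) := fun e =>
            (hgm e).comp (measurable_update x)
          rw [lintegral_const_mul]
          swap
          · exact (measurable_const).mul
              (Finset.measurable_prod _ fun e _ => (hm e).pow_const _)
          gcongr
          apply ENNReal.lintegral_mul_prod_norm_pow_le
          · exact aemeasurable_const
          · exact fun e _ => (hm e).aemeasurable
          · simp
          · have h1 : ((E.filter (fun e => a ∈ dep e)).card : ℝ) ≤ D := by exact_mod_cast hdeg a
            have : ((E.filter (fun e => a ∈ dep e)).card : ℝ) * (D:ℝ)⁻¹ ≤ 1 := by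
              rw [← div_eq_mul_inv, div_le_one hD0]; exact h1
            linarith
          · intro e _; positivity
      _ = ∏ e ∈ E, (lmarginal (fun _ => ν) (insert a s) (fun x => F e x ^ D) x) ^ ((D : ℝ)⁻¹) := by
          rw [lintegral_one, measure_univ, ENNReal.one_rpow, one_mul, mul_comm,
            ← Finset.prod_filter_mul_prod_filter_not E (fun e => a ∈ dep e)]
          congr 1
          · refine Finset.prod_congr rfl fun e he => ?_
            rw [hins]
          · refine Finset.prod_congr rfl fun e he => ?_
            rw [hins]
            simp [hind e (Finset.mem_filter.1 he).2]

theorem finner {κ ι : Type*} [Fintype κ] [DecidableEq κ] (ν : Measure ℝ) [IsProbabilityMeasure ν]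
    (E : Finset ι) (F : ι → (κ → ℝ) → ℝ≥0∞) (hF : ∀ e, Measurable (F e))
    (dep : ι → Finset κ)
    (hdep : ∀ e, ∀ x y : κ → ℝ, (∀ a ∈ dep e, x a = y a) → F e x = F e y)
    (D : ℕ) (hD : 1 ≤ D) (hdeg : ∀ a, (E.filter (fun e => a ∈ dep e)).card ≤ D) :
    ∫⁻ x, ∏ e ∈ E, F e x ∂(Measure.pi fun _ : κ => ν) ≤
      ∏ e ∈ E, (∫⁻ x, F e x ^ D ∂(Measure.pi fun _ : κ => ν)) ^ ((D : ℝ)⁻¹) := by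
  have := finner_aux ν E F hF dep hdep D hD hdeg Finset.univ (fun _ => 0)
  simpa only [lmarginal_univ] using this

theorem mp_update {κ : Type*} [Fintype κ] [DecidableEq κ] (ν : Measure ℝ) [IsProbabilityMeasure ν]
    (a : κ) :
    MeasurePreserving (fun z : (κ → ℝ) × ℝ => Function.update z.1 a z.2)
      ((Measure.pi fun _ : κ => ν).prod ν) (Measure.pi fun _ : κ => ν) := by
  have hm : Measurable (fun z : (κ → ℝ) × ℝ => Function.update z.1 a z.2) := by
    rw [measurable_pi_iff]
    intro b
    by_cases hb : b = a
    · subst hb; simpa using measurable_snd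
    · simp only [Function.update_of_ne hb]
      exact (measurable_pi_apply b).comp measurable_fst
  refine ⟨hm, ?_⟩
  symm
  apply Measure.pi_eq
  intro s hs
  rw [Measure.map_apply hm (MeasurableSet.univ_pi hs)]
  have : (fun z : (κ → ℝ) × ℝ => Function.update z.1 a z.2) ⁻¹' (Set.univ.pi s) =
      (Set.univ.pi (Function.update s a Set.univ)) ×ˢ (s a) := by
    ext z
    simp only [Set.mem_preimage, Set.mem_pi, Set.mem_univ, true_implies, Set.mem_prod]
    constructor
    · intro h
      refine ⟨fun b => ?_, by simpa using h a⟩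
      by_cases hb : b = a
      · subst hb; simp
      · simpa [Function.update_of_ne hb] using h b
    · rintro ⟨h, h2⟩ b
      by_cases hb : b = a
      · subst hb; simpa using h2
      · simpa [Function.update_of_ne hb] using h b
  rw [this, Measure.prod_prod, Measure.pi_pi, ← Finset.prod_erase_mul _ _ (Finset.mem_univ a),
    ← Finset.prod_erase_mul (a := a) _ (fun i => ν (s i)) (Finset.mem_univ a)]
  simp only [Function.update_self, measure_univ, mul_one]
  congr 1
  refine Finset.prod_congr rfl fun b hb => ?_
  rw [Function.update_of_ne (Finset.ne_of_mem_erase hb)]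

theorem mp_update2 {κ : Type*} [Fintype κ] [DecidableEq κ] (ν : Measure ℝ) [IsProbabilityMeasure ν]
    (a b : κ) :
    MeasurePreserving (fun z : (κ → ℝ) × (ℝ × ℝ) =>
        Function.update (Function.update z.1 a z.2.1) b z.2.2)
      ((Measure.pi fun _ : κ => ν).prod (ν.prod ν)) (Measure.pi fun _ : κ => ν) := by
  have h1 : MeasurePreserving (MeasurableEquiv.prodAssoc (α := κ → ℝ) (β := ℝ) (γ := ℝ)).symm
      ((Measure.pi fun _ : κ => ν).prod (ν.prod ν))
      (((Measure.pi fun _ : κ => ν).prod ν).prod ν) :=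
    (measurePreserving_prodAssoc _ _ _).symm
  have h2 : MeasurePreserving (fun z : ((κ → ℝ) × ℝ) × ℝ => (Function.update z.1.1 a z.1.2, z.2))
      (((Measure.pi fun _ : κ => ν).prod ν).prod ν)
      ((Measure.pi fun _ : κ => ν).prod ν) :=
    (mp_update ν a).prod (MeasurePreserving.id ν)
  exact ((mp_update ν b).comp h2).comp h1

theorem mp_pair {κ : Type*} [Fintype κ] [DecidableEq κ] (ν : Measure ℝ) [IsProbabilityMeasure ν]
    {a b : κ} (hab : a ≠ b) :
    MeasurePreserving (fun x : κ → ℝ => (x a, x b)) (Measure.pi fun _ : κ => ν) (ν.prod ν) := by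
  have hm : Measurable (fun x : κ → ℝ => (x a, x b)) :=
    (measurable_pi_apply a).prodMk (measurable_pi_apply b)
  refine ⟨hm, ?_⟩
  rw [← (mp_update2 ν a b).map_eq, Measure.map_map hm (mp_update2 ν a b).measurable]
  have : (fun x : κ → ℝ => (x a, x b)) ∘ (fun z : (κ → ℝ) × (ℝ × ℝ) =>
        Function.update (Function.update z.1 a z.2.1) b z.2.2) = Prod.snd := by
    ext z <;> simp [Function.update_of_ne hab]
  rw [this]
  simpa using (measurePreserving_snd (μ := (Measure.pi fun _ : κ => ν)) (ν := ν.prod ν)).map_eq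

end

section
open MeasureTheory Filter Set
open scoped ENNReal NNReal

/-! ### Part B: kernel bounds -/

/-- The product measure on `[0,1]^v`. -/
noncomputable abbrev PV (v : ℕ) : Measure (Fin v → ℝ) := Measure.pi fun _ : Fin v => unif01

/-- The edge set as ordered pairs. -/
def edgeSetF {v : ℕ} (G : SimpleGraph (Fin v)) [DecidableRel G.Adj] : Finset (Fin v × Fin v) :=
  Finset.univ.filter (fun p : Fin v × Fin v => G.Adj p.1 p.2 ∧ p.1 < p.2)

theorem lintegral_pi_prod {κ : Type*} [Fintype κ] (ν : Measure ℝ) [IsProbabilityMeasure ν]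
    (g : κ → ℝ → ℝ≥0∞) (hg : ∀ i, Measurable (g i)) :
    ∫⁻ x, ∏ i, g i (x i) ∂(Measure.pi fun _ : κ => ν) = ∏ i, ∫⁻ t, g i t ∂ν := by
  have h := ProbabilityTheory.iIndepFun_pi (μ := fun _ : κ => ν) (X := g)
    (fun i => (hg i).aemeasurable)
  rw [ProbabilityTheory.lintegral_prod_eq_prod_lintegral_of_indepFun Finset.univ _ h
    (fun i => (hg i).comp (measurable_pi_apply i))]
  refine Finset.prod_congr rfl fun i _ => ?_
  exact (measurePreserving_eval (fun _ : κ => ν) i).lintegral_comp (hg i)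

theorem enorm_fprod {ι : Type*} (s : Finset ι) (f : ι → ℝ) :
    ‖∏ i ∈ s, f i‖ₑ = ∏ i ∈ s, ‖f i‖ₑ := by
  classical
  induction s using Finset.induction_on with
  | empty => simp
  | insert a s ha ih => rw [Finset.prod_insert ha, Finset.prod_insert ha, enorm_mul, ih]

theorem edge_ne {v : ℕ} {G : SimpleGraph (Fin v)} [DecidableRel G.Adj] {e : Fin v × Fin v}
    (he : e ∈ edgeSetF G) : e.1 ≠ e.2 := by
  simp only [edgeSetF, Finset.mem_filter] at he
  exact he.2.2.ne

theorem edge_deg {v : ℕ} (G : SimpleGraph (Fin v)) [DecidableRel G.Adj] (a : Fin v) :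
    ((edgeSetF G).filter (fun e => a ∈ ({e.1, e.2} : Finset (Fin v)))).card ≤ G.maxDegree := by
  refine le_trans ?_ (G.degree_le_maxDegree a)
  rw [← SimpleGraph.card_neighborFinset_eq_degree]
  refine Finset.card_le_card_of_injOn (fun e => if e.1 = a then e.2 else e.1) ?_ ?_
  · intro e he
    simp only [edgeSetF, Finset.coe_filter, Finset.mem_filter, Finset.mem_univ, true_and,
      Finset.mem_insert, Finset.mem_singleton, Set.mem_ofPred_eq] at he
    obtain ⟨⟨h1, h2⟩, h3⟩ := he
    simp only [Finset.mem_coe, SimpleGraph.mem_neighborFinset]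
    split_ifs with h
    · rw [← h]; exact h1
    · rcases h3 with h3 | h3
      · exact absurd h3.symm h
      · rw [h3]; exact h1.symm
  · rintro ⟨e1, e2⟩ he ⟨f1, f2⟩ hf h
    simp only [edgeSetF, Finset.coe_filter, Finset.mem_filter, Finset.mem_univ, true_and,
      Finset.mem_insert, Finset.mem_singleton, Set.mem_ofPred_eq] at he hf h
    obtain ⟨⟨-, h2⟩, h3⟩ := he
    obtain ⟨⟨-, g2⟩, g3⟩ := hf
    simp only [Prod.mk.injEq]
    split_ifs at h with h4 h5 h5 <;> grind

theorem edge_finner {v : ℕ} (G : SimpleGraph (Fin v)) [DecidableRel G.Adj]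
    (hD : 1 ≤ G.maxDegree) (E' : Finset (Fin v × Fin v)) (hE : E' ⊆ edgeSetF G)
    (Φ : Fin v × Fin v → ℝ × ℝ → ℝ≥0∞) (hΦ : ∀ e, Measurable (Φ e)) :
    ∫⁻ x, ∏ e ∈ E', Φ e (x e.1, x e.2) ∂(PV v) ≤
      ∏ e ∈ E', (∫⁻ z, Φ e z ^ G.maxDegree ∂(unif01.prod unif01)) ^ ((G.maxDegree : ℝ)⁻¹) := by
  refine (finner unif01 E' (fun e x => Φ e (x e.1, x e.2)) ?_ (fun e => {e.1, e.2}) ?_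
    G.maxDegree hD ?_).trans (le_of_eq ?_)
  · exact fun e => (hΦ e).comp ((measurable_pi_apply _).prodMk (measurable_pi_apply _))
  · intro e x y h
    simp only [Finset.mem_insert, Finset.mem_singleton, forall_eq_or_imp, forall_eq] at h
    simp only [h.1, h.2]
  · intro a
    refine (Finset.card_le_card ?_).trans (edge_deg G a)
    exact Finset.filter_subset_filter _ hE
  · refine Finset.prod_congr rfl fun e he => ?_
    congr 1
    exact (mp_pair unif01 (edge_ne (hE he))).lintegral_comp ((hΦ e).pow_const _)

theorem edgeProd_meas {v : ℕ} (G : SimpleGraph (Fin v)) [DecidableRel G.Adj]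
    {U : ℝ → ℝ → ℝ} (hU : Measurable (Function.uncurry U)) :
    Measurable (fun x : Fin v → ℝ => edgeProd G (fun a b => U (x a) (x b))) := by
  unfold edgeProd
  refine Finset.measurable_prod _ fun e _ => ?_
  have h : Measurable (fun x : Fin v → ℝ => (x e.1, x e.2)) :=
    (measurable_pi_apply e.1).prodMk (measurable_pi_apply e.2)
  exact hU.comp h

theorem edge_empty {v : ℕ} (G : SimpleGraph (Fin v)) [DecidableRel G.Adj]
    (hD : G.maxDegree = 0) : edgeSetF G = ∅ := by
  rw [Finset.eq_empty_iff_forall_notMem]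
  intro e he
  have h1 := edge_deg G e.1
  rw [hD, Nat.le_zero, Finset.card_eq_zero] at h1
  have : e ∈ ((edgeSetF G).filter (fun e' => e.1 ∈ ({e'.1, e'.2} : Finset (Fin v)))) := by
    simp [he]
  rw [h1] at this
  simp at this

theorem edgeProd_norm {v : ℕ} (G : SimpleGraph (Fin v)) [DecidableRel G.Adj]
    {U : ℝ → ℝ → ℝ} (hU : Measurable (Function.uncurry U)) {q B : ℝ≥0∞} (hq : 1 < q)
    (hB : kerNorm U (q * (G.maxDegree : ℝ≥0∞)) ≤ B) :
    eLpNorm (fun x : Fin v → ℝ => edgeProd G (fun a b => U (x a) (x b))) q (PV v) ≤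
      B ^ (edgeSetF G).card := by
  have hUm : Measurable (fun z : ℝ × ℝ => U z.1 z.2) := hU
  rcases Nat.eq_zero_or_pos G.maxDegree with hD | hD
  · have hE := edge_empty G hD
    have : (fun x : Fin v → ℝ => edgeProd G (fun a b => U (x a) (x b))) = fun _ => 1 := by
      ext x
      simp only [edgeProd]
      change ∏ e ∈ edgeSetF G, _ = _
      rw [hE]; simp
    rw [this, hE, eLpNorm_const _ (by positivity) (NeZero.ne _)]
    simp
  have hD0 : (0:ℝ) < G.maxDegree := by exact_mod_cast hD
  by_cases hqt : q = ⊤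
  · subst hqt
    have hD1 : ((G.maxDegree : ℝ≥0∞)) ≠ 0 := by exact_mod_cast hD.ne'
    rw [ENNReal.top_mul hD1, kerNorm, eLpNorm_exponent_top] at hB
    rw [eLpNorm_exponent_top]
    refine eLpNormEssSup_le_of_ae_enorm_bound ?_
    have hae : ∀ᵐ z ∂(unif01.prod unif01), ‖U z.1 z.2‖ₑ ≤ B := by
      filter_upwards [enorm_ae_le_eLpNormEssSup (fun z : ℝ × ℝ => U z.1 z.2) (unif01.prod unif01)]
        with z hz using hz.trans hB
    have hall : ∀ᵐ x ∂(PV v), ∀ e ∈ edgeSetF G, ‖U (x e.1) (x e.2)‖ₑ ≤ B := by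
      rw [Filter.eventually_all_finset]
      intro e he
      exact (mp_pair unif01 (edge_ne he)).quasiMeasurePreserving.ae hae
    filter_upwards [hall] with x hx
    unfold edgeProd
    change ‖∏ e ∈ edgeSetF G, _‖ₑ ≤ _
    rw [enorm_fprod]
    exact Finset.prod_le_pow_card _ _ _ hx
  · have hq0 : q ≠ 0 := (zero_lt_one.trans hq).ne'
    have hqr : 0 < q.toReal := ENNReal.toReal_pos hq0 hqt
    have hqD : q * (G.maxDegree : ℝ≥0∞) ≠ 0 := by
      simp [hq0, hD.ne']
    have hqDt : q * (G.maxDegree : ℝ≥0∞) ≠ ⊤ := ENNReal.mul_ne_top hqt (by simp)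
    rw [kerNorm, eLpNorm_eq_lintegral_rpow_enorm_toReal hqD hqDt] at hB
    rw [eLpNorm_eq_lintegral_rpow_enorm_toReal hq0 hqt]
    have hF := edge_finner G hD (edgeSetF G) le_rfl (fun _ z => ‖U z.1 z.2‖ₑ ^ q.toReal)
      (fun _ => hUm.enorm.pow_const _)
    have h1 : ∀ x : Fin v → ℝ, ‖edgeProd G (fun a b => U (x a) (x b))‖ₑ ^ q.toReal =
        ∏ e ∈ edgeSetF G, ‖U (x e.1) (x e.2)‖ₑ ^ q.toReal := by
      intro x
      unfold edgeProd
      change ‖∏ e ∈ edgeSetF G, _‖ₑ ^ _ = _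
      rw [enorm_fprod, ENNReal.prod_rpow_of_nonneg hqr.le]
    simp_rw [h1]
    have h2 : ∀ z : ℝ × ℝ, (‖U z.1 z.2‖ₑ ^ q.toReal) ^ G.maxDegree =
        ‖U z.1 z.2‖ₑ ^ (q * (G.maxDegree : ℝ≥0∞)).toReal := by
      intro z
      rw [← ENNReal.rpow_natCast, ← ENNReal.rpow_mul]
      simp
    simp_rw [h2] at hF
    rw [Finset.prod_const] at hF
    calc _ ≤ (((∫⁻ z, ‖U z.1 z.2‖ₑ ^ (q * (G.maxDegree : ℝ≥0∞)).toReal ∂(unif01.prod unif01)) ^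
            ((G.maxDegree : ℝ)⁻¹)) ^ (edgeSetF G).card) ^ (1 / q.toReal) := by gcongr
      _ = ((∫⁻ z, ‖U z.1 z.2‖ₑ ^ (q * (G.maxDegree : ℝ≥0∞)).toReal ∂(unif01.prod unif01)) ^
            (1 / (q * (G.maxDegree : ℝ≥0∞)).toReal)) ^ (edgeSetF G).card := by
          simp only [← ENNReal.rpow_natCast, ← ENNReal.rpow_mul]
          congr 1
          simp only [ENNReal.toReal_mul, ENNReal.toReal_natCast]
          field_simp
      _ ≤ B ^ (edgeSetF G).card := by gcongr

theorem edgeProd_holder {v : ℕ} (G : SimpleGraph (Fin v)) [DecidableRel G.Adj]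
    {U : ℝ → ℝ → ℝ} (hU : Measurable (Function.uncurry U)) {p q B : ℝ≥0∞} (hq : 1 < q)
    (hpq : p⁻¹ + q⁻¹ ≤ 1)
    (hB : kerNorm U (q * (G.maxDegree : ℝ≥0∞)) ≤ B) {h : (Fin v → ℝ) → ℝ} (hh : Measurable h) :
    eLpNorm (fun x : Fin v → ℝ => edgeProd G (fun a b => U (x a) (x b)) * h x) 1 (PV v) ≤
      B ^ (edgeSetF G).card * eLpNorm h p (PV v) := by
  change eLpNorm ((fun x : Fin v → ℝ => edgeProd G (fun a b => U (x a) (x b))) • h) 1 (PV v) ≤ _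
  have hr : 1 ≤ (q⁻¹ + p⁻¹)⁻¹ := by
    rw [add_comm]
    exact ENNReal.one_le_inv.2 hpq
  have : ENNReal.HolderTriple q p (q⁻¹ + p⁻¹)⁻¹ := ⟨by simp⟩
  have hm := edgeProd_meas G hU
  have hn := edgeProd_norm G hU hq hB
  generalize (fun x : Fin v → ℝ => edgeProd G (fun a b => U (x a) (x b))) = φ at hm hn
  generalize B ^ (edgeSetF G).card = K at hn
  have h1 : eLpNorm (φ • h) 1 (PV v) ≤ eLpNorm (φ • h) (q⁻¹ + p⁻¹)⁻¹ (PV v) :=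
    eLpNorm_le_eLpNorm_of_exponent_le hr (hm.mul hh).aestronglyMeasurable
  have h2 : eLpNorm (φ • h) (q⁻¹ + p⁻¹)⁻¹ (PV v) ≤ eLpNorm φ q (PV v) * eLpNorm h p (PV v) :=
    eLpNorm_smul_le_mul_eLpNorm hh.aestronglyMeasurable hm.aestronglyMeasurable
  exact (h1.trans h2).trans (mul_le_mul_left hn _)

/-- Functions with controlled `p`-th moment and tail. -/
def NiceF (r : ℝ) (C δ : ℝ≥0∞) (M : ℝ) (f : ℝ → ℝ) : Prop :=
  ∫⁻ u, ‖f u‖ₑ ^ r ∂unif01 ≤ C ∧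
  ∫⁻ u, (if M < |f u| then ‖f u‖ₑ ^ r else 0) ∂unif01 ≤ δ

theorem prod_eLpNorm {v : ℕ} {p : ℝ≥0∞} (hp0 : p ≠ 0) (hpt : p ≠ ⊤) {f : ℝ → ℝ}
    (hf : Measurable f) :
    eLpNorm (fun x : Fin v → ℝ => ∏ a, f (x a)) p (PV v) =
      ((∫⁻ u, ‖f u‖ₑ ^ p.toReal ∂unif01) ^ v) ^ (1 / p.toReal) := by
  rw [eLpNorm_eq_lintegral_rpow_enorm_toReal hp0 hpt]
  congr 1
  have : ∀ x : Fin v → ℝ, ‖∏ a, f (x a)‖ₑ ^ p.toReal = ∏ a, ‖f (x a)‖ₑ ^ p.toReal := by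
    intro x
    rw [enorm_fprod, ENNReal.prod_rpow_of_nonneg ENNReal.toReal_nonneg]
  simp_rw [this]
  rw [lintegral_pi_prod unif01 (fun _ t => ‖f t‖ₑ ^ p.toReal) (fun _ => hf.enorm.pow_const _)]
  simp

theorem prod_meas {v : ℕ} {f : ℝ → ℝ} (hf : Measurable f) :
    Measurable (fun x : Fin v → ℝ => ∏ a, f (x a)) :=
  Finset.measurable_prod _ fun a _ => hf.comp (measurable_pi_apply a)

/-- integrability of the integrand of `G1`. -/
theorem G1_integrable {v : ℕ} (G : SimpleGraph (Fin v)) [DecidableRel G.Adj]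
    {U : ℝ → ℝ → ℝ} (hU : Measurable (Function.uncurry U)) {p q B : ℝ≥0∞} (hp : 1 ≤ p)
    (hpt : p ≠ ⊤) (hq : 1 < q)
    (hpq : p⁻¹ + q⁻¹ ≤ 1)
    (hB : kerNorm U (q * (G.maxDegree : ℝ≥0∞)) ≤ B) (hBt : B ≠ ⊤) {f : ℝ → ℝ} (hf : Measurable f)
    (hfp : ∫⁻ u, ‖f u‖ₑ ^ p.toReal ∂unif01 ≠ ⊤) :
    Integrable (fun x : Fin v → ℝ => edgeProd G (fun a b => U (x a) (x b)) * ∏ a, f (x a)) (PV v) := by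
  rw [← memLp_one_iff_integrable]
  refine ⟨((edgeProd_meas G hU).mul (prod_meas hf)).aestronglyMeasurable, ?_⟩
  refine (edgeProd_holder G hU hq hpq hB (prod_meas hf)).trans_lt ?_
  rw [prod_eLpNorm (zero_lt_one.trans_le hp).ne' hpt hf]
  refine ENNReal.mul_lt_top (ENNReal.pow_lt_top hBt.lt_top) ?_
  refine ENNReal.rpow_lt_top_of_nonneg (by positivity) ?_
  exact ENNReal.pow_ne_top hfp

/-- Truncation of a function. -/
noncomputable def truncF (M : ℝ) (f : ℝ → ℝ) : ℝ → ℝ := fun u => if M < |f u| then 0 else f u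

theorem truncF_meas {M : ℝ} {f : ℝ → ℝ} (hf : Measurable f) : Measurable (truncF M f) :=
  Measurable.ite (measurableSet_lt measurable_const (_root_.measurable_abs.comp hf)) measurable_const hf

theorem truncF_norm {v : ℕ} {p : ℝ≥0∞} (hp : 1 ≤ p) (hpt : p ≠ ⊤) {f : ℝ → ℝ}
    (hf : Measurable f) {C δ : ℝ≥0∞} {M : ℝ} (hN : NiceF p.toReal C δ M f) :
    eLpNorm (fun x : Fin v → ℝ => ∏ a, f (x a) - ∏ a, truncF M f (x a)) p (PV v) ≤
      (v * (δ * C ^ (v - 1))) ^ (1 / p.toReal) := by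
  have hp0 : p ≠ 0 := (zero_lt_one.trans_le hp).ne'
  have hr : 0 < p.toReal := ENNReal.toReal_pos hp0 hpt
  rw [eLpNorm_eq_lintegral_rpow_enorm_toReal hp0 hpt]
  gcongr
  set g : ℝ → ℝ≥0∞ := fun u => ‖f u‖ₑ ^ p.toReal with hg
  set k : ℝ → ℝ≥0∞ := fun u => if M < |f u| then ‖f u‖ₑ ^ p.toReal else 0 with hk
  have hgm : Measurable g := hf.enorm.pow_const _
  have hkm : Measurable k :=
    Measurable.ite (measurableSet_lt measurable_const (_root_.measurable_abs.comp hf)) hgm measurable_const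
  have hpt' : ∀ x : Fin v → ℝ, ‖∏ a, f (x a) - ∏ a, truncF M f (x a)‖ₑ ^ p.toReal ≤
      ∑ c : Fin v, ∏ a, (if a = c then k else g) (x a) := by
    intro x
    by_cases h : ∃ c, M < |f (x c)|
    · obtain ⟨c, hc⟩ := h
      have h0 : ∏ a, truncF M f (x a) = 0 :=
        Finset.prod_eq_zero (Finset.mem_univ c) (by simp [truncF, hc])
      rw [h0, sub_zero, enorm_fprod, ← ENNReal.prod_rpow_of_nonneg hr.le]
      refine le_trans (le_of_eq ?_) (Finset.single_le_sum (fun _ _ => zero_le) (Finset.mem_univ c))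
      refine Finset.prod_congr rfl fun a _ => ?_
      split_ifs with hac
      · subst hac; simp [hk, hc]
      · rfl
    · push Not at h
      have h0 : ∏ a, truncF M f (x a) = ∏ a, f (x a) := by
        refine Finset.prod_congr rfl fun a _ => ?_
        simp [truncF, not_lt.2 (h a)]
      rw [h0, sub_self, enorm_zero, ENNReal.zero_rpow_of_pos hr]
      exact zero_le
  calc ∫⁻ x, ‖∏ a, f (x a) - ∏ a, truncF M f (x a)‖ₑ ^ p.toReal ∂(PV v)
      ≤ ∫⁻ x, ∑ c : Fin v, ∏ a, (if a = c then k else g) (x a) ∂(PV v) := lintegral_mono hpt'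
    _ = ∑ c : Fin v, ∏ a : Fin v, ∫⁻ t, (if a = c then k else g) t ∂unif01 := by
        rw [lintegral_finsetSum]
        · refine Finset.sum_congr rfl fun c _ => ?_
          exact lintegral_pi_prod unif01 _ (fun a => by split_ifs <;> assumption)
        · intro c _
          refine Finset.measurable_prod _ fun a _ => ?_
          have : Measurable (if a = c then k else g) := by split_ifs <;> assumption
          exact this.comp (measurable_pi_apply a)
    _ ≤ ∑ c : Fin v, δ * C ^ (v - 1) := by
        refine Finset.sum_le_sum fun c _ => ?_
        rw [← Finset.mul_prod_erase _ _ (Finset.mem_univ c)]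
        simp only [if_true]
        gcongr
        · exact hN.2
        · refine (Finset.prod_le_pow_card _ _ C fun a ha => ?_).trans ?_
          · rw [if_neg (Finset.ne_of_mem_erase ha)]; exact hN.1
          · simp [Finset.card_erase_of_mem]
    _ = v * (δ * C ^ (v - 1)) := by simp

theorem truncF_G1 {v : ℕ} (G : SimpleGraph (Fin v)) [DecidableRel G.Adj]
    {U : ℝ → ℝ → ℝ} (hU : Measurable (Function.uncurry U)) {p q B : ℝ≥0∞} (hp : 1 ≤ p)
    (hpt : p ≠ ⊤) (hq : 1 < q)
    (hpq : p⁻¹ + q⁻¹ ≤ 1)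
    (hB : kerNorm U (q * (G.maxDegree : ℝ≥0∞)) ≤ B) (hBt : B ≠ ⊤) {f : ℝ → ℝ} (hf : Measurable f)
    {C δ : ℝ≥0∞} {M : ℝ} (hC : C ≠ ⊤) (hN : NiceF p.toReal C δ M f) :
    ‖G1 G U f - G1 G U (truncF M f)‖ₑ ≤
      B ^ (edgeSetF G).card * (v * (δ * C ^ (v - 1))) ^ (1 / p.toReal) := by
  have hp0 : p ≠ 0 := (zero_lt_one.trans_le hp).ne'
  have hr : 0 < p.toReal := ENNReal.toReal_pos hp0 hpt
  have h1 : ∫⁻ u, ‖f u‖ₑ ^ p.toReal ∂unif01 ≠ ⊤ := (hN.1.trans_lt hC.lt_top).ne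
  have h2 : ∫⁻ u, ‖truncF M f u‖ₑ ^ p.toReal ∂unif01 ≠ ⊤ := by
    refine ((lintegral_mono fun u => ?_).trans_lt h1.lt_top).ne
    gcongr
    unfold truncF
    split_ifs <;> simp
  unfold G1
  rw [← integral_sub (G1_integrable G hU hp hpt hq hpq hB hBt hf h1)
    (G1_integrable G hU hp hpt hq hpq hB hBt (truncF_meas hf) h2)]
  refine (enorm_integral_le_lintegral_enorm _).trans ?_
  rw [← eLpNorm_one_eq_lintegral_enorm]
  simp_rw [← mul_sub]
  refine (edgeProd_holder G hU hq hpq hB ((prod_meas hf).sub (prod_meas (truncF_meas hf)))).trans ?_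
  gcongr
  exact truncF_norm hp hpt hf hN

end

section
open MeasureTheory Filter Set
open scoped ENNReal NNReal

/-! ### Part C: the counting lemma for bounded functions -/

/-- cut norm at most `η`. -/
def CutLe (D : ℝ → ℝ → ℝ) (η : ℝ) : Prop :=
  ∀ S T : Set ℝ, MeasurableSet S → MeasurableSet T →
    |∫ x in S, ∫ y in T, D x y ∂unif01 ∂unif01| ≤ η

theorem set_to_fun {k g : ℝ → ℝ} (hk : Integrable k unif01) {η K : ℝ}
    (h : ∀ S : Set ℝ, MeasurableSet S → |∫ x in S, k x ∂unif01| ≤ η)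
    (hgK : ∀ x, |g x| ≤ K) : |∫ x, k x * g x ∂unif01| ≤ 2 * K * η := by
  have hK : 0 ≤ K := (abs_nonneg _).trans (hgK 0)
  have hη : 0 ≤ η := (abs_nonneg _).trans (h ∅ MeasurableSet.empty)
  -- pass to a measurable version
  obtain ⟨k', hk'm, hkk'⟩ := hk.aestronglyMeasurable
  have hk' : Integrable k' unif01 := hk.congr hkk'
  have h' : ∀ S : Set ℝ, MeasurableSet S → |∫ x in S, k' x ∂unif01| ≤ η := by
    intro S hS
    rw [← integral_congr_ae (ae_restrict_of_ae hkk')]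
    exact h S hS
  have hintg : ∫ x, ‖k' x‖ ∂unif01 ≤ 2 * η := by
    rw [integral_norm_eq_pos_sub_neg hk']
    have h1 := h' {x | 0 ≤ k' x} (measurableSet_le measurable_const hk'm.measurable)
    have h2 := h' {x | k' x ≤ 0} (measurableSet_le hk'm.measurable measurable_const)
    have := abs_le.1 h1
    have := abs_le.1 h2
    linarith
  have e1 : ∫ x, k x * g x ∂unif01 = ∫ x, k' x * g x ∂unif01 := by
    refine integral_congr_ae ?_
    filter_upwards [hkk'] with x hx
    rw [hx]
  rw [e1, ← Real.norm_eq_abs]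
  calc ‖∫ x, k' x * g x ∂unif01‖ ≤ ∫ x, ‖k' x‖ * K ∂unif01 := by
        refine norm_integral_le_of_norm_le (hk'.norm.mul_const K) (Eventually.of_forall fun x => ?_)
        rw [norm_mul]
        exact mul_le_mul_of_nonneg_left (hgK x) (norm_nonneg _)
    _ = (∫ x, ‖k' x‖ ∂unif01) * K := integral_mul_const _ _
    _ ≤ 2 * η * K := by gcongr
    _ = 2 * K * η := by ring

theorem cut_bilinear {D : ℝ → ℝ → ℝ}
    (hDi : Integrable (fun z : ℝ × ℝ => D z.1 z.2) (unif01.prod unif01)) {η : ℝ}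
    (hD : CutLe D η) {g h : ℝ → ℝ} (hg : Measurable g) (hh : Measurable h) {K1 K2 : ℝ}
    (hgK : ∀ x, |g x| ≤ K1) (hhK : ∀ x, |h x| ≤ K2) :
    |∫ z, D z.1 z.2 * (g z.1 * h z.2) ∂(unif01.prod unif01)| ≤ 4 * K1 * K2 * η := by
  have hgi : Integrable (fun z : ℝ × ℝ => D z.1 z.2 * g z.1) (unif01.prod unif01) := by
    refine hDi.mul_bdd (c := K1) (hg.comp measurable_fst).aestronglyMeasurable ?_
    exact Eventually.of_forall fun z => hgK z.1
  have hghi : Integrable (fun z : ℝ × ℝ => D z.1 z.2 * (g z.1 * h z.2)) (unif01.prod unif01) := by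
    have := hgi.mul_bdd (hh.comp measurable_snd).aestronglyMeasurable
      (Eventually.of_forall fun z : ℝ × ℝ => hhK z.2)
    refine this.congr (Eventually.of_forall fun z => ?_)
    simp only [Function.comp, mul_assoc]
  have step1 : ∀ T : Set ℝ, MeasurableSet T →
      |∫ x, (∫ y in T, D x y ∂unif01) * g x ∂unif01| ≤ 2 * K1 * η := by
    intro T hT
    refine set_to_fun ?_ (fun S hS => hD S T hS hT) hgK
    have : Integrable (fun z : ℝ × ℝ => D z.1 z.2) (unif01.prod (unif01.restrict T)) := by
      have h1 : unif01.prod (unif01.restrict T) = (unif01.prod unif01).restrict (Set.univ ×ˢ T) := by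
        rw [← Measure.prod_restrict, Measure.restrict_univ]
      rw [h1]; exact hDi.restrict
    exact this.integral_prod_left
  have step2 : ∀ T : Set ℝ, MeasurableSet T →
      |∫ y in T, (∫ x, D x y * g x ∂unif01) ∂unif01| ≤ 2 * K1 * η := by
    intro T hT
    have hi : Integrable (Function.uncurry fun x y => D x y * g x)
        (unif01.prod (unif01.restrict T)) := by
      have h1 : unif01.prod (unif01.restrict T) = (unif01.prod unif01).restrict (Set.univ ×ˢ T) := by
        rw [← Measure.prod_restrict, Measure.restrict_univ]
      rw [h1]; exact hgi.restrict
    rw [← integral_integral_swap hi]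
    have := step1 T hT
    simp_rw [integral_mul_const]
    exact this
  have hfin := set_to_fun (k := fun y => ∫ x, D x y * g x ∂unif01)
    (by exact hgi.integral_prod_right) step2 hhK
  rw [integral_prod_symm _ hghi]
  have e : ∀ y, ∫ x, D x y * (g x * h y) ∂unif01 = (∫ x, D x y * g x ∂unif01) * h y := by
    intro y
    rw [← integral_mul_const]
    simp only [mul_assoc]
  simp only [e]
  calc _ ≤ _ := hfin
    _ = _ := by ring

theorem abs_fprod_le {ι : Type*} (s : Finset ι) (f : ι → ℝ) {A : ℝ} (hA : 1 ≤ A) {N : ℕ}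
    (hs : s.card ≤ N) (hf : ∀ i ∈ s, |f i| ≤ A) : |∏ i ∈ s, f i| ≤ A ^ N := by
  rw [Finset.abs_prod]
  calc ∏ i ∈ s, |f i| ≤ ∏ i ∈ s, A := Finset.prod_le_prod (fun _ _ => abs_nonneg _) hf
    _ = A ^ s.card := by simp
    _ ≤ A ^ N := pow_le_pow_right₀ hA hs

theorem pair_meas {v : ℕ} {U : ℝ → ℝ → ℝ} (hU : Measurable (Function.uncurry U)) (a b : Fin v) :
    Measurable (fun x : Fin v → ℝ => U (x a) (x b)) := by
  have h : Measurable (fun x : Fin v → ℝ => (x a, x b)) :=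
    (measurable_pi_apply a).prodMk (measurable_pi_apply b)
  exact hU.comp h

/-- The main term in the counting lemma. -/
theorem count_main {v : ℕ} (G : SimpleGraph (Fin v)) [DecidableRel G.Adj]
    {D : ℝ → ℝ → ℝ} (hDm : Measurable (Function.uncurry D))
    (hDi : Integrable (fun z : ℝ × ℝ => D z.1 z.2) (unif01.prod unif01)) {η : ℝ}
    (hD : CutLe D η) (T : Fin v × Fin v → ℝ → ℝ → ℝ)
    (hT : ∀ e, Measurable (Function.uncurry (T e))) {A M : ℝ} (hA : 1 ≤ A) (hM : 1 ≤ M)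
    (hTA : ∀ e x y, |T e x y| ≤ A) {f : ℝ → ℝ} (hf : Measurable f) (hfM : ∀ x, |f x| ≤ M)
    {e0 : Fin v × Fin v} (he0 : e0 ∈ edgeSetF G) :
    |∫ x, D (x e0.1) (x e0.2) * (∏ e ∈ (edgeSetF G).erase e0, T e (x e.1) (x e.2)) *
        ∏ a, f (x a) ∂(PV v)| ≤
      4 * (A ^ (edgeSetF G).card * M ^ v) * (A ^ (edgeSetF G).card * M ^ v) * η := by
  classical
  set E := edgeSetF G with hE
  set K := A ^ E.card * M ^ v with hK
  have hne := edge_ne he0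
  set a0 := e0.1
  set b0 := e0.2
  set E1 := (E.erase e0).filter (fun e => ¬ (e.1 = b0 ∨ e.2 = b0)) with hE1
  set E2 := (E.erase e0).filter (fun e => (e.1 = b0 ∨ e.2 = b0)) with hE2
  let g : (Fin v → ℝ) → ℝ := fun x => (∏ e ∈ E1, T e (x e.1) (x e.2)) *
    ∏ a ∈ Finset.univ.erase b0, f (x a)
  let h : (Fin v → ℝ) → ℝ := fun x => (∏ e ∈ E2, T e (x e.1) (x e.2)) * f (x b0)
  have hgm : Measurable g :=
    (Finset.measurable_prod _ fun e _ => pair_meas (hT e) _ _).mul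
      (Finset.measurable_prod _ fun a _ => hf.comp (measurable_pi_apply a))
  have hhm : Measurable h :=
    (Finset.measurable_prod _ fun e _ => pair_meas (hT e) _ _).mul
      (hf.comp (measurable_pi_apply b0))
  have hK0 : 0 ≤ K := by positivity
  have hc1 : E1.card ≤ E.card := Finset.card_le_card
    ((Finset.filter_subset _ _).trans (Finset.erase_subset _ _))
  have hc2 : E2.card ≤ E.card := Finset.card_le_card
    ((Finset.filter_subset _ _).trans (Finset.erase_subset _ _))
  have hv : 1 ≤ v := Nat.one_le_iff_ne_zero.2 (by rintro rfl; exact a0.elim0)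
  have hgK : ∀ x, |g x| ≤ K := by
    intro x
    simp only [g, abs_mul]
    refine mul_le_mul (abs_fprod_le _ _ hA hc1 fun e _ => hTA _ _ _)
      (abs_fprod_le _ _ hM ?_ fun a _ => hfM _) (abs_nonneg _) (by positivity)
    exact (Finset.card_le_univ _).trans (by simp)
  have hhK : ∀ x, |h x| ≤ K := by
    intro x
    simp only [h, abs_mul]
    refine mul_le_mul (abs_fprod_le _ _ hA hc2 fun e _ => hTA _ _ _)
      ((hfM _).trans ?_) (abs_nonneg _) (by positivity)
    exact le_self_pow₀ hM (by omega)
  have hdecomp : ∀ x : Fin v → ℝ, D (x a0) (x b0) * (∏ e ∈ E.erase e0, T e (x e.1) (x e.2)) *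
        ∏ a, f (x a) = D (x a0) (x b0) * (g x * h x) := by
    intro x
    rw [← Finset.prod_filter_mul_prod_filter_not (E.erase e0) (fun e => (e.1 = b0 ∨ e.2 = b0)),
      ← Finset.prod_erase_mul _ _ (Finset.mem_univ b0)]
    simp only [g, h, hE1, hE2]
    ring
  have hgind : ∀ (x : Fin v → ℝ) (s t : ℝ),
      g (Function.update (Function.update x a0 s) b0 t) = g (Function.update x a0 s) := by
    intro x s t
    simp only [g]
    congr 1
    · refine Finset.prod_congr rfl fun e he => ?_
      have := (Finset.mem_filter.1 he).2
      push Not at this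
      rw [Function.update_of_ne this.1, Function.update_of_ne this.2]
    · refine Finset.prod_congr rfl fun a ha => ?_
      rw [Function.update_of_ne (Finset.ne_of_mem_erase ha)]
  have hhind : ∀ (x : Fin v → ℝ) (s t : ℝ),
      h (Function.update (Function.update x a0 s) b0 t) = h (Function.update x b0 t) := by
    intro x s t
    simp only [h]
    rw [Function.update_comm hne]
    congr 1
    · refine Finset.prod_congr rfl fun e he => ?_
      have h1 := Finset.mem_filter.1 he
      have h2 : e ≠ e0 := Finset.ne_of_mem_erase h1.1
      have h3 : e ∈ E := Finset.mem_of_mem_erase h1.1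
      have ho : e0.1 < e0.2 := by
        simp only [hE, edgeSetF, Finset.mem_filter] at he0; exact he0.2.2
      have ho' : e.1 < e.2 := by
        simp only [hE, edgeSetF, Finset.mem_filter] at h3; exact h3.2.2
      have h4 : e.1 ≠ a0 ∧ e.2 ≠ a0 := by
        rcases h1.2 with h5 | h5
        · refine ⟨fun h6 => hne (h6.symm.trans h5), fun h6 => ?_⟩
          have q1 : e.2 = e0.1 := h6
          have q2 : e.1 = e0.2 := h5
          rw [q1, q2] at ho'
          exact absurd ho (not_lt.2 ho'.le)
        · refine ⟨fun h6 => h2 (Prod.ext h6 h5), fun h6 => hne (h6.symm.trans h5)⟩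
      rw [Function.update_of_ne h4.1, Function.update_of_ne h4.2]
    · rw [Function.update_of_ne hne.symm]
  have hDip : Integrable (fun x : Fin v → ℝ => D (x a0) (x b0)) (PV v) :=
    (mp_pair unif01 hne).integrable_comp_of_integrable hDi
  have hintg : Integrable (fun x : Fin v → ℝ => D (x a0) (x b0) * (g x * h x)) (PV v) := by
    refine hDip.mul_bdd (c := K * K) (hgm.mul hhm).aestronglyMeasurable (Eventually.of_forall fun x => ?_)
    rw [Real.norm_eq_abs, abs_mul]
    exact mul_le_mul (hgK x) (hhK x) (abs_nonneg _) hK0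
  rw [integral_congr_ae (Eventually.of_forall hdecomp)]
  have hmp := mp_update2 (κ := Fin v) unif01 a0 b0
  change |∫ a : Fin v → ℝ, D (a a0) (a b0) * (g a * h a) ∂(Measure.pi fun _ : Fin v => unif01)| ≤ _
  rw [← hmp.map_eq, integral_map hmp.measurable.aemeasurable (by rw [hmp.map_eq]; exact hintg.1)]
  have hintg2 := hmp.integrable_comp_of_integrable hintg
  have hip := integral_prod _ hintg2
  simp only [Function.comp] at hip
  rw [hip]
  have hin : ∀ x : Fin v → ℝ, |∫ z : ℝ × ℝ,
      (D ((Function.update (Function.update x a0 z.1) b0 z.2) a0)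
          ((Function.update (Function.update x a0 z.1) b0 z.2) b0) *
        (g (Function.update (Function.update x a0 z.1) b0 z.2) *
          h (Function.update (Function.update x a0 z.1) b0 z.2))) ∂(unif01.prod unif01)| ≤
      4 * K * K * η := by
    intro x
    simp only [hgind, hhind, Function.update_self, Function.update_of_ne hne]
    exact cut_bilinear hDi hD (g := fun s => g (Function.update x a0 s))
      (h := fun t => h (Function.update x b0 t)) (hgm.comp (measurable_update x))
      (hhm.comp (measurable_update x)) (fun s => hgK _) (fun t => hhK _)
  rw [← Real.norm_eq_abs]
  refine (norm_integral_le_of_norm_le_const (C := 4 * K * K * η)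
    (Eventually.of_forall fun x => ?_)).trans ?_
  · exact hin x
  · simp

end

section
open MeasureTheory Filter Set
open scoped ENNReal NNReal

/-- truncation of a kernel -/
noncomputable def truncK (A : ℝ) (V : ℝ → ℝ → ℝ) : ℝ → ℝ → ℝ := fun x y => if A < |V x y| then 0 else V x y

theorem truncK_meas {A : ℝ} {V : ℝ → ℝ → ℝ} (hV : Measurable (Function.uncurry V)) :
    Measurable (Function.uncurry (truncK A V)) :=
  Measurable.ite (measurableSet_lt measurable_const (_root_.measurable_abs.comp hV))
    measurable_const hV

theorem truncK_le {A : ℝ} (hA : 0 ≤ A) (V : ℝ → ℝ → ℝ) (x y : ℝ) : |truncK A V x y| ≤ A := by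
  unfold truncK
  split_ifs with h
  · simpa using hA
  · exact not_lt.1 h

theorem large_pow {A s t : ℝ} (hA : 1 ≤ A) (hs : 1 < s) (ht : A < |t|) :
    ‖t‖ₑ ≤ ENNReal.ofReal (A ^ (1 - s)) * ‖t‖ₑ ^ s := by
  have h0 : 0 < |t| := by linarith
  rw [← ofReal_norm_eq_enorm, Real.norm_eq_abs, ENNReal.ofReal_rpow_of_pos h0,
    ← ENNReal.ofReal_mul (by positivity)]
  refine ENNReal.ofReal_le_ofReal ?_
  have h1 : |t| = |t| ^ (1 - s) * |t| ^ s := by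
    rw [← Real.rpow_add h0]; simp
  nth_rewrite 1 [h1]
  refine mul_le_mul_of_nonneg_right ?_ (by positivity)
  exact Real.rpow_le_rpow_of_nonpos (by linarith) ht.le (by linarith)

theorem prod_trunc_diff {v : ℕ} (E : Finset (Fin v × Fin v)) (V : Fin v × Fin v → ℝ → ℝ → ℝ)
    {A s : ℝ} (hA : 1 ≤ A) (hs : 1 < s) (x : Fin v → ℝ) :
    ‖(∏ e ∈ E, V e (x e.1) (x e.2)) - ∏ e ∈ E, truncK A (V e) (x e.1) (x e.2)‖ₑ ≤
      ∑ e1 ∈ E, ∏ e ∈ E, (if e = e1 then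
        ENNReal.ofReal (A ^ (1 - s)) * ‖V e (x e.1) (x e.2)‖ₑ ^ s else ‖V e (x e.1) (x e.2)‖ₑ) := by
  by_cases h : ∃ e1 ∈ E, A < |V e1 (x e1.1) (x e1.2)|
  · obtain ⟨e1, he1, hlt⟩ := h
    rw [Finset.prod_eq_zero (f := fun e => truncK A (V e) (x e.1) (x e.2)) he1
      (by simp only [truncK, if_pos hlt]), sub_zero, enorm_fprod]
    refine le_trans ?_ (Finset.single_le_sum (f := fun e1 => ∏ e ∈ E, (if e = e1 then
        ENNReal.ofReal (A ^ (1 - s)) * ‖V e (x e.1) (x e.2)‖ₑ ^ s else ‖V e (x e.1) (x e.2)‖ₑ))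
        (fun _ _ => zero_le) he1)
    refine Finset.prod_le_prod' fun e he => ?_
    split_ifs with h
    · subst h; exact large_pow hA hs hlt
    · exact le_rfl
  · push Not at h
    rw [Finset.prod_congr rfl fun e he => show V e (x e.1) (x e.2) = truncK A (V e) (x e.1) (x e.2)
      from (by simp only [truncK, if_neg (not_lt.2 (h e he))])]
    simp

theorem lint_pow_le {V : ℝ → ℝ → ℝ} {Δ : ℕ} (hΔ : 1 ≤ Δ)
    {r : ℝ} (hr : 0 < r) {B : ℝ≥0∞} (hB : kerNorm V (ENNReal.ofReal r * Δ) ≤ B) :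
    (∫⁻ z, (‖V z.1 z.2‖ₑ ^ r) ^ Δ ∂(unif01.prod unif01)) ^ ((Δ : ℝ)⁻¹) ≤ B ^ r := by
  have h0 : (ENNReal.ofReal r * Δ : ℝ≥0∞) ≠ 0 := by
    simp [hr]; omega
  have h1 : (ENNReal.ofReal r * Δ : ℝ≥0∞) ≠ ⊤ := ENNReal.mul_ne_top ENNReal.ofReal_ne_top (by simp)
  have hΔ' : (0:ℝ) < Δ := by exact_mod_cast hΔ
  rw [kerNorm, eLpNorm_eq_lintegral_rpow_enorm_toReal h0 h1] at hB
  simp only [ENNReal.toReal_mul, ENNReal.toReal_ofReal hr.le, ENNReal.toReal_natCast] at hB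
  have := ENNReal.rpow_le_rpow hB hr.le
  rw [← ENNReal.rpow_mul] at this
  refine le_trans (le_of_eq ?_) this
  have e : 1 / (r * Δ) * r = (Δ:ℝ)⁻¹ := by field_simp
  rw [e]
  congr 2
  ext z
  rw [ENNReal.rpow_mul, ENNReal.rpow_natCast]

/-- remainder term -/
theorem count_rem {v : ℕ} (G : SimpleGraph (Fin v)) [DecidableRel G.Adj] (hΔ : 1 ≤ G.maxDegree)
    {D : ℝ → ℝ → ℝ} (hDm : Measurable (Function.uncurry D))
    (V : Fin v × Fin v → ℝ → ℝ → ℝ)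
    (hV : ∀ e, Measurable (Function.uncurry (V e))) {A s : ℝ} (hA : 1 ≤ A) (hs : 1 < s) (hs2 : s ≤ 2)
    {B : ℝ≥0∞} (hB1 : 1 ≤ B) (hD : kerNorm D G.maxDegree ≤ 2 * B)
    (hV1 : ∀ e, kerNorm (V e) G.maxDegree ≤ B)
    (hVs : ∀ e, kerNorm (V e) (ENNReal.ofReal s * G.maxDegree) ≤ B)
    {e0 : Fin v × Fin v} (he0 : e0 ∈ edgeSetF G) :
    ∫⁻ x, ‖D (x e0.1) (x e0.2)‖ₑ * ‖(∏ e ∈ (edgeSetF G).erase e0, V e (x e.1) (x e.2)) -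
      ∏ e ∈ (edgeSetF G).erase e0, truncK A (V e) (x e.1) (x e.2)‖ₑ ∂(PV v) ≤
      (edgeSetF G).card * (ENNReal.ofReal (A ^ (1 - s)) * (2 * B ^ 2) ^ (edgeSetF G).card) := by
  classical
  set E := edgeSetF G
  set c := ENNReal.ofReal (A ^ (1 - s))
  let Φ : Fin v × Fin v → Fin v × Fin v → ℝ × ℝ → ℝ≥0∞ := fun e1 e z =>
    if e = e0 then ‖D z.1 z.2‖ₑ else if e = e1 then c * ‖V e z.1 z.2‖ₑ ^ s else ‖V e z.1 z.2‖ₑ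
  have hDm' : Measurable (fun z : ℝ × ℝ => D z.1 z.2) := hDm
  have hVm' : ∀ e, Measurable (fun z : ℝ × ℝ => V e z.1 z.2) := hV
  have hΦ : ∀ e1 e, Measurable (Φ e1 e) := by
    intro e1 e
    simp only [Φ]
    split_ifs
    · exact hDm'.enorm
    · exact ((hVm' e).enorm.pow_const s).const_mul c
    · exact (hVm' e).enorm
  have hΔ' : (0:ℝ) < G.maxDegree := by exact_mod_cast hΔ
  have hone : ∀ {K : ℝ → ℝ → ℝ} {B : ℝ≥0∞}, kerNorm K G.maxDegree ≤ B →
      (∫⁻ z, ‖K z.1 z.2‖ₑ ^ G.maxDegree ∂(unif01.prod unif01)) ^ ((G.maxDegree : ℝ)⁻¹) ≤ B := by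
    intro K B h
    have := lint_pow_le (V := K) hΔ one_pos (B := B) (by simpa using h)
    simpa using this
  have hBB : B ≤ B ^ 2 := by rw [sq]; exact le_mul_of_one_le_right' hB1
  have h2B : B ^ 2 ≤ 2 * B ^ 2 := le_mul_of_one_le_left' one_le_two
  have key : ∀ e1 ∈ E.erase e0, ∫⁻ x, ∏ e ∈ E, Φ e1 e (x e.1, x e.2) ∂(PV v) ≤
      c * (2 * B ^ 2) ^ E.card := by
    intro e1 he1
    refine (edge_finner G hΔ E (Finset.Subset.refl _) (Φ e1) (hΦ e1)).trans ?_
    have : ∀ e ∈ E, (∫⁻ z, Φ e1 e z ^ G.maxDegree ∂(unif01.prod unif01)) ^ ((G.maxDegree : ℝ)⁻¹) ≤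
        (if e = e1 then c else 1) * (2 * B ^ 2) := by
      intro e he
      simp only [Φ]
      by_cases h0 : e = e0
      · have h01 : e ≠ e1 := by rw [h0]; exact (Finset.ne_of_mem_erase he1).symm
        simp only [h0, if_true]
        rw [if_neg (by rw [← h0]; exact h01), one_mul]
        refine (hone hD).trans ?_
        gcongr
      · simp only [h0, if_false]
        by_cases h1 : e = e1
        · simp only [h1, if_true]
          simp only [mul_pow]
          rw [lintegral_const_mul _ ((((hVm' e1).enorm.pow_const s)).pow_const _),
            ENNReal.mul_rpow_of_nonneg _ _ (by positivity),
            ← ENNReal.rpow_natCast, ← ENNReal.rpow_mul, mul_inv_cancel₀ hΔ'.ne', ENNReal.rpow_one]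
          gcongr
          refine (lint_pow_le hΔ (by linarith) (hVs e1)).trans ?_
          refine (ENNReal.rpow_le_rpow_of_exponent_le hB1 hs2).trans ?_
          exact_mod_cast h2B
        · simp only [h1, if_false, one_mul]
          exact (hone (hV1 e)).trans (hBB.trans h2B)
    refine (Finset.prod_le_prod' this).trans ?_
    rw [Finset.prod_mul_distrib, Finset.prod_ite_eq' E e1, if_pos (Finset.mem_of_mem_erase he1)]
    simp
  have hpt : ∀ x : Fin v → ℝ, ‖D (x e0.1) (x e0.2)‖ₑ * ‖(∏ e ∈ E.erase e0, V e (x e.1) (x e.2)) -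
      ∏ e ∈ E.erase e0, truncK A (V e) (x e.1) (x e.2)‖ₑ ≤
      ∑ e1 ∈ E.erase e0, ∏ e ∈ E, Φ e1 e (x e.1, x e.2) := by
    intro x
    refine (mul_le_mul_right (prod_trunc_diff (E.erase e0) V hA hs x) _).trans (le_of_eq ?_)
    rw [Finset.mul_sum]
    refine Finset.sum_congr rfl fun e1 he1 => ?_
    rw [← Finset.mul_prod_erase E _ he0]
    congr 1
    · simp [Φ]
    · refine Finset.prod_congr rfl fun e he => ?_
      simp only [Φ, if_neg (Finset.ne_of_mem_erase he)]
      rfl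
  refine (lintegral_mono hpt).trans ?_
  have hm : ∀ e1 ∈ E.erase e0, Measurable fun x : Fin v → ℝ => ∏ e ∈ E, Φ e1 e (x e.1, x e.2) :=
    fun e1 _ => Finset.measurable_prod _ fun e _ => (hΦ e1 e).comp
      ((measurable_pi_apply _).prodMk (measurable_pi_apply _))
  rw [lintegral_finsetSum _ hm]
  refine (Finset.sum_le_sum key).trans ?_
  rw [Finset.sum_const, nsmul_eq_mul]
  gcongr
  exact Finset.erase_subset _ _

end

section
open MeasureTheory Filter Set
open scoped ENNReal NNReal

theorem single_swap {v : ℕ} (G : SimpleGraph (Fin v)) [DecidableRel G.Adj] (hΔ : 1 ≤ G.maxDegree)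
    {D : ℝ → ℝ → ℝ} (hDm : Measurable (Function.uncurry D)) {η : ℝ} (hDη : CutLe D η)
    (V : Fin v × Fin v → ℝ → ℝ → ℝ)
    (hV : ∀ e, Measurable (Function.uncurry (V e))) {A s b M : ℝ} (hA : 1 ≤ A) (hs : 1 < s)
    (hs2 : s ≤ 2) (hb1 : 1 ≤ b) (hM : 1 ≤ M) (hD : kerNorm D G.maxDegree ≤ 2 * ENNReal.ofReal b)
    (hV1 : ∀ e, kerNorm (V e) G.maxDegree ≤ ENNReal.ofReal b)
    (hVs : ∀ e, kerNorm (V e) (ENNReal.ofReal s * G.maxDegree) ≤ ENNReal.ofReal b)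
    {f : ℝ → ℝ} (hf : Measurable f) (hfM : ∀ x, |f x| ≤ M)
    {e0 : Fin v × Fin v} (he0 : e0 ∈ edgeSetF G) :
    Integrable (fun x : Fin v → ℝ => D (x e0.1) (x e0.2) *
      (∏ e ∈ (edgeSetF G).erase e0, V e (x e.1) (x e.2)) * ∏ a, f (x a)) (PV v) ∧
    |∫ x, D (x e0.1) (x e0.2) * (∏ e ∈ (edgeSetF G).erase e0, V e (x e.1) (x e.2)) *
        ∏ a, f (x a) ∂(PV v)| ≤
      4 * (A ^ (edgeSetF G).card * M ^ v) * (A ^ (edgeSetF G).card * M ^ v) * η +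
      M ^ v * ((edgeSetF G).card * (A ^ (1 - s) * (2 * b ^ 2) ^ (edgeSetF G).card)) := by
  classical
  have hrem := count_rem G hΔ hDm V hV hA hs hs2 (B := ENNReal.ofReal b)
    (by rw [← ENNReal.ofReal_one]; exact ENNReal.ofReal_le_ofReal hb1) hD hV1 hVs he0
  set E := edgeSetF G
  have hDi : Integrable (fun z : ℝ × ℝ => D z.1 z.2) (unif01.prod unif01) := by
    have hD' : MemLp (fun z : ℝ × ℝ => D z.1 z.2) G.maxDegree (unif01.prod unif01) :=
      ⟨Measurable.aestronglyMeasurable hDm, hD.trans_lt (ENNReal.mul_lt_top (by simp) (by simp))⟩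
    exact hD'.integrable (by exact_mod_cast hΔ)
  have hmain := count_main G hDm hDi hDη (fun e => truncK A (V e)) (fun e => truncK_meas (hV e)) hA hM
    (fun e x y => truncK_le (by linarith) _ _ _) hf hfM he0
  set T : (Fin v → ℝ) → ℝ := fun x => D (x e0.1) (x e0.2) *
    (∏ e ∈ E.erase e0, truncK A (V e) (x e.1) (x e.2)) * ∏ a, f (x a) with hT
  set R : (Fin v → ℝ) → ℝ := fun x => D (x e0.1) (x e0.2) *
    ((∏ e ∈ E.erase e0, V e (x e.1) (x e.2)) - ∏ e ∈ E.erase e0, truncK A (V e) (x e.1) (x e.2)) *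
     ∏ a, f (x a) with hR
  have hDip : Integrable (fun x : Fin v → ℝ => D (x e0.1) (x e0.2)) (PV v) :=
    (mp_pair unif01 (edge_ne he0)).integrable_comp_of_integrable hDi
  have hfb : ∀ x : Fin v → ℝ, |∏ a, f (x a)| ≤ M ^ v := fun x =>
    abs_fprod_le _ _ hM (by simp) fun a _ => hfM _
  have hfpm : Measurable (fun x : Fin v → ℝ => ∏ a, f (x a)) := prod_meas hf
  have hPTm : Measurable (fun x : Fin v → ℝ => ∏ e ∈ E.erase e0, truncK A (V e) (x e.1) (x e.2)) :=
    Finset.measurable_prod _ fun e _ => pair_meas (truncK_meas (hV e)) _ _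
  have hPVm : Measurable (fun x : Fin v → ℝ => ∏ e ∈ E.erase e0, V e (x e.1) (x e.2)) :=
    Finset.measurable_prod _ fun e _ => pair_meas (hV e) _ _
  have hTi : Integrable T (PV v) := by
    have h1 := hDip.mul_bdd (c := A ^ E.card) hPTm.aestronglyMeasurable
      (Eventually.of_forall fun x => by
        rw [Real.norm_eq_abs]
        exact abs_fprod_le _ _ hA (Finset.card_le_card (Finset.erase_subset _ _))
          fun e _ => truncK_le (by linarith) _ _ _)
    exact h1.mul_bdd (c := M ^ v) hfpm.aestronglyMeasurable (Eventually.of_forall hfb)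
  have hRm : Measurable R := ((pair_meas hDm _ _).mul (hPVm.sub hPTm)).mul hfpm
  set ρ := M ^ v * (E.card * (A ^ (1 - s) * (2 * b ^ 2) ^ E.card)) with hρ
  have hRn : ∫⁻ x, ‖R x‖ₑ ∂(PV v) ≤ ENNReal.ofReal ρ := by
    calc ∫⁻ x, ‖R x‖ₑ ∂(PV v) ≤ ∫⁻ x, ENNReal.ofReal (M ^ v) * (‖D (x e0.1) (x e0.2)‖ₑ *
          ‖(∏ e ∈ E.erase e0, V e (x e.1) (x e.2)) -
            ∏ e ∈ E.erase e0, truncK A (V e) (x e.1) (x e.2)‖ₑ) ∂(PV v) := by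
          refine lintegral_mono fun x => ?_
          simp only [hR, enorm_mul]
          rw [mul_comm]
          gcongr
          rw [← ofReal_norm_eq_enorm]
          exact ENNReal.ofReal_le_ofReal (hfb x)
      _ = ENNReal.ofReal (M ^ v) * _ := by
          rw [lintegral_const_mul]
          exact (pair_meas hDm _ _).enorm.mul (hPVm.sub hPTm).enorm
      _ ≤ _ := by
          rw [hρ, ENNReal.ofReal_mul (by positivity)]
          gcongr
          refine hrem.trans (le_of_eq ?_)
          rw [ENNReal.ofReal_mul (by positivity), ENNReal.ofReal_mul (by positivity),
            ENNReal.ofReal_pow (by positivity), ENNReal.ofReal_mul (by positivity),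
            ENNReal.ofReal_pow (by positivity), ENNReal.ofReal_natCast]
          simp
  have hRi : Integrable R (PV v) := ⟨hRm.aestronglyMeasurable, hRn.trans_lt ENNReal.ofReal_lt_top⟩
  have hsum : (fun x : Fin v → ℝ => D (x e0.1) (x e0.2) *
      (∏ e ∈ E.erase e0, V e (x e.1) (x e.2)) * ∏ a, f (x a)) = fun x => T x + R x := by
    ext x; simp only [hT, hR]; ring
  rw [hsum]
  refine ⟨hTi.add hRi, ?_⟩
  rw [integral_add hTi hRi]
  refine (abs_add_le _ _).trans (add_le_add hmain ?_)
  have := (enorm_integral_le_lintegral_enorm R).trans hRn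
  rw [← ofReal_norm_eq_enorm, ENNReal.ofReal_le_ofReal_iff (by positivity)] at this
  exact this

theorem kerNorm_mono {V : ℝ → ℝ → ℝ} (hV : Measurable (Function.uncurry V)) {r s : ℝ≥0∞} (h : r ≤ s) :
    kerNorm V r ≤ kerNorm V s :=
  eLpNorm_le_eLpNorm_of_exponent_le h (Measurable.aestronglyMeasurable hV)

theorem kerNorm_sub {U V : ℝ → ℝ → ℝ} (hU : Measurable (Function.uncurry U))
    (hV : Measurable (Function.uncurry V)) {r : ℝ≥0∞} (h : 1 ≤ r) :
    kerNorm (fun x y => U x y - V x y) r ≤ kerNorm U r + kerNorm V r :=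
  eLpNorm_sub_le (Measurable.aestronglyMeasurable hU) (Measurable.aestronglyMeasurable hV) h

theorem telescope {v : ℕ} (G : SimpleGraph (Fin v)) [DecidableRel G.Adj] {f : ℝ → ℝ}
    {U U' : ℝ → ℝ → ℝ} {ρ : ℝ}
    (h0 : Integrable (fun x : Fin v → ℝ => edgeProd G (fun a b => U' (x a) (x b)) * ∏ a, f (x a)) (PV v))
    (hstep : ∀ S : Finset (Fin v × Fin v), ∀ e0 ∈ edgeSetF G,
      Integrable (fun x : Fin v → ℝ => (U (x e0.1) (x e0.2) - U' (x e0.1) (x e0.2)) *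
      (∏ e ∈ (edgeSetF G).erase e0, (if e ∈ S then U else U') (x e.1) (x e.2)) * ∏ a, f (x a)) (PV v) ∧
      |∫ x, (U (x e0.1) (x e0.2) - U' (x e0.1) (x e0.2)) *
      (∏ e ∈ (edgeSetF G).erase e0, (if e ∈ S then U else U') (x e.1) (x e.2)) * ∏ a, f (x a) ∂(PV v)| ≤ ρ) :
    |G1 G U f - G1 G U' f| ≤ (edgeSetF G).card * ρ := by
  classical
  set E := edgeSetF G
  let I : Finset (Fin v × Fin v) → (Fin v → ℝ) → ℝ := fun S x =>
    (∏ e ∈ E, (if e ∈ S then U else U') (x e.1) (x e.2)) * ∏ a, f (x a)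
  have hI0 : I ∅ = fun x : Fin v → ℝ => edgeProd G (fun a b => U' (x a) (x b)) * ∏ a, f (x a) := by
    ext x; simp only [I, Finset.notMem_empty, if_false]; rfl
  have hIE : I E = fun x : Fin v → ℝ => edgeProd G (fun a b => U (x a) (x b)) * ∏ a, f (x a) := by
    ext x; simp only [I]
    congr 1
    change _ = ∏ e ∈ E, _
    exact Finset.prod_congr rfl fun e he => by rw [if_pos he]
  have key : ∀ S : Finset (Fin v × Fin v), S ⊆ E → Integrable (I S) (PV v) ∧
      |∫ x, I S x ∂(PV v) - ∫ x, I ∅ x ∂(PV v)| ≤ S.card * ρ := by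
    intro S
    induction S using Finset.induction_on with
    | empty => intro _; rw [hI0]; exact ⟨h0, by simp⟩
    | insert e0 S hnot ih =>
      intro hS
      obtain ⟨i1, i2⟩ := ih ((Finset.subset_insert _ _).trans hS)
      have he0 : e0 ∈ E := hS (Finset.mem_insert_self _ _)
      obtain ⟨j1, j2⟩ := hstep S e0 he0
      have hd : I (insert e0 S) = fun x => I S x + (U (x e0.1) (x e0.2) - U' (x e0.1) (x e0.2)) *
          (∏ e ∈ E.erase e0, (if e ∈ S then U else U') (x e.1) (x e.2)) * ∏ a, f (x a) := by
        ext x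
        simp only [I]
        rw [← Finset.mul_prod_erase E _ he0, ← Finset.mul_prod_erase E _ he0]
        rw [if_pos (Finset.mem_insert_self _ _), if_neg hnot]
        rw [Finset.prod_congr rfl (g := fun e : Fin v × Fin v =>
          (if e ∈ S then U else U') (x e.1) (x e.2)) fun e he => by
            simp only [Finset.mem_insert, Finset.ne_of_mem_erase he, false_or]]
        ring
      rw [hd]
      refine ⟨i1.add j1, ?_⟩
      rw [integral_add i1 j1, Finset.card_insert_of_notMem hnot]
      push_cast
      have := abs_add_le (∫ x, I S x ∂(PV v) - ∫ x, I ∅ x ∂(PV v))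
        (∫ x, (U (x e0.1) (x e0.2) - U' (x e0.1) (x e0.2)) *
          (∏ e ∈ E.erase e0, (if e ∈ S then U else U') (x e.1) (x e.2)) * ∏ a, f (x a) ∂(PV v))
      calc _ = _ := by congr 1; ring
        _ ≤ _ := this
        _ ≤ S.card * ρ + ρ := add_le_add i2 j2
        _ = _ := by ring
  have := (key E (Finset.Subset.refl _)).2
  rw [hI0, hIE] at this
  exact this

theorem counting {v : ℕ} (G : SimpleGraph (Fin v)) [DecidableRel G.Adj] {p q B : ℝ≥0∞} (hp : 1 ≤ p)
    (hpt : p ≠ ⊤) (hq : 1 < q) (hpq : p⁻¹ + q⁻¹ ≤ 1) (hBt : B ≠ ⊤) (M : ℝ) {ε : ℝ} (hε : 0 < ε) :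
    ∃ η > 0, ∀ U U' : ℝ → ℝ → ℝ, Measurable (Function.uncurry U) → Measurable (Function.uncurry U') →
      kerNorm U (q * G.maxDegree) ≤ B → kerNorm U' (q * G.maxDegree) ≤ B →
      CutLe (fun x y => U x y - U' x y) η → ∀ f : ℝ → ℝ, Measurable f → (∀ x, |f x| ≤ M) →
      |G1 G U f - G1 G U' f| ≤ ε := by
  rcases Nat.eq_zero_or_pos G.maxDegree with h0 | hΔ
  · refine ⟨1, one_pos, fun U U' _ _ _ _ _ f _ _ => ?_⟩
    have : ∀ V : ℝ → ℝ → ℝ, ∀ x : Fin v → ℝ, edgeProd G (fun a b => V (x a) (x b)) = 1 := by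
      intro V x
      change ∏ e ∈ edgeSetF G, _ = _
      rw [edge_empty G h0]; simp
    simp only [G1, this, sub_self, abs_zero]
    exact hε.le
  have hΔ' : 1 ≤ G.maxDegree := hΔ
  obtain ⟨s, hs1, hs2, hsq⟩ : ∃ s : ℝ, 1 < s ∧ s ≤ 2 ∧ ENNReal.ofReal s ≤ q := by
    have hm : min q 2 ≠ ⊤ := ne_top_of_le_ne_top (by simp) (min_le_right q 2)
    refine ⟨(min q 2).toReal, ?_, ?_, ?_⟩
    · rw [← ENNReal.toReal_one]
      exact (ENNReal.toReal_lt_toReal (by simp) hm).2 (lt_min hq (by norm_num))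
    · have := (ENNReal.toReal_le_toReal hm (by simp)).2 (min_le_right q 2)
      simpa using this
    · rw [ENNReal.ofReal_toReal hm]; exact min_le_left _ _
  set b := max B.toReal 1
  set M' := max M 1
  set N := (edgeSetF G).card
  have hb1 : 1 ≤ b := le_max_right _ _
  have hM1 : 1 ≤ M' := le_max_right _ _
  have hBb : B ≤ ENNReal.ofReal b := by
    rw [← ENNReal.ofReal_toReal hBt]; exact ENNReal.ofReal_le_ofReal (le_max_left _ _)
  set ε' := ε / (2 * (N + 1)) with hε'
  have hε'0 : 0 < ε' := by positivity
  set R := M' ^ v * (N * (2 * b ^ 2) ^ N)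
  have hR0 : 0 ≤ R := by positivity
  obtain ⟨A, hA1, hA⟩ : ∃ A : ℝ, 1 ≤ A ∧ R * A ^ (1 - s) ≤ ε' := by
    have h1 : Tendsto (fun A : ℝ => R * A ^ (-(s - 1))) atTop (nhds (R * 0)) :=
      (tendsto_rpow_neg_atTop (by linarith)).const_mul R
    rw [mul_zero] at h1
    obtain ⟨A, hA, hA2⟩ := ((h1.eventually (gt_mem_nhds hε'0)).and (eventually_ge_atTop 1)).exists
    refine ⟨A, hA2, ?_⟩
    rw [neg_sub] at hA
    exact hA.le
  set K := A ^ N * M' ^ v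
  have hK : 0 < K := by positivity
  refine ⟨ε' / (4 * K * K), by positivity, fun U U' hU hU' hUB hUB' hc f hf hfM => ?_⟩
  have hfM' : ∀ x, |f x| ≤ M' := fun x => (hfM x).trans (le_max_left _ _)
  have hΔq : (G.maxDegree : ℝ≥0∞) ≤ q * G.maxDegree := le_mul_of_one_le_left' hq.le
  have hintg : Integrable (fun x : Fin v → ℝ => edgeProd G (fun a b => U' (x a) (x b)) * ∏ a, f (x a))
      (PV v) := by
    refine G1_integrable G hU' hp hpt hq hpq hUB' hBt hf ?_
    refine ((lintegral_mono (g := fun _ => ENNReal.ofReal M' ^ p.toReal) fun u => ?_).trans_lt ?_).ne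
    · dsimp only
      rw [← ofReal_norm_eq_enorm]
      gcongr
      exact hfM' u
    · simp only [lintegral_const, measure_univ, mul_one]
      exact ENNReal.rpow_lt_top_of_nonneg ENNReal.toReal_nonneg (by simp)
  have hD : kerNorm (fun x y => U x y - U' x y) G.maxDegree ≤ 2 * ENNReal.ofReal b := by
    refine (kerNorm_sub hU hU' (by exact_mod_cast hΔ')).trans ?_
    rw [two_mul]
    exact add_le_add (((kerNorm_mono hU hΔq).trans hUB).trans hBb)
      (((kerNorm_mono hU' hΔq).trans hUB').trans hBb)
  have hmain := telescope G (f := f) (U := U) (U' := U') (ρ := 2 * ε') hintg (by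
    intro S e0 he0
    have hss := single_swap G hΔ' (D := fun x y => U x y - U' x y)
      (hU.sub hU') hc (fun e => if e ∈ S then U else U')
      (fun e => by split_ifs <;> assumption) hA1 hs1 hs2 hb1 hM1 hD
      (fun e => by
        split_ifs
        · exact ((kerNorm_mono hU hΔq).trans hUB).trans hBb
        · exact ((kerNorm_mono hU' hΔq).trans hUB').trans hBb)
      (fun e => by
        have : ENNReal.ofReal s * G.maxDegree ≤ q * G.maxDegree := mul_le_mul_left hsq _
        split_ifs
        · exact ((kerNorm_mono hU this).trans hUB).trans hBb
        · exact ((kerNorm_mono hU' this).trans hUB').trans hBb) hf hfM' he0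
    refine ⟨hss.1, hss.2.trans ?_⟩
    change 4 * K * K * (ε' / (4 * K * K)) + M' ^ v * (N * (A ^ (1 - s) * (2 * b ^ 2) ^ N)) ≤ 2 * ε'
    rw [mul_div_cancel₀ _ (by positivity : 4 * K * K ≠ 0), two_mul ε']
    refine add_le_add le_rfl ?_
    calc _ = R * A ^ (1 - s) := by simp only [R]; ring
      _ ≤ _ := hA)
  refine hmain.trans ?_
  change (N : ℝ) * (2 * ε') ≤ ε
  rw [hε']
  have : (N : ℝ) * (2 * (ε / (2 * (N + 1)))) = ε * (N / (N + 1)) := by field_simp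
  rw [this]
  have : (N : ℝ) / (N + 1) ≤ 1 := by rw [div_le_one (by positivity)]; linarith
  nlinarith

theorem enorm_le_ofReal {x ε : ℝ} (hε : 0 ≤ ε) : ‖x‖ₑ ≤ ENNReal.ofReal ε ↔ |x| ≤ ε := by
  rw [← ofReal_norm_eq_enorm, ENNReal.ofReal_le_ofReal_iff hε, Real.norm_eq_abs]

theorem approx {v : ℕ} (G : SimpleGraph (Fin v)) [DecidableRel G.Adj] {p q B : ℝ≥0∞} (hp : 1 ≤ p)
    (hpt : p ≠ ⊤) (hq : 1 < q) (hpq : p⁻¹ + q⁻¹ ≤ 1) (hBt : B ≠ ⊤) {C : ℝ≥0∞} (hC : C ≠ ⊤)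
    {ε : ℝ} (hε : 0 < ε) :
    ∃ δ : ℝ, 0 < δ ∧ ∀ M : ℝ, ∃ η > 0, ∀ U U' : ℝ → ℝ → ℝ,
      Measurable (Function.uncurry U) → Measurable (Function.uncurry U') →
      kerNorm U (q * G.maxDegree) ≤ B → kerNorm U' (q * G.maxDegree) ≤ B →
      CutLe (fun x y => U x y - U' x y) η → ∀ f : ℝ → ℝ, Measurable f →
      NiceF p.toReal C (ENNReal.ofReal δ) M f →
      |G1 G U f - G1 G U' f| ≤ ε := by
  have hp0 : p ≠ 0 := (zero_lt_one.trans_le hp).ne'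
  have hr : 0 < p.toReal := ENNReal.toReal_pos hp0 hpt
  obtain ⟨δ, hδ0, hδ⟩ : ∃ δ : ℝ, 0 < δ ∧ B ^ (edgeSetF G).card *
      (v * (ENNReal.ofReal δ * C ^ (v - 1))) ^ (1 / p.toReal) ≤ ENNReal.ofReal (ε / 3) := by
    have h1 : Tendsto (fun δ : ℝ => B ^ (edgeSetF G).card *
      (v * (ENNReal.ofReal δ * C ^ (v - 1))) ^ (1 / p.toReal)) (nhdsWithin 0 (Set.Ioi 0)) (nhds 0) := by
      have h2 : Tendsto (fun δ : ℝ => B ^ (edgeSetF G).card *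
        (v * (ENNReal.ofReal δ * C ^ (v - 1))) ^ (1 / p.toReal)) (nhds 0)
          (nhds (B ^ (edgeSetF G).card *
        (v * (ENNReal.ofReal 0 * C ^ (v - 1))) ^ (1 / p.toReal))) := by
        refine ENNReal.Tendsto.const_mul ?_ (Or.inr (by finiteness))
        refine ((ENNReal.continuous_rpow_const (y := 1 / p.toReal)).tendsto _).comp ?_
        refine ENNReal.Tendsto.const_mul ?_ (Or.inr (by simp))
        refine ENNReal.Tendsto.mul_const ?_ (Or.inr (by finiteness))
        exact (ENNReal.continuous_ofReal.tendsto 0)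
      have h3 : (1 / p.toReal) > 0 := by positivity
      simp only [ENNReal.ofReal_zero, zero_mul, mul_zero, ENNReal.zero_rpow_of_pos h3] at h2
      exact h2.mono_left nhdsWithin_le_nhds
    have h2 := h1.eventually (gt_mem_nhds (show (0:ℝ≥0∞) < ENNReal.ofReal (ε / 3) by
      rw [ENNReal.ofReal_pos]; positivity))
    obtain ⟨δ, h3, h4⟩ := (h2.and self_mem_nhdsWithin).exists
    exact ⟨δ, h4, h3.le⟩
  refine ⟨δ, hδ0, fun M => ?_⟩
  obtain ⟨η, hη, hcount⟩ := counting G hp hpt hq hpq hBt (max M 0) (show 0 < ε / 3 by positivity)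
  refine ⟨η, hη, fun U U' hU hU' hUB hUB' hc f hf hN => ?_⟩
  have h1 := (truncF_G1 G hU hp hpt hq hpq hUB hBt hf hC hN).trans hδ
  have h2 := (truncF_G1 G hU' hp hpt hq hpq hUB' hBt hf hC hN).trans hδ
  rw [enorm_le_ofReal (by positivity)] at h1 h2
  have h3 := hcount U U' hU hU' hUB hUB' hc (truncF M f) (truncF_meas hf) (by
    intro x
    unfold truncF
    split_ifs with h
    · simp
    · exact (not_lt.1 h).trans (le_max_left _ _))
  rw [abs_le] at *
  constructor <;> linarith [h1.1, h1.2, h2.1, h2.2, h3.1, h3.2]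

end

section
open MeasureTheory Filter Set
open scoped ENNReal NNReal

/-! ### Part E: step kernels -/

theorem NiceF.mono {r : ℝ} {C C' δ δ' : ℝ≥0∞} {M M' : ℝ} {f : ℝ → ℝ} (h : NiceF r C δ M f)
    (hC : C ≤ C') (hδ : δ ≤ δ') (hM : M ≤ M') : NiceF r C' δ' M' f := by
  refine ⟨h.1.trans hC, ((lintegral_mono fun u => ?_).trans h.2).trans hδ⟩
  dsimp only
  split_ifs with h1 h2
  · exact le_rfl
  · exact absurd (hM.trans_lt h1) h2
  · exact zero_le
  · exact le_rfl

/-- polynomial of block integrals -/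
noncomputable def blockSum {v : ℕ} {ι : Type*} [Fintype ι] (φ : (Fin v → ι) → ℝ) (b : ι → ℝ) : ℝ :=
  ∑ j : Fin v → ι, φ j * ∏ a, b (j a)

/-- block integrals -/
noncomputable def blockInt {ι : Type*} (τ : ℝ → ι) (f : ℝ → ℝ) (i : ι) : ℝ :=
  ∫ u in τ ⁻¹' {i}, f u ∂unif01

theorem step_integral {v : ℕ} {ι : Type*} [Fintype ι] [MeasurableSpace ι]
    [MeasurableSingletonClass ι] {τ : ℝ → ι} (hτ : Measurable τ) (φ : (Fin v → ι) → ℝ) {f : ℝ → ℝ}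
    (hf : Integrable f unif01) :
    ∫ x : Fin v → ℝ, φ (fun a => τ (x a)) * ∏ a, f (x a) ∂(PV v) = blockSum φ (blockInt τ f) := by
  classical
  have hS : ∀ i, MeasurableSet (τ ⁻¹' {i}) := fun i => hτ (measurableSet_singleton i)
  have h1 : ∀ x : Fin v → ℝ, φ (fun a => τ (x a)) * ∏ a, f (x a) =
      ∑ j : Fin v → ι, φ j * ∏ a, (τ ⁻¹' {j a}).indicator f (x a) := by
    intro x
    rw [Finset.sum_eq_single (fun a => τ (x a))]
    · congr 1
      refine Finset.prod_congr rfl fun a _ => ?_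
      rw [Set.indicator_of_mem]; simp
    · intro j _ hj
      obtain ⟨a, ha⟩ : ∃ a, j a ≠ τ (x a) := by
        by_contra h; push Not at h; exact hj (funext h)
      rw [Finset.prod_eq_zero (Finset.mem_univ a), mul_zero]
      rw [Set.indicator_of_notMem]
      simpa using ha.symm
    · simp
  rw [integral_congr_ae (Eventually.of_forall h1), integral_finsetSum]
  · unfold blockSum
    refine Finset.sum_congr rfl fun j _ => ?_
    rw [integral_const_mul]
    congr 1
    rw [show (∫ a : Fin v → ℝ, ∏ a_1, (τ ⁻¹' {j a_1}).indicator f (a a_1) ∂PV v) = _ from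
      integral_fintype_prod_eq_prod (μ := fun _ : Fin v => unif01)
        (f := fun a => (τ ⁻¹' {j a}).indicator f)]
    refine Finset.prod_congr rfl fun a _ => ?_
    rw [integral_indicator (hS _)]; rfl
  · intro j _
    refine Integrable.const_mul ?_ _
    exact Integrable.fintype_prod (μ := fun _ : Fin v => unif01)
      (f := fun a => (τ ⁻¹' {j a}).indicator f) fun a => hf.indicator (hS _)

theorem G1_step {v : ℕ} (G : SimpleGraph (Fin v)) [DecidableRel G.Adj] {ι : Type*} [Fintype ι]
    [MeasurableSpace ι] [MeasurableSingletonClass ι] {τ : ℝ → ι} (hτ : Measurable τ)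
    (h : ι → ι → ℝ) {f : ℝ → ℝ} (hf : Integrable f unif01) :
    G1 G (fun x y => h (τ x) (τ y)) f =
      blockSum (fun j => edgeProd G (fun a b => h (j a) (j b))) (blockInt τ f) :=
  step_integral hτ (fun j => edgeProd G (fun a b => h (j a) (j b))) hf

theorem blockSum_continuous {v : ℕ} {ι : Type*} [Fintype ι] (φ : (Fin v → ι) → ℝ) :
    Continuous (blockSum φ) := by
  unfold blockSum
  fun_prop

theorem blockInt_comp {n : ℕ} {τ : ℝ → Fin n} (hτ : Measurable τ)
    (hu : ∀ i, unif01 (τ ⁻¹' {i}) = (n : ℝ≥0∞)⁻¹) (x : Fin n → ℝ) (i : Fin n) :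
    blockInt τ (fun u => x (τ u)) i = x i / n := by
  unfold blockInt
  rw [setIntegral_congr_fun (g := fun _ => x i) (hτ (measurableSet_singleton i))
    (fun u hu => by simp only [mem_preimage, mem_singleton_iff] at hu; simp [hu])]
  rw [setIntegral_const, measureReal_def, hu]
  simp [div_eq_inv_mul]

theorem comp_tau_integrable {n : ℕ} {τ : ℝ → Fin n} (hτ : Measurable τ) (x : Fin n → ℝ) :
    Integrable (fun u => x (τ u)) unif01 := by
  have : Finite (Fin n) := inferInstance
  refine Integrable.of_bound (C := ∑ i, |x i|)
    ((measurable_of_finite x).comp hτ).aestronglyMeasurable (Eventually.of_forall fun u => ?_)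
  exact Finset.single_le_sum (f := fun i => |x i|) (fun _ _ => abs_nonneg _) (Finset.mem_univ _)

theorem lintegral_comp_tau {n : ℕ} {τ : ℝ → Fin n} (hτ : Measurable τ)
    (hu : ∀ i, unif01 (τ ⁻¹' {i}) = (n : ℝ≥0∞)⁻¹) (g : Fin n → ℝ≥0∞) :
    ∫⁻ u, g (τ u) ∂unif01 = (n : ℝ≥0∞)⁻¹ * ∑ i, g i := by
  have h : ∫⁻ u, g (τ u) ∂unif01 = ∫⁻ i, g i ∂(unif01.map τ) :=
    (lintegral_map (measurable_of_finite g) hτ).symm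
  rw [h, lintegral_fintype, Finset.mul_sum]
  refine Finset.sum_congr rfl fun i _ => ?_
  rw [Measure.map_apply hτ (measurableSet_singleton i), hu, mul_comm]

theorem Vstat_eq {v : ℕ} (G : SimpleGraph (Fin v)) [DecidableRel G.Adj] {n : ℕ} (Q : Fin n → Fin n → ℝ)
    {τ : ℝ → Fin n} (hτ : Measurable τ)
    (hu : ∀ i, unif01 (τ ⁻¹' {i}) = (n : ℝ≥0∞)⁻¹) (x : Fin n → ℝ) (φ : (Fin v → Fin n) → ℝ) :
    ∫ z : Fin v → ℝ, φ (fun a => τ (z a)) * ∏ a, x (τ (z a)) ∂(PV v) =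
      (∑ i : Fin v → Fin n, φ i * ∏ a, x (i a)) / (n : ℝ) ^ v := by
  rw [step_integral hτ φ (comp_tau_integrable hτ x)]
  unfold blockSum
  rw [Finset.sum_div]
  refine Finset.sum_congr rfl fun j _ => ?_
  simp_rw [blockInt_comp hτ hu, Finset.prod_div_distrib]
  simp [mul_div_assoc]

theorem noninj_bound {v n : ℕ} {τ : ℝ → Fin n} (hτ : Measurable τ) {g : ℝ → ℝ≥0∞} (hg : Measurable g)
    {κ C : ℝ≥0∞} (hκ : ∀ i, ∫⁻ u, (if i = τ u then g u else 0) ∂unif01 ≤ κ)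
    (hC : ∫⁻ u, g u ∂unif01 ≤ C) {a b : Fin v} (hab : a ≠ b) :
    ∫⁻ z : Fin v → ℝ, (if τ (z a) = τ (z b) then ∏ c, g (z c) else 0) ∂(PV v) ≤ κ * C ^ (v - 1) := by
  classical
  have hm : Measurable fun z : Fin v → ℝ => (if τ (z a) = τ (z b) then ∏ c, g (z c) else 0) := by
    refine Measurable.ite ?_ (Finset.measurable_prod _ fun c _ => hg.comp (measurable_pi_apply c))
      measurable_const
    exact measurableSet_eq_fun (hτ.comp (measurable_pi_apply a)) (hτ.comp (measurable_pi_apply b))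
  have hmp := mp_update (κ := Fin v) unif01 b
  have h1 := hmp.lintegral_comp hm
  change ∫⁻ z : Fin v → ℝ, _ ∂(Measure.pi fun _ : Fin v => unif01) ≤ _
  have h5 := lintegral_prod (μ := Measure.pi fun _ : Fin v => unif01) (ν := unif01) _
    (hm.comp hmp.measurable).aemeasurable
  simp only [Function.comp] at h5
  rw [← h1, h5]
  have h2 : ∀ z : Fin v → ℝ, ∫⁻ t, (if τ (Function.update z b t a) = τ (Function.update z b t b) then
      ∏ c, g (Function.update z b t c) else 0) ∂unif01 ≤ κ * ∏ c, (if c = b then 1 else g (z c)) := by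
    intro z
    have h3 : ∀ t, (if τ (Function.update z b t a) = τ (Function.update z b t b) then
      ∏ c, g (Function.update z b t c) else 0) =
        (if τ (z a) = τ t then g t else 0) * ∏ c, (if c = b then 1 else g (z c)) := by
      intro t
      rw [Function.update_of_ne hab, Function.update_self]
      rw [← Finset.mul_prod_erase _ _ (Finset.mem_univ b),
        ← Finset.mul_prod_erase _ (fun c => if c = b then 1 else g (z c)) (Finset.mem_univ b)]
      rw [Function.update_self, if_pos rfl, one_mul, ite_mul, zero_mul]
      congr 2
      refine Finset.prod_congr rfl fun c hc => ?_
      rw [Function.update_of_ne (Finset.ne_of_mem_erase hc), if_neg (Finset.ne_of_mem_erase hc)]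
    simp_rw [h3]
    rw [lintegral_mul_const]
    · exact mul_le_mul_left (hκ _) _
    · exact Measurable.ite (measurableSet_eq_fun measurable_const hτ) hg measurable_const
  refine (lintegral_mono h2).trans ?_
  have h4 : ∀ c : Fin v, Measurable fun t : ℝ => if c = b then (1 : ℝ≥0∞) else g t := by
    intro c; split_ifs
    · exact measurable_const
    · exact hg
  rw [lintegral_const_mul]
  · gcongr
    rw [lintegral_pi_prod unif01 (fun c t => if c = b then 1 else g t) h4]
    rw [← Finset.mul_prod_erase _ _ (Finset.mem_univ b)]
    simp only [if_true, lintegral_one, measure_univ, one_mul]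
    calc _ ≤ ∏ c ∈ Finset.univ.erase b, C := Finset.prod_le_prod' fun c hc => by
          simp only [if_neg (Finset.ne_of_mem_erase hc)]; exact hC
      _ = _ := by rw [Finset.prod_const, Finset.card_erase_of_mem (Finset.mem_univ b)]; simp
  · exact Finset.measurable_prod _ fun c _ => (h4 c).comp (measurable_pi_apply c)

end

section
open MeasureTheory Filter Set
open scoped ENNReal NNReal

theorem comp_tau_meas {n : ℕ} {τ : ℝ → Fin n} (hτ : Measurable τ) (x : Fin n → ℝ) :
    Measurable (fun u => x (τ u)) := (measurable_of_finite x).comp hτ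

theorem Q_tau_meas {ι : Type*} [Fintype ι] [MeasurableSpace ι] [MeasurableSingletonClass ι]
    (Q : ι → ι → ℝ) {τ : ℝ → ι} (hτ : Measurable τ) :
    Measurable (Function.uncurry fun x y => Q (τ x) (τ y)) := by
  have h1 : Measurable (fun z : ℝ × ℝ => (τ z.1, τ z.2)) :=
    (hτ.comp measurable_fst).prodMk (hτ.comp measurable_snd)
  exact (measurable_of_finite (fun z : ι × ι => Q z.1 z.2)).comp h1

/-- difference between U and V statistics. -/
theorem UV_bound {v : ℕ} (G : SimpleGraph (Fin v)) [DecidableRel G.Adj] {p q B : ℝ≥0∞} (hp : 1 ≤ p)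
    (hpt : p ≠ ⊤) (hq : 1 < q) (hpq : p⁻¹ + q⁻¹ ≤ 1) (hBt : B ≠ ⊤) {C δ : ℝ≥0∞} (hC : C ≠ ⊤) {M : ℝ}
    {n : ℕ} (Q : Fin n → Fin n → ℝ) {τ : ℝ → Fin n} (hτ : Measurable τ)
    (hu : ∀ i, unif01 (τ ⁻¹' {i}) = (n : ℝ≥0∞)⁻¹)
    (hB : kerNorm (fun x y => Q (τ x) (τ y)) (q * G.maxDegree) ≤ B) (x : Fin n → ℝ)
    (hN : NiceF p.toReal C δ M (fun u => x (τ u))) :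
    ‖Ustat G (fun y : Fin v → ℝ => ∏ a, y a) n Q x - G1 G (fun x y => Q (τ x) (τ y)) (fun u => x (τ u))‖ₑ ≤
      B ^ (edgeSetF G).card * ((v * v : ℕ) * ((ENNReal.ofReal M ^ p.toReal * (n : ℝ≥0∞)⁻¹ + δ) * C ^ (v - 1)))
        ^ (1 / p.toReal) := by
  classical
  have hp0 : p ≠ 0 := (zero_lt_one.trans_le hp).ne'
  have hr : 0 < p.toReal := ENNReal.toReal_pos hp0 hpt
  set F : ℝ → ℝ := fun u => x (τ u) with hF
  have hFm : Measurable F := comp_tau_meas hτ x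
  set U : ℝ → ℝ → ℝ := fun x y => Q (τ x) (τ y) with hU
  have hUm : Measurable (Function.uncurry U) := Q_tau_meas Q hτ
  let ni : (Fin v → Fin n) → Prop := fun j => ∃ a b, a ≠ b ∧ j a = j b
  let h : (Fin v → ℝ) → ℝ := fun z => if ni (fun a => τ (z a)) then ∏ a, F (z a) else 0
  have htm : Measurable fun z : Fin v → ℝ => fun a => τ (z a) :=
    measurable_pi_iff.2 fun a => hτ.comp (measurable_pi_apply a)
  have hhm : Measurable h := by
    refine Measurable.ite ?_ (prod_meas hFm) measurable_const
    exact htm (Set.toFinite {j | ni j}).measurableSet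
  have hintg := G1_integrable G hUm hp hpt hq hpq hB hBt hFm (hN.1.trans_lt hC.lt_top).ne
  have hdiff : G1 G U F - Ustat G (fun y : Fin v → ℝ => ∏ a, y a) n Q x =
      ∫ z : Fin v → ℝ, edgeProd G (fun a b => U (z a) (z b)) * h z ∂(PV v) := by
    have e1 := Vstat_eq (v := v) G Q hτ hu x (fun j => edgeProd G (fun a b => Q (j a) (j b)))
    have e2 := Vstat_eq (v := v) G Q hτ hu x
      (fun j => edgeProd G (fun a b => Q (j a) (j b)) * if ni j then 1 else 0)
    have e3 : (∫ z : Fin v → ℝ, edgeProd G (fun a b => U (z a) (z b)) * h z ∂(PV v)) =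
        ∫ z : Fin v → ℝ, (edgeProd G (fun a b => Q (τ (z a)) (τ (z b))) *
          if ni (fun a => τ (z a)) then 1 else 0) * ∏ a, x (τ (z a)) ∂(PV v) := by
      refine integral_congr_ae (Eventually.of_forall fun z => ?_)
      simp only [h, hU, hF]
      split_ifs <;> simp
    rw [e3, e2]
    have e4 : G1 G U F = _ := e1
    rw [e4, Ustat, ← sub_div]
    congr 1
    rw [Finset.sum_filter, ← Finset.sum_sub_distrib]
    refine Finset.sum_congr rfl fun j _ => ?_
    have : Function.Injective j ↔ ¬ ni j := by
      simp only [ni, Function.Injective]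
      constructor
      · rintro h ⟨a, b, hab, he⟩; exact hab (h he)
      · intro h a b he; by_contra hab; exact h ⟨a, b, hab, he⟩
    by_cases hj : ni j
    · rw [if_neg (by rw [this]; exact not_not.2 hj), if_pos hj]; ring
    · rw [if_pos (this.2 hj), if_neg hj]; simp only [Function.comp]; ring
  rw [← enorm_neg, neg_sub, hdiff]
  refine (enorm_integral_le_lintegral_enorm _).trans ?_
  rw [← eLpNorm_one_eq_lintegral_enorm]
  refine (edgeProd_holder G hUm hq hpq hB hhm).trans ?_
  gcongr
  rw [eLpNorm_eq_lintegral_rpow_enorm_toReal hp0 hpt]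
  gcongr
  set g : ℝ → ℝ≥0∞ := fun u => ‖F u‖ₑ ^ p.toReal with hg
  have hgm : Measurable g := hFm.enorm.pow_const _
  have hpt : ∀ z : Fin v → ℝ, ‖h z‖ₑ ^ p.toReal ≤ ∑ a : Fin v, ∑ b : Fin v,
      (if a ≠ b then (if τ (z a) = τ (z b) then ∏ c, g (z c) else 0) else 0) := by
    intro z
    simp only [h]
    split_ifs with hni
    · obtain ⟨a, b, hab, he⟩ := hni
      rw [enorm_fprod, ENNReal.prod_rpow_of_nonneg hr.le]
      refine le_trans ?_ (Finset.single_le_sum (fun _ _ => zero_le) (Finset.mem_univ a))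
      refine le_trans ?_ (Finset.single_le_sum (fun _ _ => zero_le) (Finset.mem_univ b))
      rw [if_pos hab, if_pos he]
    · simp [hr]
  refine (lintegral_mono hpt).trans ?_
  have hmab : ∀ a b : Fin v, Measurable fun z : Fin v → ℝ =>
      (if a ≠ b then (if τ (z a) = τ (z b) then ∏ c, g (z c) else 0) else 0) := by
    intro a b
    by_cases hab : a ≠ b
    · simp only [if_pos hab]
      refine Measurable.ite ?_ (Finset.measurable_prod _ fun c _ => hgm.comp (measurable_pi_apply c))
        measurable_const
      exact measurableSet_eq_fun (hτ.comp (measurable_pi_apply a)) (hτ.comp (measurable_pi_apply b))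
    · simp only [if_neg hab]; exact measurable_const
  rw [lintegral_finsetSum _ fun a _ => Finset.measurable_fun_sum _ fun b _ => hmab a b]
  have hκ : ∀ i, ∫⁻ u, (if i = τ u then g u else 0) ∂unif01 ≤
      ENNReal.ofReal M ^ p.toReal * (n : ℝ≥0∞)⁻¹ + δ := by
    intro i
    have hle : ∀ u, (if i = τ u then g u else 0) ≤
        (τ ⁻¹' {i}).indicator (fun _ => ENNReal.ofReal M ^ p.toReal) u +
          (if M < |F u| then ‖F u‖ₑ ^ p.toReal else 0) := by
      intro u
      by_cases hi : i = τ u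
      · rw [if_pos hi, Set.indicator_of_mem (by simp [hi])]
        by_cases hM : M < |F u|
        · rw [if_pos hM]; exact le_add_self
        · rw [if_neg hM, add_zero]
          simp only [hg]
          gcongr
          rw [← ofReal_norm_eq_enorm, Real.norm_eq_abs]
          exact ENNReal.ofReal_le_ofReal (not_lt.1 hM)
      · rw [if_neg hi]; exact zero_le
    refine (lintegral_mono hle).trans ?_
    rw [lintegral_add_left (measurable_const.indicator (hτ (measurableSet_singleton i))),
      lintegral_indicator_const (hτ (measurableSet_singleton i)), hu]
    exact add_le_add le_rfl hN.2
  calc _ ≤ ∑ a : Fin v, ∑ b : Fin v, (ENNReal.ofReal M ^ p.toReal * (n : ℝ≥0∞)⁻¹ + δ) * C ^ (v - 1) := by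
        refine Finset.sum_le_sum fun a _ => ?_
        rw [lintegral_finsetSum _ fun b _ => hmab a b]
        refine Finset.sum_le_sum fun b _ => ?_
        by_cases hab : a ≠ b
        · simp only [if_pos hab]
          exact noninj_bound hτ hgm hκ hN.1 hab
        · simp only [if_neg hab]; simp
    _ = _ := by simp [mul_assoc]

/-- main deterministic approximation -/
theorem approxN {v : ℕ} (G : SimpleGraph (Fin v)) [DecidableRel G.Adj] {p q B : ℝ≥0∞} (hp : 1 ≤ p)
    (hpt : p ≠ ⊤) (hq : 1 < q) (hpq : p⁻¹ + q⁻¹ ≤ 1) (hBt : B ≠ ⊤) {C : ℝ≥0∞} (hC : C ≠ ⊤)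
    {ε : ℝ} (hε : 0 < ε) :
    ∃ δ : ℝ, 0 < δ ∧ ∀ M : ℝ, ∃ n0 : ℕ, ∀ n ≥ n0, ∀ (Q : Fin n → Fin n → ℝ) (τ : ℝ → Fin n),
      Measurable τ → (∀ i, unif01 (τ ⁻¹' {i}) = (n : ℝ≥0∞)⁻¹) →
      kerNorm (fun x y => Q (τ x) (τ y)) (q * G.maxDegree) ≤ B → ∀ x : Fin n → ℝ,
      NiceF p.toReal C (ENNReal.ofReal δ) M (fun u => x (τ u)) →
      |Ustat G (fun y : Fin v → ℝ => ∏ a, y a) n Q x -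
        G1 G (fun x y => Q (τ x) (τ y)) (fun u => x (τ u))| ≤ ε := by
  have hp0 : p ≠ 0 := (zero_lt_one.trans_le hp).ne'
  have hr : 0 < p.toReal := ENNReal.toReal_pos hp0 hpt
  have h3 : (1 / p.toReal) > 0 := by positivity
  let Ψ : ℝ≥0∞ → ℝ≥0∞ := fun κ => B ^ (edgeSetF G).card * ((v * v : ℕ) * (κ * C ^ (v - 1))) ^ (1 / p.toReal)
  have hΨ : Tendsto Ψ (nhds 0) (nhds 0) := by
    have h2 : Tendsto Ψ (nhds 0) (nhds (Ψ 0)) := by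
      refine ENNReal.Tendsto.const_mul ?_ (Or.inr (by finiteness))
      refine ((ENNReal.continuous_rpow_const (y := 1 / p.toReal)).tendsto _).comp ?_
      refine ENNReal.Tendsto.const_mul ?_ (Or.inr (by finiteness))
      exact ENNReal.Tendsto.mul_const tendsto_id (Or.inr (by finiteness))
    have h0 : Ψ 0 = 0 := by simp [Ψ, hr]
    rwa [h0] at h2
  have hΨm : Monotone Ψ := by
    intro a b hab
    simp only [Ψ]
    gcongr
  have h5 := hΨ.eventually (gt_mem_nhds (show (0:ℝ≥0∞) < ENNReal.ofReal ε by simpa using hε))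
  obtain ⟨κ, hκ0, hκ⟩ : ∃ κ : ℝ, 0 < κ ∧ Ψ (ENNReal.ofReal κ) < ENNReal.ofReal ε := by
    have h1 : Tendsto (fun κ : ℝ => ENNReal.ofReal κ) (nhdsWithin 0 (Set.Ioi 0)) (nhds 0) := by
      have := ENNReal.continuous_ofReal.tendsto 0
      rw [ENNReal.ofReal_zero] at this
      exact this.mono_left nhdsWithin_le_nhds
    obtain ⟨κ, h3, h4⟩ := ((h1.eventually h5).and self_mem_nhdsWithin).exists
    exact ⟨κ, h4, h3⟩
  refine ⟨κ / 2, by positivity, fun M => ?_⟩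
  have hn : Tendsto (fun n : ℕ => ENNReal.ofReal M ^ p.toReal * (n : ℝ≥0∞)⁻¹) atTop (nhds 0) := by
    have := ENNReal.Tendsto.const_mul (a := ENNReal.ofReal M ^ p.toReal) ENNReal.tendsto_inv_nat_nhds_zero
      (Or.inr (ENNReal.rpow_lt_top_of_nonneg ENNReal.toReal_nonneg ENNReal.ofReal_ne_top).ne)
    simpa using this
  obtain ⟨n0, hn0⟩ := eventually_atTop.1 (hn.eventually (gt_mem_nhds
    (show (0:ℝ≥0∞) < ENNReal.ofReal (κ / 2) by simp [hκ0])))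
  refine ⟨n0, fun n hnn Q τ hτ hu hB x hN => ?_⟩
  rw [← enorm_le_ofReal hε.le]
  refine (UV_bound G hp hpt hq hpq hBt hC Q hτ hu hB x hN).trans ?_
  refine le_trans (hΨm ?_) hκ.le
  rw [show κ = κ / 2 + κ / 2 by ring, ENNReal.ofReal_add (by positivity) (by positivity)]
  rw [show (κ / 2 + κ / 2) / 2 = κ / 2 by ring]
  exact add_le_add (hn0 n hnn).le le_rfl

end

section
open MeasureTheory Filter Set
open scoped ENNReal NNReal

/-- Exponential moment condition. -/
def TC (μ : Measure ℝ) (r : ℝ) : Prop :=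
  ∀ lam : ℝ, 0 < lam → ∫⁻ x, ENNReal.ofReal (Real.exp (lam * |x| ^ r)) ∂μ < ⊤

theorem TC.int {μ : Measure ℝ} {r : ℝ} (h : TC μ r) {lam : ℝ} (hl : 0 < lam) :
    Integrable (fun x : ℝ => Real.exp (lam * |x| ^ r)) μ := by
  refine ⟨(by fun_prop : Measurable fun x : ℝ => Real.exp (lam * |x| ^ r)).aestronglyMeasurable, ?_⟩
  rw [hasFiniteIntegral_iff_ofReal (Eventually.of_forall fun x => (Real.exp_pos _).le)]
  exact h lam hl

theorem abs_le_one_add_rpow {r : ℝ} (hr : 1 ≤ r) (x : ℝ) : |x| ≤ 1 + |x| ^ r := by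
  have h0 : 0 ≤ |x| ^ r := Real.rpow_nonneg (abs_nonneg x) r
  rcases le_total (|x|) 1 with h | h
  · linarith
  · have := Real.rpow_le_rpow_of_exponent_le h hr
    rw [Real.rpow_one] at this
    linarith

theorem TC.expInt {μ : Measure ℝ} {r : ℝ} (hr : 1 ≤ r) (h : TC μ r) (θ : ℝ) :
    Integrable (fun x : ℝ => Real.exp (θ * x)) μ := by
  have h1 := (h.int (lam := |θ| + 1) (by positivity)).const_mul (Real.exp (|θ|+1))
  refine h1.mono' (by fun_prop : Measurable fun x : ℝ => Real.exp (θ * x)).aestronglyMeasurable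
    (Eventually.of_forall fun x => ?_)
  rw [Real.norm_eq_abs, abs_of_pos (Real.exp_pos _), ← Real.exp_add]
  refine Real.exp_le_exp.2 ?_
  have h2 : θ * x ≤ |θ| * |x| := (le_abs_self _).trans (abs_mul θ x).le
  have h3 := abs_le_one_add_rpow hr x
  have h4 : |θ| * |x| ≤ (|θ| + 1) * (1 + |x| ^ r) := by
    have := abs_nonneg x
    have := abs_nonneg θ
    nlinarith
  linarith

section cgf
variable {μ : Measure ℝ} [IsProbabilityMeasure μ]

theorem cgf_eq (μ : Measure ℝ) : cgf' μ = ProbabilityTheory.cgf id μ := rfl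

theorem expPos (hI : ∀ θ, Integrable (fun x : ℝ => Real.exp (θ * x)) μ) (θ : ℝ) :
    0 < ∫ x, Real.exp (θ * x) ∂μ := integral_exp_pos (hI θ)

theorem exp_cgf (hI : ∀ θ, Integrable (fun x : ℝ => Real.exp (θ * x)) μ) (θ : ℝ) :
    ∫ x, Real.exp (θ * x) ∂μ = Real.exp (cgf' μ θ) := by
  rw [cgf', Real.exp_log (expPos hI θ)]

theorem cgf_zero : cgf' μ 0 = 0 := by simp [cgf']

theorem iES (hI : ∀ θ, Integrable (fun x : ℝ => Real.exp (θ * x)) μ) :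
    interior (ProbabilityTheory.integrableExpSet id μ) = univ := by
  have : ProbabilityTheory.integrableExpSet id μ = univ := by
    ext θ; simpa [ProbabilityTheory.integrableExpSet] using hI θ
  rw [this, interior_univ]

theorem cgf_analytic (hI : ∀ θ, Integrable (fun x : ℝ => Real.exp (θ * x)) μ) (θ : ℝ) :
    AnalyticAt ℝ (cgf' μ) θ := by
  rw [cgf_eq]
  exact ProbabilityTheory.analyticAt_cgf (by rw [iES hI]; trivial)

theorem cgf_diff (hI : ∀ θ, Integrable (fun x : ℝ => Real.exp (θ * x)) μ) :
    Differentiable ℝ (cgf' μ) := fun θ => (cgf_analytic hI θ).differentiableAt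

theorem cgf_diff2 (hI : ∀ θ, Integrable (fun x : ℝ => Real.exp (θ * x)) μ) :
    Differentiable ℝ (deriv (cgf' μ)) := fun θ => (cgf_analytic hI θ).deriv.differentiableAt

theorem cgf_convex (hI : ∀ θ, Integrable (fun x : ℝ => Real.exp (θ * x)) μ) :
    ConvexOn ℝ univ (cgf' μ) := by
  refine convexOn_univ_of_deriv2_nonneg (cgf_diff hI) (cgf_diff2 hI) fun x => ?_
  have h := ProbabilityTheory.iteratedDeriv_two_cgf_eq_integral (X := id) (μ := μ) (v := x) (by rw [iES hI]; trivial)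
  rw [iteratedDeriv_eq_iterate] at h
  rw [cgf_eq, h]
  refine div_nonneg (integral_nonneg fun ω => by positivity) ProbabilityTheory.mgf_nonneg

theorem cgf_mono (hI : ∀ θ, Integrable (fun x : ℝ => Real.exp (θ * x)) μ) :
    Monotone (deriv (cgf' μ)) := by
  intro a b hab
  exact (cgf_convex hI).monotoneOn_deriv (fun x _ => cgf_diff hI x) trivial trivial hab

theorem cgf_tangent (hI : ∀ θ, Integrable (fun x : ℝ => Real.exp (θ * x)) μ) (θ s : ℝ) :
    cgf' μ θ + deriv (cgf' μ) θ * (s - θ) ≤ cgf' μ s := by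
  rcases lt_trichotomy s θ with h | h | h
  · have := (cgf_convex hI).slope_le_deriv (x := s) (y := θ) trivial trivial h (cgf_diff hI θ)
    rw [slope_def_field, div_le_iff₀ (by linarith)] at this
    linarith
  · subst h; simp
  · have := (cgf_convex hI).deriv_le_slope (x := θ) (y := s) trivial trivial h (cgf_diff hI θ)
    rw [slope_def_field, le_div_iff₀ (by linarith)] at this
    linarith

theorem le_gamma (θ u : ℝ) : ENNReal.ofReal (θ * u - cgf' μ θ) ≤ gammaBeta μ u :=
  le_iSup (fun θ : ℝ => ENNReal.ofReal (θ * u - cgf' μ θ)) θ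

theorem gamma_deriv (hI : ∀ θ, Integrable (fun x : ℝ => Real.exp (θ * x)) μ) (θ : ℝ) :
    gammaBeta μ (deriv (cgf' μ) θ) = ENNReal.ofReal (θ * deriv (cgf' μ) θ - cgf' μ θ) := by
  refine le_antisymm (iSup_le fun s => ENNReal.ofReal_le_ofReal ?_) (le_gamma _ _)
  have := cgf_tangent hI θ s
  nlinarith

theorem gamma_deriv_nonneg (hI : ∀ θ, Integrable (fun x : ℝ => Real.exp (θ * x)) μ) (θ : ℝ) :
    0 ≤ θ * deriv (cgf' μ) θ - cgf' μ θ := by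
  have := cgf_tangent hI θ 0
  rw [cgf_zero] at this
  linarith

theorem gamma_lsc : LowerSemicontinuous (gammaBeta μ) := by
  refine lowerSemicontinuous_iSup fun θ => Continuous.lowerSemicontinuous ?_
  exact ENNReal.continuous_ofReal.comp (by fun_prop)

theorem gamma_meas : Measurable (gammaBeta μ) := gamma_lsc.measurable

/-- F7 -/
theorem gamma_clip_pos (hI : ∀ θ, Integrable (fun x : ℝ => Real.exp (θ * x)) μ) {J u : ℝ} (hJ : 0 ≤ J)
    (hu : deriv (cgf' μ) J ≤ u) : gammaBeta μ (deriv (cgf' μ) J) ≤ gammaBeta μ u := by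
  rw [gamma_deriv hI]
  refine le_trans (ENNReal.ofReal_le_ofReal ?_) (le_gamma J u)
  have := mul_le_mul_of_nonneg_left hu hJ
  linarith

theorem gamma_clip_neg (hI : ∀ θ, Integrable (fun x : ℝ => Real.exp (θ * x)) μ) {J u : ℝ} (hJ : J ≤ 0)
    (hu : u ≤ deriv (cgf' μ) J) : gammaBeta μ (deriv (cgf' μ) J) ≤ gammaBeta μ u := by
  rw [gamma_deriv hI]
  refine le_trans (ENNReal.ofReal_le_ofReal ?_) (le_gamma J u)
  have := mul_le_mul_of_nonpos_left hu hJ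
  linarith

/-- F5 -/
theorem gamma_fin_mem (hI : ∀ θ, Integrable (fun x : ℝ => Real.exp (θ * x)) μ) {u : ℝ}
    (hu : gammaBeta μ u ≠ ⊤) : u ∈ closure (Ncal μ) := by
  by_contra hn
  rw [Metric.mem_closure_iff] at hn
  push Not at hn
  obtain ⟨ε, hε, hn⟩ := hn
  have hcont : Continuous (deriv (cgf' μ)) := (cgf_diff2 hI).continuous
  have h1 : ∀ θ, ε ≤ |u - deriv (cgf' μ) θ| := fun θ => hn _ ⟨θ, rfl⟩
  have key : (∀ θ, deriv (cgf' μ) θ ≤ u - ε) ∨ (∀ θ, u + ε ≤ deriv (cgf' μ) θ) := by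
    by_contra hc
    push Not at hc
    obtain ⟨⟨a, ha⟩, b, hb⟩ := hc
    have ha' : u ≤ deriv (cgf' μ) a := by
      by_contra hx; push Not at hx
      have := h1 a; rw [abs_of_pos (by linarith)] at this; linarith
    have hb' : deriv (cgf' μ) b ≤ u := by
      by_contra hx; push Not at hx
      have := h1 b; rw [abs_of_neg (by linarith)] at this; linarith
    obtain ⟨c, hc⟩ := mem_range_of_exists_le_of_exists_ge hcont ⟨b, hb'⟩ ⟨a, ha'⟩
    have := h1 c; rw [hc] at this; simp at this; linarith
  refine hu (ENNReal.eq_top_of_forall_nnreal_le fun K => ?_)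
  rcases key with h | h
  · refine le_trans ?_ (le_gamma (K / ε) u)
    rw [← ENNReal.ofReal_coe_nnreal]
    refine ENNReal.ofReal_le_ofReal ?_
    have hKε : 0 ≤ (K:ℝ) / ε := by positivity
    have h2 := cgf_tangent hI (K/ε) 0
    rw [cgf_zero] at h2
    have h3 := mul_le_mul_of_nonneg_left (h (K/ε)) hKε
    have : (K:ℝ) / ε * ε = K := by field_simp
    nlinarith
  · refine le_trans ?_ (le_gamma (-(K / ε)) u)
    rw [← ENNReal.ofReal_coe_nnreal]
    refine ENNReal.ofReal_le_ofReal ?_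
    have hKε : 0 ≤ (K:ℝ) / ε := by positivity
    have h2 := cgf_tangent hI (-(K/ε)) 0
    rw [cgf_zero] at h2
    have h3 := mul_le_mul_of_nonneg_left (h (-(K/ε))) hKε
    have : (K:ℝ) / ε * ε = K := by field_simp
    nlinarith

theorem young_aux {r a x : ℝ} (hr : 1 ≤ r) (ha : 0 ≤ a) (hx : 0 ≤ x) :
    a ^ r + r * a ^ (r - 1) * (x - a) ≤ x ^ r := by
  rcases ha.eq_or_lt with h | h
  · subst h
    rcases hr.eq_or_lt with h1 | h1
    · subst h1; simp
    · rw [Real.zero_rpow (by linarith), Real.zero_rpow (by linarith)]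
      simp only [mul_zero, zero_mul, add_zero]
      positivity
  · have hb := one_add_mul_self_le_rpow_one_add (s := (x - a)/a) (by rw [le_div_iff₀ h]; linarith) hr
    have e : 1 + (x - a)/a = x / a := by field_simp; ring
    rw [e, Real.div_rpow hx h.le, le_div_iff₀ (by positivity)] at hb
    have e2 : a ^ (r-1) = a ^ r / a := Real.rpow_sub_one h.ne' r
    rw [e2]
    calc _ = (1 + r * ((x-a)/a)) * a ^ r := by field_simp
      _ ≤ _ := hb

/-- F4 -/
theorem gamma_lower {r : ℝ} (hr : 1 ≤ r) (h : TC μ r) {lam : ℝ} (hl : 0 < lam) (u : ℝ) :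
    ENNReal.ofReal (lam * |u| ^ r - Real.log (∫ x, Real.exp (lam * |x| ^ r) ∂μ)) ≤ gammaBeta μ u := by
  have hI := h.expInt hr
  have main : ∀ s : ℝ, |s| = 1 → s * u = |u| →
      ENNReal.ofReal (lam * |u| ^ r - Real.log (∫ x, Real.exp (lam * |x| ^ r) ∂μ)) ≤ gammaBeta μ u := by
    intro s hs hsu
    set θ := lam * r * |u| ^ (r-1) * s
    refine le_trans (ENNReal.ofReal_le_ofReal ?_) (le_gamma θ u)
    have hpt : ∀ x : ℝ, θ * x ≤ lam * |x| ^ r + (θ * u - lam * |u| ^ r) := by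
      intro x
      have h1 := young_aux hr (abs_nonneg u) (abs_nonneg x)
      have h2 : s * x ≤ |x| := (le_abs_self _).trans (by rw [abs_mul, hs, one_mul])
      have h3 : 0 ≤ lam * r * |u| ^ (r-1) := by positivity
      have h4 := mul_le_mul_of_nonneg_left h2 h3
      have h5 : θ * u = lam * r * |u| ^ (r-1) * |u| := by
        have : θ * u = lam * r * |u| ^ (r-1) * (s * u) := by simp only [θ]; ring
        rw [this, hsu]
      have h6 := mul_le_mul_of_nonneg_left h1 hl.le
      rw [h5]
      have : θ * x = lam * r * |u| ^ (r-1) * (s * x) := by simp only [θ]; ring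
      rw [this]
      nlinarith
    have h7 : ∫ x, Real.exp (θ * x) ∂μ ≤ Real.exp (θ * u - lam * |u| ^ r) * ∫ x, Real.exp (lam * |x| ^ r) ∂μ := by
      rw [← integral_const_mul]
      refine integral_mono (hI θ) ((h.int hl).const_mul _) fun x => ?_
      simp only
      rw [← Real.exp_add]
      refine Real.exp_le_exp.2 ?_
      linarith [hpt x]
    have h8 : cgf' μ θ ≤ θ * u - lam * |u| ^ r + Real.log (∫ x, Real.exp (lam * |x| ^ r) ∂μ) := by
      have h9 := Real.log_le_log (expPos hI θ) h7
      rw [Real.log_mul (Real.exp_pos _).ne' (integral_exp_pos (h.int hl)).ne', Real.log_exp] at h9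
      exact h9
    linarith
  rcases le_total 0 u with h0 | h0
  · exact main 1 (by simp) (by rw [abs_of_nonneg h0, one_mul])
  · exact main (-1) (by simp) (by rw [abs_of_nonpos h0]; ring)

end cgf

end

section
open MeasureTheory Filter Set
open scoped ENNReal NNReal

section nice
variable {μ : Measure ℝ} [IsProbabilityMeasure μ]

theorem enorm_rpow_eq {r : ℝ} (hr : 0 ≤ r) (x : ℝ) : ‖x‖ₑ ^ r = ENNReal.ofReal (|x| ^ r) := by
  rw [← ofReal_norm_eq_enorm, ENNReal.ofReal_rpow_of_nonneg (norm_nonneg _) hr, Real.norm_eq_abs]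

/-- log moment -/
noncomputable def logMom (μ : Measure ℝ) (r lam : ℝ) : ℝ :=
  Real.log (∫ x, Real.exp (lam * |x| ^ r) ∂μ)

theorem logMom_nonneg {r : ℝ} (h : TC μ r) {lam : ℝ} (hl : 0 < lam) : 0 ≤ logMom μ r lam := by
  refine Real.log_nonneg ?_
  calc (1:ℝ) = ∫ x, (1:ℝ) ∂μ := by simp
    _ ≤ _ := integral_mono (integrable_const _) (h.int hl) fun x =>
        Real.one_le_exp (by positivity)

theorem exp_logMom {r : ℝ} (h : TC μ r) {lam : ℝ} (hl : 0 < lam) :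
    ∫ x, Real.exp (lam * |x| ^ r) ∂μ = Real.exp (logMom μ r lam) := by
  rw [logMom, Real.exp_log (integral_exp_pos (h.int hl))]

theorem nice_mom {r : ℝ} (hr : 1 ≤ r) (h : TC μ r) {L : ℝ} (hL : 0 ≤ L) {f : ℝ → ℝ} (hf : Measurable f)
    (hf2 : ∫⁻ u, gammaBeta μ (f u) ∂unif01 ≤ ENNReal.ofReal L) :
    ∫⁻ u, ‖f u‖ₑ ^ r ∂unif01 ≤ ENNReal.ofReal (L + logMom μ r 1) := by
  have hp : ∀ u, ‖f u‖ₑ ^ r ≤ gammaBeta μ (f u) + ENNReal.ofReal (logMom μ r 1) := by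
    intro u
    rw [enorm_rpow_eq (by linarith)]
    calc ENNReal.ofReal (|f u| ^ r) = ENNReal.ofReal ((1 * |f u| ^ r - logMom μ r 1) + logMom μ r 1) := by
          congr 1; ring
      _ ≤ _ := ENNReal.ofReal_add_le
      _ ≤ _ := by gcongr; exact gamma_lower hr h one_pos (f u)
  calc _ ≤ ∫⁻ u, (gammaBeta μ (f u) + ENNReal.ofReal (logMom μ r 1)) ∂unif01 := lintegral_mono hp
    _ = ∫⁻ u, gammaBeta μ (f u) ∂unif01 + ENNReal.ofReal (logMom μ r 1) := by
        rw [lintegral_add_right _ measurable_const]; simp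
    _ ≤ _ := by
        rw [ENNReal.ofReal_add hL (logMom_nonneg h one_pos)]; gcongr

theorem nice_tail {r : ℝ} (hr : 1 ≤ r) (h : TC μ r) {L δ : ℝ} (hL : 0 ≤ L) (hδ : 0 < δ) :
    ∃ M0 : ℝ, ∀ M ≥ M0, ∀ f : ℝ → ℝ,
    ∫⁻ u, gammaBeta μ (f u) ∂unif01 ≤ ENNReal.ofReal L →
    ∫⁻ u, (if M < |f u| then ‖f u‖ₑ ^ r else 0) ∂unif01 ≤ ENNReal.ofReal δ := by
  set lam := 2 * (L + 1) / δ with hlam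
  have hl : 0 < lam := by positivity
  refine ⟨max 1 (2 * logMom μ r lam / lam), fun M hM f hf2 => ?_⟩
  have hp : ∀ u, (if M < |f u| then ‖f u‖ₑ ^ r else 0) ≤ ENNReal.ofReal (2 / lam) * gammaBeta μ (f u) := by
    intro u
    split_ifs with hu
    · rw [enorm_rpow_eq (by linarith)]
      refine le_trans ?_ (mul_le_mul_right (gamma_lower hr h hl (f u)) _)
      rw [← ENNReal.ofReal_mul (by positivity)]
      refine ENNReal.ofReal_le_ofReal ?_
      change _ ≤ 2 / lam * (lam * |f u| ^ r - logMom μ r lam)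
      have h1 : 1 ≤ |f u| := by linarith [le_max_left 1 (2 * logMom μ r lam / lam)]
      have h2 : 2 * logMom μ r lam / lam ≤ |f u| := by linarith [le_max_right 1 (2 * logMom μ r lam / lam)]
      have h3 := Real.rpow_le_rpow_of_exponent_le h1 hr
      rw [Real.rpow_one] at h3
      have h4 : 2 / lam * (lam * |f u| ^ r - logMom μ r lam) = 2 * |f u| ^ r - 2 * logMom μ r lam / lam := by
        field_simp
      linarith
    · exact zero_le
  calc _ ≤ ∫⁻ u, ENNReal.ofReal (2 / lam) * gammaBeta μ (f u) ∂unif01 := lintegral_mono hp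
    _ = ENNReal.ofReal (2 / lam) * ∫⁻ u, gammaBeta μ (f u) ∂unif01 := lintegral_const_mul' _ _ (by simp)
    _ ≤ ENNReal.ofReal (2 / lam) * ENNReal.ofReal L := by gcongr
    _ ≤ _ := by
      rw [← ENNReal.ofReal_mul (by positivity)]
      refine ENNReal.ofReal_le_ofReal ?_
      rw [hlam, show 2 / (2 * (L+1) / δ) * L = δ * (L / (L+1)) by field_simp]
      have : L / (L+1) ≤ 1 := by rw [div_le_one (by linarith)]; linarith
      nlinarith

/-- Chernoff bound for product measures. -/
theorem chernoff {n : ℕ} (g : Fin n → ℝ → ℝ) (hg : ∀ i, Measurable (g i)) (c : ℝ) :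
    (Measure.pi fun _ : Fin n => μ) {x | c ≤ ∑ i, g i (x i)} ≤
      ENNReal.ofReal (Real.exp (-c)) * ∏ i, ∫⁻ x, ENNReal.ofReal (Real.exp (g i x)) ∂μ := by
  have hm : Measurable fun x : Fin n → ℝ => ENNReal.ofReal (Real.exp (∑ i, g i (x i))) := by
    refine ENNReal.measurable_ofReal.comp (Real.measurable_exp.comp ?_)
    exact Finset.measurable_sum _ fun i _ => (hg i).comp (measurable_pi_apply i)
  have h1 : (Measure.pi fun _ : Fin n => μ) {x | c ≤ ∑ i, g i (x i)} =
      (Measure.pi fun _ : Fin n => μ) {x | ENNReal.ofReal (Real.exp c) ≤ ENNReal.ofReal (Real.exp (∑ i, g i (x i)))} := by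
    congr 1; ext x
    simp only [Set.mem_ofPred_eq]
    rw [ENNReal.ofReal_le_ofReal_iff (Real.exp_pos _).le, Real.exp_le_exp]
  rw [h1]
  have h2 := mul_meas_ge_le_lintegral (μ := Measure.pi fun _ : Fin n => μ) hm (ENNReal.ofReal (Real.exp c))
  have h3 : ∫⁻ x, ENNReal.ofReal (Real.exp (∑ i, g i (x i))) ∂(Measure.pi fun _ : Fin n => μ) =
      ∏ i, ∫⁻ x, ENNReal.ofReal (Real.exp (g i x)) ∂μ := by
    rw [← lintegral_pi_prod μ (fun i x => ENNReal.ofReal (Real.exp (g i x))) (fun i => ENNReal.measurable_ofReal.comp (Real.measurable_exp.comp (hg i)))]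
    refine lintegral_congr fun x => ?_
    rw [Real.exp_sum, ENNReal.ofReal_prod_of_nonneg fun _ _ => (Real.exp_pos _).le]
  rw [h3] at h2
  calc _ = ENNReal.ofReal (Real.exp (-c)) * (ENNReal.ofReal (Real.exp c) * _) := by
        rw [← mul_assoc, ← ENNReal.ofReal_mul (Real.exp_pos _).le, ← Real.exp_add]; simp
    _ ≤ _ := mul_le_mul_right h2 _

theorem tail_exp {r : ℝ} (h : TC μ r) {lam : ℝ} (hl : 0 < lam) :
    ∃ M0 : ℝ, ∀ M ≥ M0, ∫⁻ x, ENNReal.ofReal (Real.exp (if M < |x| then lam * |x| ^ r else 0)) ∂μ ≤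
      ENNReal.ofReal (Real.exp 1) := by
  have hm : ∀ M : ℝ, Measurable fun x : ℝ => ENNReal.ofReal (Real.exp (if M < |x| then lam * |x| ^ r else 0)) := by
    intro M
    refine ENNReal.measurable_ofReal.comp (Real.measurable_exp.comp ?_)
    exact Measurable.ite (measurableSet_lt measurable_const measurable_norm) (by fun_prop) measurable_const
  have ht : Tendsto (fun M : ℝ => ∫⁻ x, ENNReal.ofReal (Real.exp (if M < |x| then lam * |x| ^ r else 0)) ∂μ) atTop
      (nhds (∫⁻ x, (fun _ : ℝ => 1) x ∂μ)) := by
    refine tendsto_lintegral_filter_of_dominated_convergence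
      (fun x => ENNReal.ofReal (Real.exp (lam * |x| ^ r))) (Eventually.of_forall hm)
      (Eventually.of_forall fun M => Eventually.of_forall fun x => ?_) (h lam hl).ne
      (Eventually.of_forall fun x => ?_)
    · refine ENNReal.ofReal_le_ofReal (Real.exp_le_exp.2 ?_)
      split_ifs
      · exact le_rfl
      · positivity
    · refine tendsto_const_nhds.congr' ?_
      filter_upwards [eventually_ge_atTop (|x|)] with M hM
      rw [if_neg (not_lt.2 hM)]; simp
  have h1 : (∫⁻ x : ℝ, (fun _ : ℝ => (1:ℝ≥0∞)) x ∂μ) < ENNReal.ofReal (Real.exp 1) := by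
    simp
  obtain ⟨M0, hM0⟩ := eventually_atTop.1 (ht.eventually_lt_const h1)
  exact ⟨M0, fun M hM => (hM0 M hM).le⟩

theorem lintegral_tau_real {n : ℕ} (hn : 1 ≤ n) {τ : ℝ → Fin n} (hτ : Measurable τ)
    (hu : ∀ i, unif01 (τ ⁻¹' {i}) = (n : ℝ≥0∞)⁻¹) (g : Fin n → ℝ) (hg : ∀ i, 0 ≤ g i) :
    ∫⁻ u, ENNReal.ofReal (g (τ u)) ∂unif01 = ENNReal.ofReal ((∑ i, g i) / n) := by
  have h := lintegral_comp_tau hτ hu (fun i => ENNReal.ofReal (g i))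
  rw [h, ← ENNReal.ofReal_sum_of_nonneg fun i _ => hg i, div_eq_inv_mul, ENNReal.ofReal_mul (by positivity),
    ENNReal.ofReal_inv_of_pos (by positivity), ENNReal.ofReal_natCast]

theorem nicePack {r : ℝ} (hr : 1 ≤ r) (h : TC μ r) {L : ℝ} (hL : 0 ≤ L) {δ : ℝ} (hδ : 0 < δ) :
    ∃ M : ℝ, (∀ f : ℝ → ℝ, Measurable f → ∫⁻ u, gammaBeta μ (f u) ∂unif01 ≤ ENNReal.ofReal L →
      NiceF r (ENNReal.ofReal (L + logMom μ r 1)) (ENNReal.ofReal δ) M f) ∧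
    ∀ n : ℕ, 1 ≤ n → ∀ τ : ℝ → Fin n, Measurable τ → (∀ i, unif01 (τ ⁻¹' {i}) = (n : ℝ≥0∞)⁻¹) →
      (Measure.pi fun _ : Fin n => μ)
        {x | ¬ NiceF r (ENNReal.ofReal (L + logMom μ r 1)) (ENNReal.ofReal δ) M (fun u => x (τ u))} ≤
        2 * ENNReal.ofReal (Real.exp (-(n * L))) := by
  obtain ⟨M1, hM1⟩ := nice_tail hr h hL hδ
  set lam := (L + 1) / δ with hlam
  have hl : 0 < lam := by positivity
  obtain ⟨M2, hM2⟩ := tail_exp h hl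
  refine ⟨max M1 M2, fun f hf hf2 => ⟨nice_mom hr h hL hf hf2, hM1 _ (le_max_left _ _) f hf2⟩, ?_⟩
  intro n hn τ hτ hu
  set M := max M1 M2
  have hn0 : (0:ℝ) < n := by exact_mod_cast hn
  have hc := logMom_nonneg h one_pos
  set P := (Measure.pi fun _ : Fin n => μ)
  have A1 := chernoff (μ := μ) (n := n) (fun _ x => |x| ^ r) (fun _ => by fun_prop) (n * (L + logMom μ r 1))
  have A2 := chernoff (μ := μ) (n := n) (fun _ x => if M < |x| then lam * |x| ^ r else 0)
    (fun _ => Measurable.ite (measurableSet_lt measurable_const measurable_norm) (by fun_prop) measurable_const) (n * (L + 1))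
  have B1 : ENNReal.ofReal (Real.exp (-(n * (L + logMom μ r 1)))) *
      ∏ i : Fin n, ∫⁻ x, ENNReal.ofReal (Real.exp (|x| ^ r)) ∂μ ≤ ENNReal.ofReal (Real.exp (-(n * L))) := by
    have e : ∫⁻ x, ENNReal.ofReal (Real.exp (|x| ^ r)) ∂μ = ENNReal.ofReal (Real.exp (logMom μ r 1)) := by
      rw [← exp_logMom h one_pos, ofReal_integral_eq_lintegral_ofReal (h.int one_pos)
        (Eventually.of_forall fun x => (Real.exp_pos _).le)]
      simp
    rw [e, Finset.prod_const, Finset.card_univ, Fintype.card_fin, ← ENNReal.ofReal_pow (Real.exp_pos _).le,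
      ← Real.exp_nat_mul, ← ENNReal.ofReal_mul (Real.exp_pos _).le, ← Real.exp_add]
    refine ENNReal.ofReal_le_ofReal (Real.exp_le_exp.2 ?_)
    linarith
  have B2 : ENNReal.ofReal (Real.exp (-(n * (L + 1)))) *
      ∏ i : Fin n, ∫⁻ x, ENNReal.ofReal (Real.exp (if M < |x| then lam * |x| ^ r else 0)) ∂μ ≤
      ENNReal.ofReal (Real.exp (-(n * L))) := by
    rw [Finset.prod_const, Finset.card_univ, Fintype.card_fin]
    refine (mul_le_mul_right (pow_le_pow_left' (hM2 M (le_max_right _ _)) n) _).trans ?_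
    rw [← ENNReal.ofReal_pow (Real.exp_pos _).le,
      ← Real.exp_nat_mul, ← ENNReal.ofReal_mul (Real.exp_pos _).le, ← Real.exp_add]
    refine ENNReal.ofReal_le_ofReal (Real.exp_le_exp.2 ?_)
    linarith
  rw [two_mul]
  refine le_trans (measure_mono (t := {x : Fin n → ℝ | n * (L + logMom μ r 1) ≤ ∑ i, |x i| ^ r} ∪
    {x : Fin n → ℝ | n * (L + 1) ≤ ∑ i, if M < |x i| then lam * |x i| ^ r else 0}) ?_)
    ((measure_union_le _ _).trans (add_le_add (A1.trans B1) (A2.trans B2)))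
  intro x hx
  by_contra hcon
  simp only [mem_union, Set.mem_ofPred_eq, not_or, not_le] at hcon hx
  refine hx ⟨?_, ?_⟩
  · have e : ∀ u, ‖x (τ u)‖ₑ ^ r = ENNReal.ofReal ((fun i => |x i| ^ r) (τ u)) := fun u => enorm_rpow_eq (by linarith) _
    simp_rw [e]
    have := lintegral_tau_real hn hτ hu (fun i => |x i| ^ r) (fun i => by positivity)
    rw [this]
    refine ENNReal.ofReal_le_ofReal ?_
    rw [div_le_iff₀ hn0]; linarith [hcon.1]
  · have e : ∀ u, (if M < |x (τ u)| then ‖x (τ u)‖ₑ ^ r else 0) =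
        ENNReal.ofReal ((fun i => if M < |x i| then |x i| ^ r else 0) (τ u)) := by
      intro u
      simp only
      split_ifs
      · exact enorm_rpow_eq (by linarith) _
      · simp
    simp_rw [e]
    have := lintegral_tau_real hn hτ hu (fun i => if M < |x i| then |x i| ^ r else 0)
      (fun i => by split_ifs <;> positivity)
    rw [this]
    refine ENNReal.ofReal_le_ofReal ?_
    rw [div_le_iff₀ hn0]
    have h2 := hcon.2
    have e3 : ∑ i, (if M < |x i| then lam * |x i| ^ r else 0) = lam * ∑ i, (if M < |x i| then |x i| ^ r else 0) := by
      rw [Finset.mul_sum]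
      exact Finset.sum_congr rfl fun i _ => by split_ifs <;> simp
    rw [e3] at h2
    have e4 : lam * δ = L + 1 := by rw [hlam]; field_simp
    rw [← e4] at h2
    have : lam * ∑ i, (if M < |x i| then |x i| ^ r else 0) < lam * (δ * n) := by linarith
    exact (lt_of_mul_lt_mul_left this hl.le).le

end nice

end

section
open MeasureTheory Filter Set
open scoped ENNReal NNReal

section leg
variable {μ : Measure ℝ} [IsProbabilityMeasure μ]

theorem sum_iSup_aux {ι : Type*} (s : Finset ι) (g : ι → ℝ → ℝ≥0∞) (K : ℝ≥0∞) :
    ∀ c : ℝ≥0∞, (∀ θ : ι → ℝ, c + ∑ j ∈ s, g j (θ j) ≤ K) → c + ∑ j ∈ s, ⨆ t, g j t ≤ K := by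
  classical
  induction s using Finset.induction_on with
  | empty => intro c h; simpa using h (fun _ => 0)
  | insert a s ha ih =>
    intro c h
    rw [Finset.sum_insert ha, ENNReal.iSup_add, ENNReal.add_iSup]
    refine iSup_le fun t => ?_
    rw [← add_assoc]
    refine ih _ fun θ => ?_
    have := h (Function.update θ a t)
    rw [Finset.sum_insert ha, Function.update_self, ← add_assoc] at this
    refine le_trans (le_of_eq ?_) this
    congr 1
    refine Finset.sum_congr rfl fun j hj => ?_
    rw [Function.update_of_ne (by rintro rfl; exact ha hj)]

/-- cell weight -/
noncomputable def cw {ι : Type*} (τ : ℝ → ι) (j : ι) : ℝ := unif01.real (τ ⁻¹' {j})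

theorem cw_nonneg {ι : Type*} (τ : ℝ → ι) (j : ι) : 0 ≤ cw τ j := measureReal_nonneg

theorem lintegral_comp_cell {ι : Type*} [Fintype ι] [MeasurableSpace ι] [MeasurableSingletonClass ι]
    {τ : ℝ → ι} (hτ : Measurable τ) (g : ι → ℝ≥0∞) :
    ∫⁻ u, g (τ u) ∂unif01 = ∑ j, ENNReal.ofReal (cw τ j) * g j := by
  have h : ∫⁻ u, g (τ u) ∂unif01 = ∫⁻ i, g i ∂(unif01.map τ) :=
    (lintegral_map (measurable_of_finite g) hτ).symm
  rw [h, lintegral_fintype]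
  refine Finset.sum_congr rfl fun i _ => ?_
  rw [Measure.map_apply hτ (measurableSet_singleton i), mul_comm, cw, ofReal_measureReal]

theorem blockInt_cell {ι : Type*} [Fintype ι] [MeasurableSpace ι] [MeasurableSingletonClass ι]
    {τ : ℝ → ι} (hτ : Measurable τ) (c : ι → ℝ) (i : ι) :
    blockInt τ (fun u => c (τ u)) i = cw τ i * c i := by
  unfold blockInt
  rw [setIntegral_congr_fun (g := fun _ => c i) (hτ (measurableSet_singleton i))
    (fun u hu => by simp only [mem_preimage, mem_singleton_iff] at hu; simp [hu])]
  rw [setIntegral_const, smul_eq_mul]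
  rfl

theorem cell_integrable {ι : Type*} [Fintype ι] [MeasurableSpace ι] [MeasurableSingletonClass ι]
    {τ : ℝ → ι} (hτ : Measurable τ) (c : ι → ℝ) : Integrable (fun u => c (τ u)) unif01 := by
  refine Integrable.of_bound (C := ∑ i, |c i|)
    ((measurable_of_finite c).comp hτ).aestronglyMeasurable (Eventually.of_forall fun u => ?_)
  exact Finset.single_le_sum (f := fun i => |c i|) (fun _ _ => abs_nonneg _) (Finset.mem_univ _)

theorem integral_cell {ι : Type*} [Fintype ι] [MeasurableSpace ι] [MeasurableSingletonClass ι]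
    {τ : ℝ → ι} (hτ : Measurable τ) (c : ι → ℝ) {f : ℝ → ℝ} (hf : Integrable f unif01) :
    Integrable (fun u => c (τ u) * f u) unif01 ∧
    ∫ u, c (τ u) * f u ∂unif01 = ∑ j, c j * blockInt τ f j := by
  have hS : ∀ i, MeasurableSet (τ ⁻¹' {i}) := fun i => hτ (measurableSet_singleton i)
  have h1 : (fun u => c (τ u) * f u) = fun u => ∑ j, c j * (τ ⁻¹' {j}).indicator f u := by
    classical
    funext u
    rw [Finset.sum_eq_single (τ u)]
    · rw [indicator_of_mem (by simp)]
    · intro j _ hj; rw [indicator_of_notMem (by simpa using Ne.symm hj), mul_zero]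
    · simp
  have h2 : ∀ j, Integrable (fun u => c j * (τ ⁻¹' {j}).indicator f u) unif01 :=
    fun j => (hf.indicator (hS j)).const_mul _
  rw [h1]
  refine ⟨integrable_finsetSum _ fun j _ => h2 j, ?_⟩
  rw [integral_finsetSum _ fun j _ => h2 j]
  refine Finset.sum_congr rfl fun j _ => ?_
  rw [integral_const_mul, integral_indicator (hS j)]
  rfl

theorem integral_le_of_lintegral_pos {g : ℝ → ℝ} (hg : Integrable g unif01) {L : ℝ} (hL : 0 ≤ L)
    (h : ∫⁻ u, ENNReal.ofReal (g u) ∂unif01 ≤ ENNReal.ofReal L) : ∫ u, g u ∂unif01 ≤ L := by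
  rw [integral_eq_lintegral_pos_part_sub_lintegral_neg_part hg]
  have := ENNReal.toReal_mono ENNReal.ofReal_ne_top h
  rw [ENNReal.toReal_ofReal hL] at this
  have h2 : 0 ≤ (∫⁻ u, ENNReal.ofReal (-g u) ∂unif01).toReal := ENNReal.toReal_nonneg
  linarith

theorem fenchel {ι : Type*} [Fintype ι] [MeasurableSpace ι] [MeasurableSingletonClass ι]
    {τ : ℝ → ι} (hτ : Measurable τ) {f : ℝ → ℝ} (hf : Integrable f unif01) {L : ℝ} (hL : 0 ≤ L)
    (hf2 : ∫⁻ u, gammaBeta μ (f u) ∂unif01 ≤ ENNReal.ofReal L) (θ : ι → ℝ) :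
    ∑ j, (θ j * blockInt τ f j - cw τ j * cgf' μ (θ j)) ≤ L := by
  obtain ⟨h1, h2⟩ := integral_cell hτ θ hf
  have h3 := integral_cell hτ (fun j => cgf' μ (θ j)) (integrable_const (μ := unif01) (1:ℝ))
  have h4 : ∀ j, blockInt τ (fun _ => (1:ℝ)) j = cw τ j := by
    intro j; unfold blockInt; rw [setIntegral_const]; simp [cw]
  simp only [mul_one, h4] at h3
  rw [Finset.sum_sub_distrib, ← h2]
  simp_rw [mul_comm (cw τ _)]
  rw [← h3.2, ← integral_sub h1 h3.1]
  refine integral_le_of_lintegral_pos (h1.sub h3.1) hL (le_trans (lintegral_mono fun u => ?_) hf2)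
  exact le_gamma _ _

theorem legendre {ι : Type*} [Fintype ι] [MeasurableSpace ι] [MeasurableSingletonClass ι]
    {τ : ℝ → ι} (hτ : Measurable τ) (b : ι → ℝ) {L : ℝ} (hb : ∀ j, cw τ j = 0 → b j = 0)
    (h : ∀ θ : ι → ℝ, ∑ j, (θ j * b j - cw τ j * cgf' μ (θ j)) ≤ L) :
    ∫⁻ u, gammaBeta μ (b (τ u) / cw τ (τ u)) ∂unif01 ≤ ENNReal.ofReal L := by
  classical
  have h0 := lintegral_comp_cell hτ (fun j => gammaBeta μ (b j / cw τ j))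
  rw [h0]
  unfold gammaBeta
  simp_rw [ENNReal.mul_iSup]
  have := sum_iSup_aux Finset.univ (fun j t => ENNReal.ofReal (cw τ j) * ENNReal.ofReal (t * (b j / cw τ j) - cgf' μ t))
    (ENNReal.ofReal L) 0 ?_
  · simpa using this
  intro θ
  rw [zero_add]
  set θ' : ι → ℝ := fun j => if 0 ≤ θ j * (b j / cw τ j) - cgf' μ (θ j) then θ j else 0
  refine le_trans (le_of_eq ?_) (ENNReal.ofReal_le_ofReal (h θ'))
  have e : ∀ j, ENNReal.ofReal (cw τ j) * ENNReal.ofReal (θ j * (b j / cw τ j) - cgf' μ (θ j)) =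
      ENNReal.ofReal (θ' j * b j - cw τ j * cgf' μ (θ' j)) ∧ 0 ≤ θ' j * b j - cw τ j * cgf' μ (θ' j) := by
    intro j
    have hw := cw_nonneg τ j
    have hbw : b j = cw τ j * (b j / cw τ j) := by
      rcases eq_or_ne (cw τ j) 0 with h | h
      · rw [hb j h]; simp
      · field_simp
    by_cases hc : 0 ≤ θ j * (b j / cw τ j) - cgf' μ (θ j)
    · have e1 : θ' j = θ j := by simp only [θ']; rw [if_pos hc]
      have e2 : θ j * b j - cw τ j * cgf' μ (θ j) = cw τ j * (θ j * (b j / cw τ j) - cgf' μ (θ j)) := by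
        conv_lhs => rw [hbw]
        ring
      rw [e1, e2, ENNReal.ofReal_mul hw]
      exact ⟨rfl, mul_nonneg hw hc⟩
    · have e1 : θ' j = 0 := by simp only [θ']; rw [if_neg hc]
      rw [e1, cgf_zero]
      simp
      right; linarith
  rw [ENNReal.ofReal_sum_of_nonneg fun j _ => (e j).2]
  exact Finset.sum_congr rfl fun j _ => (e j).1

theorem G1_congr {v : ℕ} (G : SimpleGraph (Fin v)) [DecidableRel G.Adj] (W : ℝ → ℝ → ℝ) {f g : ℝ → ℝ}
    (h : f =ᵐ[unif01] g) : G1 G W f = G1 G W g := by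
  unfold G1
  refine integral_congr_ae ?_
  have : ∀ a : Fin v, ∀ᵐ x ∂(Measure.pi fun _ : Fin v => unif01), f (x a) = g (x a) := fun a =>
    (measurePreserving_eval (fun _ : Fin v => unif01) a).quasiMeasurePreserving.ae h
  filter_upwards [ae_all_iff.2 this] with x hx
  simp only [hx]

theorem rate1_le {v : ℕ} (G : SimpleGraph (Fin v)) [DecidableRel G.Adj] (W : ℝ → ℝ → ℝ) {p : ℝ≥0∞}
    (hp : 1 ≤ p) (hpt : p ≠ ⊤) (h : TC μ p.toReal) {f : ℝ → ℝ} (hf : Measurable f)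
    {L : ℝ} (hL : 0 ≤ L) (hfin : ∫⁻ u, gammaBeta μ (f u) ∂unif01 ≤ ENNReal.ofReal L) :
    rate1 G W μ p (G1 G W f) ≤ ∫⁻ u, gammaBeta μ (f u) ∂unif01 := by
  classical
  have hp0 : p ≠ 0 := (zero_lt_one.trans_le hp).ne'
  have hr : 1 ≤ p.toReal := by
    rw [← ENNReal.toReal_one]; exact ENNReal.toReal_mono hpt hp
  have hI := h.expInt hr
  set f' : ℝ → ℝ := fun u => if gammaBeta μ (f u) = ⊤ then deriv (cgf' μ) 0 else f u with hf'
  have hm : Measurable f' := Measurable.ite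
    ((gamma_meas.comp hf) (measurableSet_singleton ⊤)) measurable_const hf
  have hae : f' =ᵐ[unif01] f := by
    filter_upwards [ae_lt_top (gamma_meas.comp hf) (hfin.trans_lt ENNReal.ofReal_lt_top).ne] with u hu
    simp only [hf', Function.comp] at *
    rw [if_neg hu.ne]
  have e1 : ∫⁻ u, gammaBeta μ (f' u) ∂unif01 = ∫⁻ u, gammaBeta μ (f u) ∂unif01 :=
    lintegral_congr_ae (by filter_upwards [hae] with u hu; rw [hu])
  have hmem : f' ∈ Lcal μ p := by
    refine ⟨hm, fun u _ => ?_, ?_⟩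
    · simp only [hf']
      split_ifs with hu
      · exact subset_closure ⟨0, rfl⟩
      · exact gamma_fin_mem hI hu
    · rw [eLpNorm_lt_top_iff_lintegral_rpow_enorm_lt_top hp0 hpt]
      exact (nice_mom hr h hL hm (by rw [e1]; exact hfin)).trans_lt ENNReal.ofReal_lt_top
  rw [← e1]
  exact iInf_le (fun f : {g : ℝ → ℝ // g ∈ Lcal μ p ∧ (∫⁻ u, gammaBeta μ (g u) ∂unif01) ≠ ⊤ ∧
      G1 G W g = G1 G W f} => ∫⁻ u, gammaBeta μ (f.1 u) ∂unif01)
    ⟨f', hmem, by rw [e1]; exact (hfin.trans_lt ENNReal.ofReal_lt_top).ne, G1_congr G W hae⟩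

end leg

end

section
open MeasureTheory Filter Set
open scoped ENNReal NNReal

section finc
variable {Ω : Type*} [mΩ : MeasurableSpace Ω] (ν : Measure Ω) [IsProbabilityMeasure ν]
  {ι : Type*} [Fintype ι] [MeasurableSpace ι] [MeasurableSingletonClass ι]

theorem integral_cellG {τ : Ω → ι} (hτ : Measurable τ) (c : ι → ℝ) {f : Ω → ℝ} (hf : Integrable f ν) :
    Integrable (fun u => c (τ u) * f u) ν ∧
    ∫ u, c (τ u) * f u ∂ν = ∑ j, c j * ∫ u in τ ⁻¹' {j}, f u ∂ν := by
  have hS : ∀ i, MeasurableSet (τ ⁻¹' {i}) := fun i => hτ (measurableSet_singleton i)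
  have h1 : (fun u => c (τ u) * f u) = fun u => ∑ j, c j * (τ ⁻¹' {j}).indicator f u := by
    classical
    funext u
    rw [Finset.sum_eq_single (τ u)]
    · rw [indicator_of_mem (by simp)]
    · intro j _ hj; rw [indicator_of_notMem (by simpa using Ne.symm hj), mul_zero]
    · simp
  have h2 : ∀ j, Integrable (fun u => c j * (τ ⁻¹' {j}).indicator f u) ν :=
    fun j => (hf.indicator (hS j)).const_mul _
  rw [h1]
  refine ⟨integrable_finsetSum _ fun j _ => h2 j, ?_⟩
  rw [integral_finsetSum _ fun j _ => h2 j]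
  refine Finset.sum_congr rfl fun j _ => ?_
  rw [integral_const_mul, integral_indicator (hS j)]

theorem setIntegral_cellG {τ : Ω → ι} (hτ : Measurable τ) (A : Set ι) {f : Ω → ℝ} (hf : Integrable f ν) :
    ∫ u in τ ⁻¹' A, f u ∂ν = ∑ j, A.indicator (fun _ => (1:ℝ)) j * ∫ u in τ ⁻¹' {j}, f u ∂ν := by
  rw [← (integral_cellG ν hτ _ hf).2, ← integral_indicator (hτ (Set.toFinite A).measurableSet)]
  refine integral_congr_ae (Eventually.of_forall fun u => ?_)
  by_cases hu : τ u ∈ A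
  · simp [hu, indicator]
  · simp [hu, indicator]

/-- The cell average. -/
noncomputable def cavg (τ : Ω → ι) (V : Ω → ℝ) (i : ι) : ℝ :=
  (ν.real (τ ⁻¹' {i}))⁻¹ * ∫ z in τ ⁻¹' {i}, V z ∂ν

theorem cell_integrableG {τ : Ω → ι} (hτ : Measurable τ) (c : ι → ℝ) : Integrable (fun u => c (τ u)) ν := by
  have := (integral_cellG ν hτ c (integrable_const (μ := ν) (1:ℝ))).1
  simpa using this

theorem cell_setIntegral {τ : Ω → ι} (hτ : Measurable τ) (c : ι → ℝ) (i : ι) :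
    ∫ u in τ ⁻¹' {i}, c (τ u) ∂ν = ν.real (τ ⁻¹' {i}) * c i := by
  rw [setIntegral_congr_fun (g := fun _ => c i) (hτ (measurableSet_singleton i))
    (fun u hu => by simp only [mem_preimage, mem_singleton_iff] at hu; simp [hu])]
  rw [setIntegral_const, smul_eq_mul]

theorem cavg_setIntegral {τ : Ω → ι} (hτ : Measurable τ) (V : Ω → ℝ) (i : ι) :
    ∫ u in τ ⁻¹' {i}, cavg ν τ V (τ u) ∂ν = ∫ z in τ ⁻¹' {i}, V z ∂ν := by
  rw [cell_setIntegral ν hτ, cavg]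
  rcases eq_or_ne (ν.real (τ ⁻¹' {i})) 0 with h | h
  · rw [setIntegral_measure_zero _ (by rwa [measureReal_eq_zero_iff] at h)]; simp
  · field_simp

theorem condExp_fin {τ : Ω → ι} (hτ : Measurable τ) {V : Ω → ℝ} (hV : Integrable V ν) :
    (fun ω => cavg ν τ V (τ ω)) =ᵐ[ν] ν[V | MeasurableSpace.comap τ inferInstance] := by
  refine ae_eq_condExp_of_forall_setIntegral_eq hτ.comap_le hV
    (fun s _ _ => (cell_integrableG ν hτ _).integrableOn) (fun s hs _ => ?_)
    ((measurable_of_finite (cavg ν τ V)).comp (comap_measurable τ)).stronglyMeasurable.aestronglyMeasurable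
  obtain ⟨A, _, rfl⟩ := hs
  rw [setIntegral_cellG ν hτ A (cell_integrableG ν hτ _), setIntegral_cellG ν hτ A hV]
  exact Finset.sum_congr rfl fun j _ => by rw [cavg_setIntegral ν hτ]

end finc

/-- enumeration of the rationals -/
noncomputable def rq (i : ℕ) : ℝ := (((Encodable.decode i : Option ℚ).getD 0 : ℚ) : ℝ)

theorem rq_surj (q : ℚ) : ∃ i, rq i = q := ⟨Encodable.encode q, by simp [rq]⟩

/-- Finite cell index. -/
noncomputable def ind (k : ℕ) (x : ℝ) : Fin k → Bool := fun i => decide (x < rq i)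

theorem ind_meas (k : ℕ) : Measurable (ind k) := by
  refine measurable_pi_iff.2 fun i => measurable_to_bool ?_
  have : (fun x => ind k x i) ⁻¹' {true} = Iio (rq i) := by ext x; simp [ind]
  rw [this]; exact measurableSet_Iio

theorem ind_factor {k l : ℕ} (h : k ≤ l) : ind k = (fun j i => j (Fin.castLE h i)) ∘ ind l := by
  funext x i; simp [ind]

theorem comap_ind_mono {k l : ℕ} (h : k ≤ l) :
    MeasurableSpace.comap (ind k) inferInstance ≤ MeasurableSpace.comap (ind l) inferInstance := by
  rw [ind_factor h, ← MeasurableSpace.comap_comp]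
  refine MeasurableSpace.comap_mono ?_
  exact (measurable_of_finite _).comap_le

/-- 1-dimensional filtration -/
noncomputable def filt1 : Filtration ℕ (inferInstance : MeasurableSpace ℝ) where
  seq k := MeasurableSpace.comap (ind k) inferInstance
  mono' _ _ h := comap_ind_mono h
  le' k := (ind_meas k).comap_le

theorem filt1_sup : (⨆ k, (filt1 k : MeasurableSpace ℝ)) = (inferInstance : MeasurableSpace ℝ) := by
  refine le_antisymm (iSup_le fun k => filt1.le k) ?_
  have hb : (inferInstance : MeasurableSpace ℝ) = MeasurableSpace.generateFrom (⋃ a : ℚ, {Iio (a : ℝ)}) := by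
    rw [← Real.borel_eq_generateFrom_Iio_rat]; exact BorelSpace.measurable_eq
  refine hb.le.trans ?_
  refine MeasurableSpace.generateFrom_le fun s hs => ?_
  simp only [mem_iUnion, mem_singleton_iff] at hs
  obtain ⟨a, rfl⟩ := hs
  obtain ⟨i, hi⟩ := rq_surj a
  refine (le_iSup (fun k => (filt1 k : MeasurableSpace ℝ)) (i+1)) _ ?_
  refine ⟨{j | j (Fin.last i) = true}, (Set.toFinite _).measurableSet, ?_⟩
  ext x; simp [ind, hi]

/-- 2-dimensional cell index -/
noncomputable def ind2 (k : ℕ) (z : ℝ × ℝ) : (Fin k → Bool) × (Fin k → Bool) := (ind k z.1, ind k z.2)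

theorem ind2_meas (k : ℕ) : Measurable (ind2 k) :=
  ((ind_meas k).comp measurable_fst).prodMk ((ind_meas k).comp measurable_snd)

theorem comap_ind2 (k : ℕ) : MeasurableSpace.comap (ind2 k) inferInstance =
    MeasurableSpace.comap Prod.fst (filt1 k) ⊔ MeasurableSpace.comap Prod.snd (filt1 k) := by
  have : (inferInstance : MeasurableSpace ((Fin k → Bool) × (Fin k → Bool))) =
    MeasurableSpace.comap Prod.fst inferInstance ⊔ MeasurableSpace.comap Prod.snd inferInstance := rfl
  rw [this, MeasurableSpace.comap_sup]
  simp only [filt1, MeasurableSpace.comap_comp]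
  rfl

/-- 2-dimensional filtration -/
noncomputable def filt2 : Filtration ℕ (inferInstance : MeasurableSpace (ℝ × ℝ)) where
  seq k := MeasurableSpace.comap (ind2 k) inferInstance
  mono' k l h := by
    simp only [comap_ind2]
    exact sup_le_sup (MeasurableSpace.comap_mono (filt1.mono h)) (MeasurableSpace.comap_mono (filt1.mono h))
  le' k := (ind2_meas k).comap_le

theorem filt2_sup : (⨆ k, (filt2 k : MeasurableSpace (ℝ × ℝ))) = (inferInstance : MeasurableSpace (ℝ × ℝ)) := by
  have h : ∀ k, (filt2 k : MeasurableSpace (ℝ × ℝ)) =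
    MeasurableSpace.comap Prod.fst (filt1 k) ⊔ MeasurableSpace.comap Prod.snd (filt1 k) := comap_ind2
  simp_rw [h]
  rw [iSup_sup_eq, ← MeasurableSpace.comap_iSup, ← MeasurableSpace.comap_iSup, filt1_sup]
  rfl

end

section
open MeasureTheory Filter Set
open scoped ENNReal NNReal

/-- unit square measure -/
noncomputable abbrev unifSq : Measure (ℝ × ℝ) := unif01.prod unif01

theorem cutle_L1 {D : ℝ → ℝ → ℝ} (hD : Integrable (Function.uncurry D) unifSq) :
    CutLe D (∫ z, |Function.uncurry D z| ∂unifSq) := by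
  intro S T hS hT
  have h := setIntegral_prod (μ := unif01) (ν := unif01) (s := S) (t := T) (Function.uncurry D) hD.integrableOn
  simp only [Function.uncurry] at h
  rw [← h]
  refine (abs_integral_le_integral_abs).trans ?_
  exact setIntegral_le_integral hD.abs (Eventually.of_forall fun _ => abs_nonneg _)

theorem CutLe.mono {D : ℝ → ℝ → ℝ} {η η' : ℝ} (h : CutLe D η) (hη : η ≤ η') : CutLe D η' :=
  fun S T hS hT => (h S T hS hT).trans hη

theorem CutLe.symm {U V : ℝ → ℝ → ℝ} {η : ℝ} (h : CutLe (fun x y => U x y - V x y) η) :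
    CutLe (fun x y => V x y - U x y) η := by
  intro S T hS hT
  have := h S T hS hT
  rw [← abs_neg, ← integral_neg] at this
  simp_rw [← integral_neg] at this
  simpa using this

theorem cell2_le {U W : ℝ → ℝ → ℝ} (hU : Integrable (Function.uncurry U) unifSq)
    (hW : Integrable (Function.uncurry W) unifSq) {η : ℝ} (h : CutLe (fun x y => U x y - W x y) η) (k : ℕ)
    (c : (Fin k → Bool) × (Fin k → Bool)) :
    |∫ z in ind2 k ⁻¹' {c}, Function.uncurry U z ∂unifSq - ∫ z in ind2 k ⁻¹' {c}, Function.uncurry W z ∂unifSq| ≤ η := by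
  have e : ind2 k ⁻¹' {c} = (ind k ⁻¹' {c.1}) ×ˢ (ind k ⁻¹' {c.2}) := by
    ext z; simp [ind2, Prod.ext_iff]
  rw [← integral_sub hU.integrableOn hW.integrableOn, e]
  have h1 := setIntegral_prod (μ := unif01) (ν := unif01) (s := ind k ⁻¹' {c.1}) (t := ind k ⁻¹' {c.2})
    (fun z => Function.uncurry U z - Function.uncurry W z) (hU.sub hW).integrableOn
  rw [h1]
  exact h _ _ (ind_meas k (measurableSet_singleton _)) (ind_meas k (measurableSet_singleton _))

theorem limit_pack {W : ℝ → ℝ → ℝ} (hWm : Measurable (Function.uncurry W))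
    (hW : Integrable (Function.uncurry W) unifSq) {r B : ℝ≥0∞} (hr : r = 0 ∨ 1 ≤ r)
    (hU : ∀ η > 0, ∃ U : ℝ → ℝ → ℝ, Integrable (Function.uncurry U) unifSq ∧ kerNorm U r ≤ B ∧
      CutLe (fun x y => U x y - W x y) η) :
    kerNorm W r ≤ B ∧ ∀ η > 0, ∃ k, ∃ h : (Fin k → Bool) → (Fin k → Bool) → ℝ,
      kerNorm (fun x y => h (ind k x) (ind k y)) r ≤ B ∧
      CutLe (fun x y => W x y - h (ind k x) (ind k y)) η := by
  choose! U hUi hUB hUc using hU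
  have hηpos : ∀ m : ℕ, (0:ℝ) < 1 / ((m:ℝ) + 1) := fun m => by positivity
  have hcell : ∀ k c, Tendsto (fun m : ℕ => cavg unifSq (ind2 k) (Function.uncurry (U (1 / ((m:ℝ) + 1)))) c) atTop
      (nhds (cavg unifSq (ind2 k) (Function.uncurry W) c)) := by
    intro k c
    refine Tendsto.const_mul _ ?_
    rw [tendsto_iff_norm_sub_tendsto_zero]
    refine squeeze_zero (fun _ => norm_nonneg _) (fun m => ?_) tendsto_one_div_add_atTop_nhds_zero_nat
    exact cell2_le (hUi _ (hηpos m)) hW (hUc _ (hηpos m)) k c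
  have hSm : ∀ (k : ℕ) (c : (Fin k → Bool) × (Fin k → Bool) → ℝ), AEStronglyMeasurable (fun z => c (ind2 k z)) unifSq :=
    fun k c => ((measurable_of_finite c).comp (ind2_meas k)).aestronglyMeasurable
  have hS : ∀ k, eLpNorm (fun z => cavg unifSq (ind2 k) (Function.uncurry W) (ind2 k z)) r unifSq ≤ B := by
    intro k
    rcases hr with hr | hr
    · rw [hr, eLpNorm_exponent_zero]; exact zero_le
    refine (Lp.eLpNorm_lim_le_liminf_eLpNorm
      (f := fun (m : ℕ) z => cavg unifSq (ind2 k) (Function.uncurry (U (1 / ((m:ℝ) + 1)))) (ind2 k z))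
      (fun m => hSm k _) _ (Eventually.of_forall fun z => hcell k _)).trans ?_
    refine liminf_le_of_le (by isBoundedDefault) (fun b hb => ?_)
    obtain ⟨m, hm⟩ := hb.exists
    refine hm.trans ?_
    rw [eLpNorm_congr_ae (condExp_fin unifSq (ind2_meas k) (hUi _ (hηpos m)))]
    exact (eLpNorm_condExp_le_eLpNorm _ hr).trans (hUB _ (hηpos m))
  have hWs : StronglyMeasurable[⨆ k, filt2 k] (Function.uncurry W) := by
    rw [filt2_sup]; exact hWm.stronglyMeasurable
  have hcong : ∀ k, (fun z => cavg unifSq (ind2 k) (Function.uncurry W) (ind2 k z)) =ᵐ[unifSq]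
      unifSq[Function.uncurry W | filt2 k] := fun k => condExp_fin unifSq (ind2_meas k) hW
  constructor
  · have h1 := hW.tendsto_ae_condExp hWs
    have h2 : ∀ᵐ z ∂unifSq, Tendsto (fun k => cavg unifSq (ind2 k) (Function.uncurry W) (ind2 k z)) atTop
        (nhds (Function.uncurry W z)) := by
      filter_upwards [h1, ae_all_iff.2 hcong] with z hz hc
      exact hz.congr fun k => (hc k).symm
    refine (Lp.eLpNorm_lim_le_liminf_eLpNorm (p := r) (fun k => hSm k _) _ h2).trans ?_
    refine liminf_le_of_le (by isBoundedDefault) (fun b hb => ?_)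
    obtain ⟨m, hm⟩ := hb.exists
    exact hm.trans (hS m)
  · intro η hη
    have h1 := hW.tendsto_eLpNorm_condExp hWs
    obtain ⟨k, hk⟩ := (h1.eventually_lt_const (ENNReal.ofReal_pos.2 hη)).exists
    refine ⟨k, fun i j => cavg unifSq (ind2 k) (Function.uncurry W) (i, j), hS k, ?_⟩
    have hSi : Integrable (fun z => cavg unifSq (ind2 k) (Function.uncurry W) (ind2 k z)) unifSq :=
      cell_integrableG unifSq (ind2_meas k) _
    refine (cutle_L1 (D := fun x y => W x y - cavg unifSq (ind2 k) (Function.uncurry W) (ind k x, ind k y)) (hW.sub hSi)).mono ?_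
    have h3 : eLpNorm (fun z => cavg unifSq (ind2 k) (Function.uncurry W) (ind2 k z) - Function.uncurry W z) 1 unifSq < ENNReal.ofReal η := by
      rw [eLpNorm_congr_ae (g := unifSq[Function.uncurry W | filt2 k] - Function.uncurry W)]
      · exact hk
      · filter_upwards [hcong k] with z hz
        simp [hz]
    have h5 := ofReal_integral_norm_eq_lintegral_enorm (hSi.sub hW)
    simp only [Pi.sub_apply] at h5
    rw [eLpNorm_one_eq_lintegral_enorm, ← h5] at h3
    have h4 := (ENNReal.ofReal_lt_ofReal_iff hη).1 h3
    refine le_trans (le_of_eq ?_) h4.le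
    refine integral_congr_ae (Eventually.of_forall fun z => ?_)
    simp only [Function.uncurry, ind2, Real.norm_eq_abs]
    rw [abs_sub_comm]

end

section
open MeasureTheory Filter Set
open scoped ENNReal NNReal

/-- block index -/
noncomputable def blk (n : ℕ) (hn : 0 < n) (x : ℝ) : Fin n := ⟨min (⌈(n:ℝ) * x⌉₊ - 1) (n - 1), by omega⟩

theorem blk_meas (n : ℕ) (hn : 0 < n) : Measurable (blk n hn) := by
  have h : Measurable fun x : ℝ => ⌈(n:ℝ) * x⌉₊ := Nat.measurable_ceil.comp (by fun_prop)
  have h2 : blk n hn = (fun m : ℕ => (⟨min (m - 1) (n - 1), by omega⟩ : Fin n)) ∘ fun x : ℝ => ⌈(n:ℝ) * x⌉₊ := rfl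
  rw [h2]
  exact (measurable_of_countable _).comp h

theorem blk_iff {n : ℕ} (hn : 0 < n) {x : ℝ} (hx : x ∈ Ioc (0:ℝ) 1) (i : Fin n) :
    x ∈ Ioc (((i : ℕ) : ℝ)/n) ((((i : ℕ) : ℝ)+1)/n) ↔ i = blk n hn x := by
  have hn0 : (0:ℝ) < n := by exact_mod_cast hn
  have h1 : 0 < ⌈(n:ℝ) * x⌉₊ := Nat.ceil_pos.2 (mul_pos hn0 hx.1)
  have h2 : ⌈(n:ℝ) * x⌉₊ ≤ n := Nat.ceil_le.2 (by nlinarith [hx.2])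
  have h3 : ⌈(n:ℝ) * x⌉₊ = (i:ℕ) + 1 ↔ i = blk n hn x := by
    rw [Fin.ext_iff]; simp only [blk]; omega
  rw [← h3, Nat.ceil_eq_iff (by omega), mem_Ioc, div_lt_iff₀ hn0, le_div_iff₀ hn0]
  simp [mul_comm]

theorem step_eq {n : ℕ} (hn : 0 < n) (Q : Fin n → Fin n → ℝ) {x y : ℝ} (hx : x ∈ Ioc (0:ℝ) 1)
    (hy : y ∈ Ioc (0:ℝ) 1) : stepKernel n Q x y = Q (blk n hn x) (blk n hn y) := by
  unfold stepKernel
  simp_rw [blk_iff hn hx, blk_iff hn hy]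
  rw [Finset.sum_eq_single (blk n hn x), Finset.sum_eq_single (blk n hn y)]
  · simp
  · intro j _ hj; simp [hj]
  · simp
  · intro j _ hj; simp [hj]
  · simp

theorem ae_Ioc : ∀ᵐ x ∂unif01, x ∈ Ioc (0:ℝ) 1 := by
  unfold unif01
  rw [← restrict_Ioc_eq_restrict_Icc]
  exact ae_restrict_mem measurableSet_Ioc

theorem blk_unif {n : ℕ} (hn : 0 < n) (i : Fin n) : unif01 (blk n hn ⁻¹' {i}) = (n : ℝ≥0∞)⁻¹ := by
  have hn0 : (0:ℝ) < n := by exact_mod_cast hn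
  have h : unif01 (blk n hn ⁻¹' {i}) = unif01 (Ioc (((i : ℕ) : ℝ)/n) ((((i : ℕ) : ℝ)+1)/n)) := by
    refine measure_congr ?_
    filter_upwards [ae_Ioc] with x hx
    refine propext ?_
    change blk n hn x = i ↔ x ∈ Ioc (((i : ℕ) : ℝ)/n) ((((i : ℕ) : ℝ)+1)/n)
    rw [blk_iff hn hx]; exact eq_comm
  rw [h, unif01, Measure.restrict_apply measurableSet_Ioc, inter_eq_left.2, Real.volume_Ioc]
  · rw [← sub_div, add_sub_cancel_left, ENNReal.ofReal_div_of_pos hn0]; simp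
  · intro x hx
    have h1 : 0 ≤ ((i:ℕ):ℝ) / n := by positivity
    have h2 : (((i : ℕ) : ℝ)+1)/n ≤ 1 := by
      rw [div_le_one hn0]; exact_mod_cast i.2
    exact ⟨h1.trans hx.1.le, hx.2.trans h2⟩

theorem cutDist_cutLe {U W : ℝ → ℝ → ℝ} (hD : Integrable (Function.uncurry fun x y => U x y - W x y) unifSq)
    {η : ℝ} (h : cutDist U W ≤ η) : CutLe (fun x y => U x y - W x y) η := by
  intro S T hS hT
  have hr : ∀ (A : Set ℝ), MeasurableSet A → volume.restrict (Icc (0:ℝ) 1 ∩ A) = unif01.restrict A := by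
    intro A hA
    rw [unif01, Measure.restrict_restrict hA, inter_comm]
  have hb : ∀ (A : {S : Set ℝ // MeasurableSet S}) (C : {S : Set ℝ // MeasurableSet S}),
      |∫ x in Set.Icc (0:ℝ) 1 ∩ A.1, ∫ y in Set.Icc (0:ℝ) 1 ∩ C.1, (U x y - W x y)| ≤
      ∫ z, |Function.uncurry (fun x y => U x y - W x y) z| ∂unifSq := by
    intro A C
    rw [hr A.1 A.2, hr C.1 C.2]
    exact cutle_L1 hD A.1 C.1 A.2 C.2
  refine le_trans ?_ h
  unfold cutDist
  have h1 := le_ciSup (f := fun T : {T : Set ℝ // MeasurableSet T} =>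
    |∫ x in Set.Icc (0:ℝ) 1 ∩ S, ∫ y in Set.Icc (0:ℝ) 1 ∩ T.1, (U x y - W x y)|)
    ⟨_, by rintro _ ⟨C, rfl⟩; exact hb ⟨S, hS⟩ C⟩ ⟨T, hT⟩
  have h2 := le_ciSup (f := fun S : {S : Set ℝ // MeasurableSet S} => ⨆ T : {T : Set ℝ // MeasurableSet T},
    |∫ x in Set.Icc (0:ℝ) 1 ∩ S.1, ∫ y in Set.Icc (0:ℝ) 1 ∩ T.1, (U x y - W x y)|)
    ⟨_, by rintro _ ⟨A, rfl⟩; exact ciSup_le fun C => hb A C⟩ ⟨S, hS⟩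
  refine le_trans (le_trans (le_of_eq ?_) h1) h2
  simp only
  rw [hr S hS, hr T hT]

theorem ker_ae {n : ℕ} (hn : 0 < n) (Q : Fin n → Fin n → ℝ) {σ : ℝ → ℝ} (hσ : MeasurePreserving σ unif01 unif01) :
    (fun z : ℝ × ℝ => stepKernel n Q (σ z.1) (σ z.2)) =ᵐ[unifSq] fun z => Q (blk n hn (σ z.1)) (blk n hn (σ z.2)) := by
  have h1 : ∀ᵐ x ∂unif01, σ x ∈ Ioc (0:ℝ) 1 := hσ.quasiMeasurePreserving.ae ae_Ioc
  have h2 : ∀ᵐ z ∂unifSq, σ z.1 ∈ Ioc (0:ℝ) 1 := Measure.quasiMeasurePreserving_fst.ae h1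
  have h3 : ∀ᵐ z ∂unifSq, σ z.2 ∈ Ioc (0:ℝ) 1 := Measure.quasiMeasurePreserving_snd.ae h1
  filter_upwards [h2, h3] with z hz1 hz2
  exact step_eq hn Q hz1 hz2

theorem step_meas (n : ℕ) (Q : Fin n → Fin n → ℝ) : Measurable (Function.uncurry (stepKernel n Q)) := by
  unfold stepKernel
  refine Finset.measurable_sum _ fun i _ => Finset.measurable_sum _ fun j _ => ?_
  refine Measurable.ite ?_ measurable_const measurable_const
  exact (measurable_fst measurableSet_Ioc).inter (measurable_snd measurableSet_Ioc)

theorem dpack_tau {n : ℕ} (hn : 0 < n) (Q : Fin n → Fin n → ℝ) {W : ℝ → ℝ → ℝ}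
    (hW : Integrable (Function.uncurry W) unifSq) {η : ℝ} (h : weakCutDist (stepKernel n Q) W < η) :
    ∃ τ : ℝ → Fin n, Measurable τ ∧ (∀ i, unif01 (τ ⁻¹' {i}) = (n : ℝ≥0∞)⁻¹) ∧
      (∀ r, kerNorm (fun x y => Q (τ x) (τ y)) r = kerNorm (stepKernel n Q) r) ∧
      CutLe (fun x y => Q (τ x) (τ y) - W x y) η := by
  have : Nonempty {σ : ℝ → ℝ // MPB σ} := ⟨⟨id, bijOn_id _, MeasurePreserving.id _⟩⟩
  obtain ⟨⟨σ, hσ⟩, hlt⟩ := exists_lt_of_ciInf_lt h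
  have hs := hσ.2
  have hτ : Measurable fun x => blk n hn (σ x) := (blk_meas n hn).comp hs.measurable
  have hQi : Integrable (fun z : ℝ × ℝ => Q (blk n hn (σ z.1)) (blk n hn (σ z.2))) unifSq :=
    cell_integrableG unifSq (τ := fun z : ℝ × ℝ => (blk n hn (σ z.1), blk n hn (σ z.2)))
      ((hτ.comp measurable_fst).prodMk (hτ.comp measurable_snd)) (fun c => Q c.1 c.2)
  have hae := ker_ae hn Q hs
  refine ⟨fun x => blk n hn (σ x), hτ, fun i => ?_, fun r => ?_, ?_⟩
  · have := hs.measure_preimage ((blk_meas n hn) (measurableSet_singleton i)).nullMeasurableSet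
    rw [blk_unif hn] at this
    exact this
  · unfold kerNorm
    have h1 := eLpNorm_comp_measurePreserving (p := r)
      (Measurable.aestronglyMeasurable (μ := unifSq) (step_meas n Q)) (hs.prod hs)
    rw [← eLpNorm_congr_ae hae]
    exact h1
  · have hUi : Integrable (fun z : ℝ × ℝ => stepKernel n Q (σ z.1) (σ z.2)) unifSq := hQi.congr hae.symm
    have hc := cutDist_cutLe (U := fun x y => stepKernel n Q (σ x) (σ y)) (hUi.sub hW) hlt.le
    intro S T hS hT
    refine le_trans (le_of_eq ?_) (hc S T hS hT)
    congr 1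
    have e1 := setIntegral_prod (μ := unif01) (ν := unif01) (s := S) (t := T)
      (fun z : ℝ × ℝ => Q (blk n hn (σ z.1)) (blk n hn (σ z.2)) - W z.1 z.2) (hQi.sub hW).integrableOn
    have e2 := setIntegral_prod (μ := unif01) (ν := unif01) (s := S) (t := T)
      (fun z : ℝ × ℝ => stepKernel n Q (σ z.1) (σ z.2) - W z.1 z.2) (hUi.sub hW).integrableOn
    simp only at e1 e2
    rw [← e1, ← e2]
    refine integral_congr_ae (ae_restrict_of_ae ?_)
    filter_upwards [hae] with z hz
    rw [hz]

theorem dpack (Q : ∀ n : ℕ, Fin n → Fin n → ℝ) {W : ℝ → ℝ → ℝ} (hWm : Measurable (Function.uncurry W))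
    (hWL1 : kerNorm W 1 ≠ ⊤)
    (hcut : Tendsto (fun n => weakCutDist (stepKernel n (Q n)) W) atTop (nhds 0))
    {r : ℝ≥0∞} (hr : r = 0 ∨ 1 ≤ r)
    (hnorm : Filter.atTop.limsup (fun n => kerNorm (stepKernel n (Q n)) r) ≠ ⊤) :
    ∃ B : ℝ≥0∞, B ≠ ⊤ ∧ kerNorm W r ≤ B ∧
      (∀ η > 0, ∀ᶠ n in atTop, ∃ τ : ℝ → Fin n, Measurable τ ∧ (∀ i, unif01 (τ ⁻¹' {i}) = (n : ℝ≥0∞)⁻¹) ∧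
        kerNorm (fun x y => Q n (τ x) (τ y)) r ≤ B ∧ CutLe (fun x y => Q n (τ x) (τ y) - W x y) η) ∧
      (∀ η > 0, ∃ k, ∃ h : (Fin k → Bool) → (Fin k → Bool) → ℝ,
        kerNorm (fun x y => h (ind k x) (ind k y)) r ≤ B ∧
        CutLe (fun x y => W x y - h (ind k x) (ind k y)) η) := by
  have hW : Integrable (Function.uncurry W) unifSq :=
    memLp_one_iff_integrable.1 ⟨hWm.aestronglyMeasurable, hWL1.lt_top⟩
  obtain ⟨B, hB1, hB2⟩ := exists_between hnorm.lt_top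
  have hev := eventually_lt_of_limsup_lt hB1
  have h1 : ∀ η > 0, ∀ᶠ n in atTop, ∃ τ : ℝ → Fin n, Measurable τ ∧ (∀ i, unif01 (τ ⁻¹' {i}) = (n : ℝ≥0∞)⁻¹) ∧
        kerNorm (fun x y => Q n (τ x) (τ y)) r ≤ B ∧ CutLe (fun x y => Q n (τ x) (τ y) - W x y) η := by
    intro η hη
    filter_upwards [hev, hcut.eventually_lt_const hη, eventually_gt_atTop 0] with n h1 h2 h3
    obtain ⟨τ, ha, hb, hc, hd⟩ := dpack_tau h3 (Q n) hW h2
    exact ⟨τ, ha, hb, (hc r).le.trans h1.le, hd⟩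
  obtain ⟨h2, h3⟩ := limit_pack hWm hW hr (B := B) fun η hη => by
    obtain ⟨n, τ, ha, hb, hc, hd⟩ := (h1 η hη).exists
    exact ⟨fun x y => Q n (τ x) (τ y), cell_integrableG unifSq (τ := fun z : ℝ × ℝ => (τ z.1, τ z.2))
      ((ha.comp measurable_fst).prodMk (ha.comp measurable_snd)) (fun c => Q n c.1 c.2), hc, hd⟩
  exact ⟨B, hB2.ne, h2, h1, h3⟩

end

section
open MeasureTheory Filter Set
open scoped ENNReal NNReal

theorem toReal_one_le {p : ℝ≥0∞} (hp : 1 ≤ p) (hpt : p ≠ ⊤) : 1 ≤ p.toReal := by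
  rw [← ENNReal.toReal_one]; exact ENNReal.toReal_mono hpt hp

theorem mom_integrable {r : ℝ} (hr : 1 ≤ r) {f : ℝ → ℝ} (hf : Measurable f) {C : ℝ≥0∞} (hC : C ≠ ⊤)
    (h : ∫⁻ u, ‖f u‖ₑ ^ r ∂unif01 ≤ C) : Integrable f unif01 ∧ ∫ u, |f u| ∂unif01 ≤ 1 + C.toReal := by
  have h1 : ∫⁻ u, ‖f u‖ₑ ∂unif01 ≤ 1 + C := by
    calc ∫⁻ u, ‖f u‖ₑ ∂unif01 ≤ ∫⁻ u, (1 + ‖f u‖ₑ ^ r) ∂unif01 := by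
          refine lintegral_mono fun u => ?_
          simp only
          rw [enorm_rpow_eq (by linarith), ← ofReal_norm_eq_enorm, ← ENNReal.ofReal_one,
            ← ENNReal.ofReal_add (by norm_num) (by positivity)]
          exact ENNReal.ofReal_le_ofReal (abs_le_one_add_rpow hr _)
      _ = 1 + ∫⁻ u, ‖f u‖ₑ ^ r ∂unif01 := by rw [lintegral_add_left measurable_const]; simp
      _ ≤ _ := by gcongr
  have h2 : Integrable f unif01 := ⟨hf.aestronglyMeasurable, h1.trans_lt (by simp [hC.lt_top])⟩
  refine ⟨h2, ?_⟩
  have h3 := integral_norm_eq_lintegral_enorm (μ := unif01) hf.aestronglyMeasurable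
  simp only [Real.norm_eq_abs] at h3
  rw [h3]
  have := ENNReal.toReal_mono (by simp [hC]) h1
  rwa [ENNReal.toReal_add (by simp) hC, ENNReal.toReal_one] at this

theorem blockInt_abs_le {ι : Type*} (τ : ℝ → ι) {f : ℝ → ℝ} (hf : Integrable f unif01) (i : ι) :
    |blockInt τ f i| ≤ ∫ u, |f u| ∂unif01 := by
  unfold blockInt
  refine (abs_integral_le_integral_abs).trans ?_
  exact setIntegral_le_integral hf.abs (Eventually.of_forall fun _ => abs_nonneg _)

theorem core {μ : Measure ℝ} [IsProbabilityMeasure μ] {v : ℕ} (G : SimpleGraph (Fin v)) [DecidableRel G.Adj]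
    {p q B : ℝ≥0∞} (hp : 1 ≤ p) (hpt : p ≠ ⊤) (hq : 1 < q) (hpq : p⁻¹ + q⁻¹ ≤ 1) (hBt : B ≠ ⊤)
    (hTC : TC μ p.toReal) {W : ℝ → ℝ → ℝ} (hWm : Measurable (Function.uncurry W))
    (hWB : kerNorm W (q * G.maxDegree) ≤ B) {Q : ∀ n : ℕ, Fin n → Fin n → ℝ}
    (hτ : ∀ η > 0, ∀ᶠ n in atTop, ∃ τ : ℝ → Fin n, Measurable τ ∧ (∀ i, unif01 (τ ⁻¹' {i}) = (n : ℝ≥0∞)⁻¹) ∧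
        kerNorm (fun x y => Q n (τ x) (τ y)) (q * G.maxDegree) ≤ B ∧ CutLe (fun x y => Q n (τ x) (τ y) - W x y) η)
    (hS : ∀ η > 0, ∃ k, ∃ h : (Fin k → Bool) → (Fin k → Bool) → ℝ,
        kerNorm (fun x y => h (ind k x) (ind k y)) (q * G.maxDegree) ≤ B ∧
        CutLe (fun x y => W x y - h (ind k x) (ind k y)) η)
    {L ε : ℝ} (hL : 0 ≤ L) (hε : 0 < ε) :
    ∃ (N : (ℝ → ℝ) → Prop) (k : ℕ) (φ : (Fin v → (Fin k → Bool)) → ℝ),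
      (∀ f, Measurable f → N f → Integrable f unif01 ∧ ∫ u, |f u| ∂unif01 ≤ 1 + (L + logMom μ p.toReal 1)) ∧
      (∀ f, Measurable f → ∫⁻ u, gammaBeta μ (f u) ∂unif01 ≤ ENNReal.ofReal L → N f) ∧
      (∀ n : ℕ, 1 ≤ n → ∀ τ : ℝ → Fin n, Measurable τ → (∀ i, unif01 (τ ⁻¹' {i}) = (n : ℝ≥0∞)⁻¹) →
        (Measure.pi fun _ : Fin n => μ) {x | ¬ N (fun u => x (τ u))} ≤ 2 * ENNReal.ofReal (Real.exp (-(n * L)))) ∧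
      (∀ f, Measurable f → N f → |G1 G W f - blockSum φ (blockInt (ind k) f)| ≤ ε) ∧
      (∀ᶠ n in atTop, ∃ τ : ℝ → Fin n, Measurable τ ∧ (∀ i, unif01 (τ ⁻¹' {i}) = (n : ℝ≥0∞)⁻¹) ∧
        (∀ f, Measurable f → N f → |G1 G (fun x y => Q n (τ x) (τ y)) f - G1 G W f| ≤ ε) ∧
        (∀ x : Fin n → ℝ, N (fun u => x (τ u)) → |Ustat G (fun y : Fin v → ℝ => ∏ a, y a) n (Q n) x -
          G1 G W (fun u => x (τ u))| ≤ ε)) := by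
  have hr := toReal_one_le hp hpt
  have hC : ENNReal.ofReal (L + logMom μ p.toReal 1) ≠ ⊤ := ENNReal.ofReal_ne_top
  have hC0 : 0 ≤ L + logMom μ p.toReal 1 := add_nonneg hL (logMom_nonneg hTC one_pos)
  obtain ⟨δ1, hδ1, H1⟩ := approx G hp hpt hq hpq hBt hC (half_pos hε)
  obtain ⟨δ2, hδ2, H2⟩ := approxN G hp hpt hq hpq hBt hC (half_pos hε)
  obtain ⟨M, HM1, HM2⟩ := nicePack (μ := μ) hr hTC hL (lt_min hδ1 hδ2)
  obtain ⟨η, hη, Hη⟩ := H1 M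
  obtain ⟨n0, Hn0⟩ := H2 M
  obtain ⟨k, h, hkB, hkc⟩ := hS η hη
  have hd1 : ENNReal.ofReal (min δ1 δ2) ≤ ENNReal.ofReal δ1 := ENNReal.ofReal_le_ofReal (min_le_left _ _)
  have hd2 : ENNReal.ofReal (min δ1 δ2) ≤ ENNReal.ofReal δ2 := ENNReal.ofReal_le_ofReal (min_le_right _ _)
  have hintg : ∀ f, Measurable f → NiceF p.toReal (ENNReal.ofReal (L + logMom μ p.toReal 1)) (ENNReal.ofReal (min δ1 δ2)) M f →
      Integrable f unif01 ∧ ∫ u, |f u| ∂unif01 ≤ 1 + (L + logMom μ p.toReal 1) := by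
    intro f hf hN
    have := mom_integrable hr hf hC hN.1
    rwa [ENNReal.toReal_ofReal hC0] at this
  refine ⟨NiceF p.toReal (ENNReal.ofReal (L + logMom μ p.toReal 1)) (ENNReal.ofReal (min δ1 δ2)) M, k,
    fun j => edgeProd G (fun a b => h (j a) (j b)), hintg, HM1, HM2, ?_, ?_⟩
  · intro f hf hN
    rw [← G1_step G (ind_meas k) h (hintg f hf hN).1]
    refine (Hη W _ hWm (Q_tau_meas h (ind_meas k)) hWB hkB hkc f hf (hN.mono le_rfl hd1 le_rfl)).trans (by linarith)
  · filter_upwards [hτ η hη, eventually_ge_atTop n0] with n ⟨τ, h1, h2, h3, h4⟩ hn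
    have hA : ∀ f, Measurable f → NiceF p.toReal (ENNReal.ofReal (L + logMom μ p.toReal 1)) (ENNReal.ofReal (min δ1 δ2)) M f →
        |G1 G (fun x y => Q n (τ x) (τ y)) f - G1 G W f| ≤ ε / 2 := fun f hf hN =>
      Hη _ W (Q_tau_meas (Q n) h1) hWm h3 hWB h4 f hf (hN.mono le_rfl hd1 le_rfl)
    refine ⟨τ, h1, h2, fun f hf hN => (hA f hf hN).trans (by linarith), fun x hN => ?_⟩
    have a1 := Hn0 n hn (Q n) τ h1 h2 h3 x (hN.mono le_rfl hd2 le_rfl)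
    have a2 := hA _ (comp_tau_meas h1 x) hN
    calc _ ≤ _ := abs_sub_le _ (G1 G (fun x y => Q n (τ x) (τ y)) (fun u => x (τ u))) _
      _ ≤ ε / 2 + ε / 2 := add_le_add a1 a2
      _ = ε := by ring

end

section
open MeasureTheory Filter Set
open scoped ENNReal NNReal

variable {μ : Measure ℝ} [IsProbabilityMeasure μ]

theorem blockInt_factor {k l : ℕ} (h : k ≤ l) {f : ℝ → ℝ} (hf : Integrable f unif01) (i : Fin k → Bool) :
    blockInt (ind k) f i = ∑ j : Fin l → Bool,
      {j : Fin l → Bool | (fun a => j (Fin.castLE h a)) = i}.indicator (fun _ => (1:ℝ)) j * blockInt (ind l) f j := by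
  have h1 : ind k ⁻¹' {i} = ind l ⁻¹' {j : Fin l → Bool | (fun a => j (Fin.castLE h a)) = i} := by
    rw [ind_factor h]; rfl
  unfold blockInt
  rw [h1, setIntegral_cellG unif01 (ind_meas l) _ hf]

theorem blockInt_step {ι : Type*} [Fintype ι] [MeasurableSpace ι] [MeasurableSingletonClass ι]
    {τ : ℝ → ι} (hτ : Measurable τ) (b : ι → ℝ) (hb : ∀ j, cw τ j = 0 → b j = 0) (j : ι) :
    blockInt τ (fun u => b (τ u) / cw τ (τ u)) j = b j := by
  rw [blockInt_cell hτ (fun i => b i / cw τ i)]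
  rcases eq_or_ne (cw τ j) 0 with h | h
  · rw [hb j h]; simp
  · field_simp

theorem blockInt_null {ι : Type*} (τ : ℝ → ι) (f : ℝ → ℝ) (j : ι) (h : cw τ j = 0) : blockInt τ f j = 0 := by
  unfold blockInt cw at *
  exact setIntegral_measure_zero _ (by rwa [measureReal_eq_zero_iff] at h)

theorem mart_limit {r : ℝ} (hr : 1 ≤ r) (h : TC μ r) {c : ℝ} (hc : 0 ≤ c)
    (β : ∀ k : ℕ, (Fin k → Bool) → ℝ)
    (hβ : ∀ k j, cw (ind k) j = 0 → β k j = 0)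
    (hcons : ∀ k l (hkl : k ≤ l) i, β k i = ∑ j : Fin l → Bool,
      {j : Fin l → Bool | (fun a => j (Fin.castLE hkl a)) = i}.indicator (fun _ => (1:ℝ)) j * β l j)
    (hγ : ∀ k, ∫⁻ u, gammaBeta μ (β k (ind k u) / cw (ind k) (ind k u)) ∂unif01 ≤ ENNReal.ofReal c) :
    ∃ f : ℝ → ℝ, Measurable f ∧ ∫⁻ u, gammaBeta μ (f u) ∂unif01 ≤ ENNReal.ofReal c ∧
      ∀ k j, blockInt (ind k) f j = β k j := by
  set g : ℕ → ℝ → ℝ := fun k u => β k (ind k u) / cw (ind k) (ind k u) with hg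
  have hgm : ∀ k, Measurable (g k) := fun k =>
    (measurable_of_finite (fun j => β k j / cw (ind k) j)).comp (ind_meas k)
  have hgi : ∀ k, Integrable (g k) unif01 := fun k => cell_integrable (ind_meas k) (fun j => β k j / cw (ind k) j)
  have hgb : ∀ k j, blockInt (ind k) (g k) j = β k j := fun k j => blockInt_step (ind_meas k) _ (hβ k) j
  have hM : Martingale g filt1 unif01 := by
    refine ⟨fun k => ?_, fun k l hkl => ?_⟩
    · exact ((measurable_of_finite (fun j => β k j / cw (ind k) j)).comp
        (comap_measurable (ind k))).stronglyMeasurable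
    · refine (condExp_fin unif01 (ind_meas k) (hgi l)).symm.trans (Eventually.of_forall fun u => ?_)
      simp only [cavg]
      have e := blockInt_factor hkl (hgi l) (ind k u)
      simp only [hgb] at e
      rw [← hcons k l hkl (ind k u)] at e
      unfold blockInt at e
      rw [e, hg]
      simp only [cw]
      ring
  have hU : UniformIntegrable g 1 unif01 := by
    refine uniformIntegrable_of le_rfl ENNReal.one_ne_top (fun k => (hgm k).aestronglyMeasurable) fun ε hε => ?_
    obtain ⟨M0, hM0⟩ := nice_tail (μ := μ) hr h hc hε
    refine ⟨Real.toNNReal (max M0 1) + 1, fun k => ?_⟩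
    rw [eLpNorm_one_eq_lintegral_enorm]
    refine le_trans (lintegral_mono fun u => ?_) (hM0 (max M0 1) (le_max_left _ _) (g k) (hγ k))
    have hM1 : (1:ℝ) ≤ max M0 1 := le_max_right _ _
    by_cases hu : Real.toNNReal (max M0 1) + 1 ≤ ‖g k u‖₊
    · rw [indicator_of_mem (show u ∈ {x | Real.toNNReal (max M0 1) + 1 ≤ ‖g k x‖₊} from hu)]
      have h2 : max M0 1 + 1 ≤ |g k u| := by
        have := NNReal.coe_le_coe.2 hu
        simpa [Real.coe_toNNReal _ (by linarith : 0 ≤ max M0 1)] using this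
      rw [if_pos (by linarith)]
      rw [enorm_rpow_eq (by linarith), ← ofReal_norm_eq_enorm]
      refine ENNReal.ofReal_le_ofReal ?_
      exact Real.self_le_rpow_of_one_le (by linarith) hr
    · rw [indicator_of_notMem (show u ∉ {x | Real.toNNReal (max M0 1) + 1 ≤ ‖g k x‖₊} from hu)]; simp
  set f := filt1.limitProcess g unif01
  obtain ⟨R, hR⟩ := hU.2.2
  have hfm : Measurable f := (Filtration.stronglyMeasurable_limit_process').measurable
  have hfi : Integrable f unif01 := (Filtration.memLp_limitProcess_of_eLpNorm_bdd hU.1 hR).integrable le_rfl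
  refine ⟨f, hfm, ?_, fun k j => ?_⟩
  · have ht := hM.submartingale.ae_tendsto_limitProcess_of_uniformIntegrable hU
    calc ∫⁻ u, gammaBeta μ (f u) ∂unif01 ≤ ∫⁻ u, liminf (fun k => gammaBeta μ (g k u)) atTop ∂unif01 := by
          refine lintegral_mono_ae ?_
          filter_upwards [ht] with u hu
          have h1 := (gamma_lsc (μ := μ)).le_liminf (f u)
          refine h1.trans ?_
          exact liminf_le_liminf_of_le hu |>.trans (le_of_eq rfl)
      _ ≤ liminf (fun k => ∫⁻ u, gammaBeta μ (g k u) ∂unif01) atTop :=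
          lintegral_liminf_le fun k => gamma_meas.comp (hgm k)
      _ ≤ _ := by
          refine (liminf_le_liminf (Eventually.of_forall hγ)).trans ?_
          simp
  · rw [← hgb k j]
    have h1 := hM.ae_eq_condExp_limitProcess hU k
    have h2 : ∫ u in ind k ⁻¹' {j}, g k u ∂unif01 = ∫ u in ind k ⁻¹' {j}, (unif01[f | filt1 k]) u ∂unif01 :=
      integral_congr_ae (ae_restrict_of_ae h1)
    unfold blockInt
    rw [h2, setIntegral_condExp (filt1.le k) hfi ⟨{j}, measurableSet_singleton j, rfl⟩]

end

section
open MeasureTheory Filter Set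
open scoped ENNReal NNReal

variable {μ : Measure ℝ} [IsProbabilityMeasure μ]

theorem gamma_integrable {r : ℝ} (hr : 1 ≤ r) (h : TC μ r) {L : ℝ} (hL : 0 ≤ L) {f : ℝ → ℝ} (hf : Measurable f)
    (hf2 : ∫⁻ u, gammaBeta μ (f u) ∂unif01 ≤ ENNReal.ofReal L) :
    Integrable f unif01 ∧ ∫ u, |f u| ∂unif01 ≤ 1 + (L + logMom μ r 1) := by
  have := mom_integrable hr hf ENNReal.ofReal_ne_top (nice_mom hr h hL hf hf2)
  rwa [ENNReal.toReal_ofReal (add_nonneg hL (logMom_nonneg h one_pos))] at this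

theorem weak_limit {r : ℝ} (hr : 1 ≤ r) (h : TC μ r) {c : ℝ} (hc : 0 ≤ c) (f : ℕ → ℝ → ℝ)
    (hfm : ∀ m, Measurable (f m)) (e : ℕ → ℝ) (he0 : ∀ m, 0 ≤ e m) (he1 : ∀ m, e m ≤ c + 1)
    (he : Tendsto e atTop (nhds c))
    (hf : ∀ m, ∫⁻ u, gammaBeta μ (f m u) ∂unif01 ≤ ENNReal.ofReal (e m)) :
    ∃ s : ℕ → ℕ, StrictMono s ∧ ∃ g : ℝ → ℝ, Measurable g ∧
      ∫⁻ u, gammaBeta μ (g u) ∂unif01 ≤ ENNReal.ofReal c ∧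
      ∀ k, Tendsto (fun m => blockInt (ind k) (f (s m))) atTop (nhds (blockInt (ind k) g)) := by
  have hfi : ∀ m, Integrable (f m) unif01 ∧ ∫ u, |f m u| ∂unif01 ≤ 1 + ((c+1) + logMom μ r 1) := fun m =>
    gamma_integrable hr h (by linarith) (hfm m) ((hf m).trans (ENNReal.ofReal_le_ofReal (he1 m)))
  set R := 1 + ((c+1) + logMom μ r 1)
  set K : Set (∀ k : ℕ, (Fin k → Bool) → ℝ) := Set.pi univ fun k => Set.pi univ fun _ => Icc (-R) R with hK
  have hKc : IsCompact K := isCompact_univ_pi fun k => isCompact_univ_pi fun _ => isCompact_Icc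
  obtain ⟨β, _, s, hs, hlim⟩ := hKc.tendsto_subseq (x := fun m k => blockInt (ind k) (f m)) (fun m => by
    simp only [hK, Set.mem_univ_pi]
    intro k j
    exact abs_le.1 ((blockInt_abs_le _ (hfi m).1 j).trans (hfi m).2))
  have hlim1 : ∀ k, Tendsto (fun m => blockInt (ind k) (f (s m))) atTop (nhds (β k)) := fun k =>
    (tendsto_pi_nhds.1 hlim) k
  have hlim2 : ∀ k j, Tendsto (fun m => blockInt (ind k) (f (s m)) j) atTop (nhds (β k j)) := fun k =>
    tendsto_pi_nhds.1 (hlim1 k)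
  have hβ : ∀ k j, cw (ind k) j = 0 → β k j = 0 := by
    intro k j hw
    refine tendsto_nhds_unique (hlim2 k j) ?_
    simp only [blockInt_null _ _ _ hw]; exact tendsto_const_nhds
  obtain ⟨g, hg1, hg2, hg3⟩ := mart_limit hr h hc β hβ (fun k l hkl i => by
    refine tendsto_nhds_unique (hlim2 k i) ?_
    simp only [fun m => blockInt_factor hkl (hfi (s m)).1 i]
    exact tendsto_finsetSum _ fun j _ => (hlim2 l j).const_mul _) (fun k => by
    refine legendre (ind_meas k) _ (hβ k) fun θ => ?_
    refine le_of_tendsto_of_tendsto' (f := fun m => ∑ j, (θ j * blockInt (ind k) (f (s m)) j - cw (ind k) j * cgf' μ (θ j)))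
      (tendsto_finsetSum _ fun j _ => ((hlim2 k j).const_mul _).sub_const _) (he.comp hs.tendsto_atTop) fun m => ?_
    exact fenchel (ind_meas k) (hfi (s m)).1 (he0 _) (hf _) θ)
  refine ⟨s, hs, g, hg1, hg2, fun k => ?_⟩
  have : blockInt (ind k) g = β k := funext (hg3 k)
  rw [this]; exact hlim1 k

/-- The step-function approximation property of the limit functional. -/
def StepApprox {v : ℕ} (G : SimpleGraph (Fin v)) [DecidableRel G.Adj] (W : ℝ → ℝ → ℝ) (μ : Measure ℝ) : Prop :=
  ∀ L : ℝ, 0 ≤ L → ∀ ε > 0, ∃ (k : ℕ) (φ : (Fin v → (Fin k → Bool)) → ℝ),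
    ∀ f, Measurable f → ∫⁻ u, gammaBeta μ (f u) ∂unif01 ≤ ENNReal.ofReal L →
      |G1 G W f - blockSum φ (blockInt (ind k) f)| ≤ ε

theorem good_rate {v : ℕ} (G : SimpleGraph (Fin v)) [DecidableRel G.Adj] {W : ℝ → ℝ → ℝ} {p : ℝ≥0∞}
    (hp : 1 ≤ p) (hpt : p ≠ ⊤) (h : TC μ p.toReal) (hS : StepApprox G W μ) {c : ℝ} (hc : 0 ≤ c) :
    IsCompact {t | rate1 G W μ p t ≤ ENNReal.ofReal c} := by
  have hr := toReal_one_le hp hpt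
  refine IsSeqCompact.isCompact ?_
  intro t ht
  set e : ℕ → ℝ := fun m => c + 1 / ((m:ℝ) + 1) with he
  have he0 : ∀ m : ℕ, 0 < 1 / ((m:ℝ)+1) := fun m => by positivity
  have he1 : ∀ m : ℕ, 1 / ((m:ℝ)+1) ≤ 1 := fun m => by
    rw [div_le_one (by positivity)]; have : (0:ℝ) ≤ m := Nat.cast_nonneg m
    linarith
  have hx : ∀ m, ∃ f : ℝ → ℝ, Measurable f ∧ G1 G W f = t m ∧
      ∫⁻ u, gammaBeta μ (f u) ∂unif01 ≤ ENNReal.ofReal (e m) := by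
    intro m
    have h1 : rate1 G W μ p (t m) < ENNReal.ofReal (e m) := lt_of_le_of_lt (ht m)
      ((ENNReal.ofReal_lt_ofReal_iff_of_nonneg hc).2 (by simp only [he]; linarith [he0 m]))
    unfold rate1 at h1
    obtain ⟨⟨f, hf⟩, hlt⟩ := iInf_lt_iff.1 h1
    exact ⟨f, hf.1.1, hf.2.2, hlt.le⟩
  choose f hfm hft hfe using hx
  have hee : Tendsto e atTop (nhds c) := by
    have := (tendsto_one_div_add_atTop_nhds_zero_nat (𝕜 := ℝ)).const_add c
    simpa [he] using this
  obtain ⟨s, hs, g, hgm, hge, hlim⟩ := weak_limit hr h hc f hfm e (fun m => by simp only [he]; linarith [he0 m])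
    (fun m => by simp only [he]; linarith [he1 m]) hee hfe
  refine ⟨G1 G W g, (rate1_le G W hp hpt h hgm hc hge).trans hge, s, hs, ?_⟩
  rw [Metric.tendsto_atTop]
  intro ε hε
  obtain ⟨k, φ, hφ⟩ := hS (c+1) (by linarith) (ε/4) (by linarith)
  have h2 : Tendsto (fun m => blockSum φ (blockInt (ind k) (f (s m)))) atTop (nhds (blockSum φ (blockInt (ind k) g))) :=
    ((blockSum_continuous φ).tendsto _).comp (hlim k)
  obtain ⟨N, hN⟩ := Metric.tendsto_atTop.1 h2 (ε/4) (by linarith)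
  refine ⟨N, fun m hm => ?_⟩
  have a1 := hN m hm
  have a2 := hφ g hgm (hge.trans (ENNReal.ofReal_le_ofReal (by linarith)))
  have a3 := hφ (f (s m)) (hfm _) ((hfe _).trans (ENNReal.ofReal_le_ofReal (by simp only [he]; linarith [he1 (s m)])))
  simp only [Function.comp, ← hft]
  rw [Real.dist_eq, abs_lt] at *
  rw [abs_le] at a2 a3
  constructor <;> linarith [a1.1, a1.2, a2.1, a2.2, a3.1, a3.2]

end

section
open MeasureTheory Filter Set
open scoped ENNReal NNReal

variable {μ : Measure ℝ} [IsProbabilityMeasure μ]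

theorem cw_unif {n : ℕ} {τ : ℝ → Fin n} (hu : ∀ i, unif01 (τ ⁻¹' {i}) = (n : ℝ≥0∞)⁻¹) (i : Fin n) :
    cw τ i = (n:ℝ)⁻¹ := by
  simp [cw, measureReal_def, hu]

/-- Exchange of the two partitions. -/
theorem exchange {ι : Type*} [Fintype ι] [MeasurableSpace ι] [MeasurableSingletonClass ι]
    {κ : ℝ → ι} (hκ : Measurable κ) {n : ℕ} {τ : ℝ → Fin n} (hτ : Measurable τ) (θ : ι → ℝ) (x : Fin n → ℝ) :
    ∑ j, θ j * blockInt κ (fun u => x (τ u)) j = ∑ i, x i * blockInt τ (fun u => θ (κ u)) i := by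
  rw [← (integral_cell hκ θ (comp_tau_integrable hτ x)).2, ← (integral_cell hτ x (cell_integrable hκ θ)).2]
  simp only [mul_comm]

theorem blockInt_const {ι : Type*} (τ : ℝ → ι) (c : ℝ) (i : ι) : blockInt τ (fun _ => c) i = cw τ i * c := by
  unfold blockInt; rw [setIntegral_const]; simp [cw]

theorem blockInt_sum {ι : Type*} [Fintype ι] [MeasurableSpace ι] [MeasurableSingletonClass ι]
    {τ : ℝ → ι} (hτ : Measurable τ) {f : ℝ → ℝ} (hf : Integrable f unif01) :
    ∑ i, blockInt τ f i = ∫ u, f u ∂unif01 := by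
  have := (integral_cell hτ (fun _ => 1) hf).2
  simpa using this.symm

theorem cgf_jensen (hI : ∀ θ, Integrable (fun x : ℝ => Real.exp (θ * x)) μ)
    {ι : Type*} [Fintype ι] [MeasurableSpace ι] [MeasurableSingletonClass ι]
    {κ : ℝ → ι} (hκ : Measurable κ) {n : ℕ} {τ : ℝ → Fin n}
    (hu : ∀ i, unif01 (τ ⁻¹' {i}) = (n : ℝ≥0∞)⁻¹) (θ : ι → ℝ) (i : Fin n) :
    cgf' μ (n * blockInt τ (fun u => θ (κ u)) i) ≤ n * blockInt τ (fun u => cgf' μ (θ (κ u))) i := by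
  have hn : (0:ℝ) < n := by
    have := i.pos; exact_mod_cast this
  set c := n * blockInt τ (fun u => θ (κ u)) i with hc
  have h1 : blockInt τ (fun u => cgf' μ c + deriv (cgf' μ) c * (θ (κ u) - c)) i ≤
      blockInt τ (fun u => cgf' μ (θ (κ u))) i := by
    unfold blockInt
    refine integral_mono ?_ ?_ fun u => cgf_tangent hI c (θ (κ u))
    · exact (cell_integrable hκ (fun j => cgf' μ c + deriv (cgf' μ) c * (θ j - c))).integrableOn
    · exact (cell_integrable hκ (fun j => cgf' μ (θ j))).integrableOn
  have h2 : blockInt τ (fun u => cgf' μ c + deriv (cgf' μ) c * (θ (κ u) - c)) i = (n:ℝ)⁻¹ * cgf' μ c := by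
    unfold blockInt
    have i1 : Integrable (fun u => θ (κ u)) (unif01.restrict (τ ⁻¹' {i})) := (cell_integrable hκ θ).integrableOn
    have i2 : Integrable (fun u => deriv (cgf' μ) c * (θ (κ u) - c)) (unif01.restrict (τ ⁻¹' {i})) :=
      (i1.sub (integrable_const c)).const_mul _
    simp only
    rw [integral_add (integrable_const _) i2, integral_const_mul,
      integral_sub i1 (integrable_const _)]
    have e1 : ∫ u in τ ⁻¹' {i}, θ (κ u) ∂unif01 = (n:ℝ)⁻¹ * c := by
      rw [hc, blockInt]; field_simp
    have e2 := blockInt_const τ (cgf' μ c) i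
    have e3 := blockInt_const τ c i
    unfold blockInt at e2 e3
    rw [e1, e2, e3, cw_unif hu]; ring
  rw [h2] at h1
  calc cgf' μ c = n * ((n:ℝ)⁻¹ * cgf' μ c) := by field_simp
    _ ≤ _ := by gcongr

theorem lint_exp_cgf (hI : ∀ θ, Integrable (fun x : ℝ => Real.exp (θ * x)) μ) (θ : ℝ) :
    ∫⁻ x, ENNReal.ofReal (Real.exp (θ * x)) ∂μ = ENNReal.ofReal (Real.exp (cgf' μ θ)) := by
  rw [← exp_cgf hI, ofReal_integral_eq_lintegral_ofReal (hI θ) (Eventually.of_forall fun _ => (Real.exp_pos _).le)]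

theorem block_chernoff (hI : ∀ θ, Integrable (fun x : ℝ => Real.exp (θ * x)) μ)
    {ι : Type*} [Fintype ι] [MeasurableSpace ι] [MeasurableSingletonClass ι]
    {κ : ℝ → ι} (hκ : Measurable κ) {n : ℕ} {τ : ℝ → Fin n} (hτ : Measurable τ)
    (hu : ∀ i, unif01 (τ ⁻¹' {i}) = (n : ℝ≥0∞)⁻¹) (θ : ι → ℝ) (ℓ : ℝ) :
    (Measure.pi fun _ : Fin n => μ) {x | ℓ ≤ ∑ j, (θ j * blockInt κ (fun u => x (τ u)) j - cw κ j * cgf' μ (θ j))} ≤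
      ENNReal.ofReal (Real.exp (-(n * ℓ))) := by
  set S := ∑ j, cw κ j * cgf' μ (θ j) with hS
  set c : Fin n → ℝ := fun i => n * blockInt τ (fun u => θ (κ u)) i with hc
  have h1 := chernoff (μ := μ) (fun i y => c i * y) (fun i => by fun_prop) (n * (ℓ + S))
  refine (measure_mono ?_).trans (h1.trans ?_)
  · intro x hx
    simp only [Set.mem_ofPred_eq] at hx ⊢
    rw [Finset.sum_sub_distrib, exchange hκ hτ] at hx
    have : ∑ i, c i * x i = n * ∑ i, x i * blockInt τ (fun u => θ (κ u)) i := by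
      rw [Finset.mul_sum]; exact Finset.sum_congr rfl fun i _ => by simp only [hc]; ring
    rw [this]
    have hn : (0:ℝ) ≤ n := Nat.cast_nonneg n
    exact mul_le_mul_of_nonneg_left (by linarith) hn
  · simp only [lint_exp_cgf hI]
    rw [← ENNReal.ofReal_prod_of_nonneg (fun _ _ => (Real.exp_pos _).le), ← Real.exp_sum,
      ← ENNReal.ofReal_mul (Real.exp_pos _).le, ← Real.exp_add]
    refine ENNReal.ofReal_le_ofReal (Real.exp_le_exp.2 ?_)
    have h2 : ∑ i, cgf' μ (c i) ≤ n * S := by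
      calc ∑ i, cgf' μ (c i) ≤ ∑ i, n * blockInt τ (fun u => cgf' μ (θ (κ u))) i :=
            Finset.sum_le_sum fun i _ => cgf_jensen hI hκ hu θ i
        _ = n * ∑ i, blockInt τ (fun u => cgf' μ (θ (κ u))) i := by rw [Finset.mul_sum]
        _ = n * S := by
            have hi := cell_integrable hκ (fun j => cgf' μ (θ j))
            rw [blockInt_sum hτ hi, ← blockInt_sum hκ hi, hS]
            congr 1
            exact Finset.sum_congr rfl fun j _ => blockInt_cell hκ (fun j => cgf' μ (θ j)) j
    linarith

end

section
open MeasureTheory Filter Set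
open scoped ENNReal NNReal

variable {μ : Measure ℝ} [IsProbabilityMeasure μ]

/-- The conclusion of `core`. -/
def CoreHyp {v : ℕ} (G : SimpleGraph (Fin v)) [DecidableRel G.Adj] (W : ℝ → ℝ → ℝ)
    (Q : ∀ n : ℕ, Fin n → Fin n → ℝ) (μ : Measure ℝ) (C : ℝ) : Prop :=
  ∀ L ε : ℝ, 0 ≤ L → 0 < ε →
    ∃ (N : (ℝ → ℝ) → Prop) (k : ℕ) (φ : (Fin v → (Fin k → Bool)) → ℝ),
      (∀ f, Measurable f → N f → Integrable f unif01 ∧ ∫ u, |f u| ∂unif01 ≤ 1 + (L + C)) ∧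
      (∀ f, Measurable f → ∫⁻ u, gammaBeta μ (f u) ∂unif01 ≤ ENNReal.ofReal L → N f) ∧
      (∀ n : ℕ, 1 ≤ n → ∀ τ : ℝ → Fin n, Measurable τ → (∀ i, unif01 (τ ⁻¹' {i}) = (n : ℝ≥0∞)⁻¹) →
        (Measure.pi fun _ : Fin n => μ) {x | ¬ N (fun u => x (τ u))} ≤ 2 * ENNReal.ofReal (Real.exp (-(n * L)))) ∧
      (∀ f, Measurable f → N f → |G1 G W f - blockSum φ (blockInt (ind k) f)| ≤ ε) ∧
      (∀ᶠ n in atTop, ∃ τ : ℝ → Fin n, Measurable τ ∧ (∀ i, unif01 (τ ⁻¹' {i}) = (n : ℝ≥0∞)⁻¹) ∧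
        (∀ f, Measurable f → N f → |G1 G (fun x y => Q n (τ x) (τ y)) f - G1 G W f| ≤ ε) ∧
        (∀ x : Fin n → ℝ, N (fun u => x (τ u)) → |Ustat G (fun y : Fin v → ℝ => ∏ a, y a) n (Q n) x -
          G1 G W (fun u => x (τ u))| ≤ ε))

theorem CoreHyp.step {v : ℕ} {G : SimpleGraph (Fin v)} [DecidableRel G.Adj] {W : ℝ → ℝ → ℝ}
    {Q : ∀ n : ℕ, Fin n → Fin n → ℝ} {C : ℝ} (h : CoreHyp G W Q μ C) : StepApprox G W μ := by
  intro L hL ε hε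
  obtain ⟨N, k, φ, h1, h2, h3, h4, h5⟩ := h L ε hL hε
  exact ⟨k, φ, fun f hf hg => h4 f hf (h2 f hf hg)⟩

theorem upper {v : ℕ} (G : SimpleGraph (Fin v)) [DecidableRel G.Adj] {W : ℝ → ℝ → ℝ}
    {Q : ∀ n : ℕ, Fin n → Fin n → ℝ} {C : ℝ} (h : CoreHyp G W Q μ C) {p : ℝ≥0∞}
    (hp : 1 ≤ p) (hpt : p ≠ ⊤) (hTC : TC μ p.toReal) {ℓ : ℝ} (hℓ : 0 ≤ ℓ) {F : Set ℝ} (hF : IsClosed F)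
    (hlt : ∀ t ∈ F, ENNReal.ofReal ℓ < rate1 G W μ p t) :
    ∃ K : ℕ, ∀ᶠ n in atTop, (Measure.pi fun _ : Fin n => μ)
      {x | Ustat G (fun y : Fin v → ℝ => ∏ a, y a) n (Q n) x ∈ F} ≤ K * ENNReal.ofReal (Real.exp (-(n * ℓ))) := by
  classical
  have hr := toReal_one_le hp hpt
  have hI := hTC.expInt hr
  have hSc := good_rate G hp hpt hTC h.step hℓ
  have hdis : Disjoint {t | rate1 G W μ p t ≤ ENNReal.ofReal ℓ} F := by
    rw [Set.disjoint_left]; intro t ht htF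
    exact absurd (hlt t htF) (not_lt.2 ht)
  obtain ⟨δ, hδ, hdd⟩ := hdis.exists_thickenings hSc hF
  have hfar : ∀ s, rate1 G W μ p s ≤ ENNReal.ofReal ℓ → ∀ y ∈ F, δ ≤ dist s y := by
    intro s hs y hy
    by_contra hcon
    push Not at hcon
    refine Set.disjoint_left.1 hdd (Metric.self_subset_thickening hδ _ hs) ?_
    exact Metric.mem_thickening_iff.2 ⟨y, hy, hcon⟩
  obtain ⟨N, k, φ, h1, h2, h3, h4, h5⟩ := h ℓ (δ/5) hℓ (by linarith)
  set R := 1 + (ℓ + C)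
  set K : Set ((Fin k → Bool) → ℝ) := (Set.pi univ fun _ => Icc (-R) R) ∩
    ({b | ∀ j, cw (ind k) j = 0 → b j = 0} ∩ {b | blockSum φ b ∈ Metric.cthickening (2*(δ/5)) F}) with hK
  have hKc : IsCompact K := by
    refine (isCompact_univ_pi fun _ => isCompact_Icc).inter_right (IsClosed.inter ?_ ?_)
    · simp only [Set.setOf_forall]
      exact isClosed_iInter fun j => isClosed_iInter fun _ => isClosed_eq (continuous_apply j) continuous_const
    · exact Metric.isClosed_cthickening.preimage (blockSum_continuous φ)
  have hcov : K ⊆ ⋃ θ : (Fin k → Bool) → ℝ, {b | ℓ < ∑ j, (θ j * b j - cw (ind k) j * cgf' μ (θ j))} := by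
    intro b hb
    obtain ⟨-, hb2, hb3⟩ := hb
    by_contra hcon
    simp only [mem_iUnion, Set.mem_ofPred_eq, not_exists, not_lt] at hcon
    have hg := legendre (μ := μ) (ind_meas k) b hb2 hcon
    have hm : Measurable fun u => b (ind k u) / cw (ind k) (ind k u) :=
      (measurable_of_finite (fun j => b j / cw (ind k) j)).comp (ind_meas k)
    have a1 := h4 _ hm (h2 _ hm hg)
    have a2 : blockInt (ind k) (fun u => b (ind k u) / cw (ind k) (ind k u)) = b :=
      funext fun j => blockInt_step (ind_meas k) b hb2 j
    rw [a2] at a1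
    have a3 := (rate1_le G W hp hpt hTC hm hℓ hg).trans hg
    have hb4 : blockSum φ b ∈ Metric.thickening (3*(δ/5)) F :=
      Metric.cthickening_subset_thickening' (by linarith) (by linarith) _ hb3
    obtain ⟨y, hy, hyd⟩ := Metric.mem_thickening_iff.1 hb4
    have := hfar _ a3 y hy
    rw [Real.dist_eq] at hyd this
    have := abs_sub_le (G1 G W fun u => b (ind k u) / cw (ind k) (ind k u)) (blockSum φ b) y
    linarith
  obtain ⟨T, hT⟩ := hKc.elim_finite_subcover _ (fun θ => isOpen_lt continuous_const (by fun_prop)) hcov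
  refine ⟨T.card + 2, ?_⟩
  filter_upwards [h5, eventually_ge_atTop 1] with n ⟨τ, hτ, hu, _, h6⟩ hn
  have hsub : {x | Ustat G (fun y : Fin v → ℝ => ∏ a, y a) n (Q n) x ∈ F} ⊆
      (⋃ θ ∈ T, {x | ℓ ≤ ∑ j, (θ j * blockInt (ind k) (fun u => x (τ u)) j - cw (ind k) j * cgf' μ (θ j))}) ∪
      {x | ¬ N (fun u => x (τ u))} := by
    intro x hx
    by_cases hN : N (fun u => x (τ u))
    · left
      have hm := comp_tau_meas hτ x
      obtain ⟨b1, b2⟩ := h1 _ hm hN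
      have b3 := h4 _ hm hN
      have b4 := h6 x hN
      have hbK : blockInt (ind k) (fun u => x (τ u)) ∈ K := by
        refine ⟨?_, ?_, ?_⟩
        · rw [Set.mem_univ_pi]
          intro j
          exact abs_le.1 ((blockInt_abs_le _ b1 j).trans b2)
        · intro j hj; exact blockInt_null _ _ _ hj
        · refine Metric.mem_cthickening_of_dist_le _ _ _ _ hx ?_
          rw [Real.dist_eq, abs_sub_comm]
          have := abs_sub_le (Ustat G (fun y : Fin v → ℝ => ∏ a, y a) n (Q n) x) (G1 G W fun u => x (τ u))
            (blockSum φ (blockInt (ind k) fun u => x (τ u)))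
          linarith
      have := hT hbK
      simp only [mem_iUnion, Set.mem_ofPred_eq] at this ⊢
      obtain ⟨θ, hθ, hlt⟩ := this
      exact ⟨θ, hθ, hlt.le⟩
    · right; exact hN
  calc _ ≤ _ := measure_mono hsub
    _ ≤ _ := measure_union_le _ _
    _ ≤ (∑ θ ∈ T, ENNReal.ofReal (Real.exp (-(n * ℓ)))) + 2 * ENNReal.ofReal (Real.exp (-(n * ℓ))) := by
        refine add_le_add ((measure_biUnion_finset_le _ _).trans (Finset.sum_le_sum fun θ _ => ?_)) (h3 n hn τ hτ hu)
        exact block_chernoff hI (ind_meas k) hτ hu θ ℓ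
    _ = _ := by
        rw [Finset.sum_const, nsmul_eq_mul]; push_cast; ring

end

section
open MeasureTheory Filter Set
open scoped ENNReal NNReal

variable {μ : Measure ℝ} [IsProbabilityMeasure μ]

/-- tilting density -/
noncomputable def Zt (μ : Measure ℝ) {n : ℕ} (θ : Fin n → ℝ) (x : Fin n → ℝ) : ℝ≥0∞ :=
  ENNReal.ofReal (Real.exp (∑ i, (θ i * x i - cgf' μ (θ i))))

theorem lint_exp_lin (hI : ∀ θ, Integrable (fun x : ℝ => Real.exp (θ * x)) μ) {n : ℕ} (θ d : Fin n → ℝ) :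
    ∫⁻ x, ENNReal.ofReal (Real.exp (∑ i, (θ i * x i - d i))) ∂(Measure.pi fun _ : Fin n => μ) =
      ENNReal.ofReal (Real.exp (∑ i, (cgf' μ (θ i) - d i))) := by
  have h1 : ∀ x : Fin n → ℝ, ENNReal.ofReal (Real.exp (∑ i, (θ i * x i - d i))) =
      ∏ i, ENNReal.ofReal (Real.exp (θ i * x i - d i)) := fun x => by
    rw [Real.exp_sum, ENNReal.ofReal_prod_of_nonneg fun _ _ => (Real.exp_pos _).le]
  simp only [h1]
  rw [lintegral_pi_prod μ (fun i y => ENNReal.ofReal (Real.exp (θ i * y - d i))) fun i => by fun_prop]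
  rw [Real.exp_sum, ENNReal.ofReal_prod_of_nonneg fun _ _ => (Real.exp_pos _).le]
  refine Finset.prod_congr rfl fun i _ => ?_
  rw [sub_eq_add_neg, Real.exp_add, ENNReal.ofReal_mul (Real.exp_pos _).le, ← lint_exp_cgf hI,
    ← lintegral_mul_const _ (by fun_prop)]
  refine lintegral_congr fun y => ?_
  rw [← ENNReal.ofReal_mul (Real.exp_pos _).le, ← Real.exp_add, ← sub_eq_add_neg]

theorem lint_Zt (hI : ∀ θ, Integrable (fun x : ℝ => Real.exp (θ * x)) μ) {n : ℕ} (θ : Fin n → ℝ) :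
    ∫⁻ x, Zt μ θ x ∂(Measure.pi fun _ : Fin n => μ) = 1 := by
  unfold Zt; rw [lint_exp_lin hI]; simp

theorem tilt_conc (hI : ∀ θ, Integrable (fun x : ℝ => Real.exp (θ * x)) μ) (J : ℝ) {K η : ℝ} (hK : 0 < K) (hη : 0 < η) :
    ∃ κ > 0, ∀ (n : ℕ) (θ c : Fin n → ℝ), (∀ i, |θ i| ≤ J) → (∀ i, |c i| ≤ K) →
      ∫⁻ x in {x | n * η ≤ ∑ i, c i * (x i - deriv (cgf' μ) (θ i))}, Zt μ θ x ∂(Measure.pi fun _ : Fin n => μ) ≤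
        ENNReal.ofReal (Real.exp (-(n * κ))) := by
  have hcont : Continuous (deriv (cgf' μ)) := (cgf_diff2 hI).continuous
  have huc := (isCompact_Icc (a := -J-1) (b := J+1)).uniformContinuousOn_of_continuous hcont.continuousOn
  obtain ⟨δ, hδ, H⟩ := Metric.uniformContinuousOn_iff.1 huc (η / (2*K)) (by positivity)
  set d := min δ 1 / 2 with hd
  have hd0 : 0 < d := by have := lt_min hδ one_pos; positivity
  have hd1 : d < δ := by have := min_le_left δ 1; have := lt_min hδ one_pos; linarith
  have hd2 : d < 1 := by have := min_le_right δ 1; linarith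
  set h := d / K with hh
  have hh0 : 0 < h := by positivity
  have hhK : h * K = d := by rw [hh]; field_simp
  refine ⟨h * η / 2, by positivity, fun n θ c hθ hc => ?_⟩
  have key : ∀ i, cgf' μ (θ i + h * c i) - (cgf' μ (θ i) + h * c i * deriv (cgf' μ) (θ i)) ≤ h * η / 2 := by
    intro i
    have h1 := cgf_tangent hI (θ i + h * c i) (θ i)
    have h2 : |h * c i| ≤ d := by
      rw [abs_mul, abs_of_pos hh0, ← hhK]; exact mul_le_mul_of_nonneg_left (hc i) hh0.le
    have h3 := abs_le.1 h2
    have h4 := abs_le.1 (hθ i)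
    have h5 := H (θ i + h * c i) ⟨by linarith, by linarith⟩ (θ i) ⟨by linarith, by linarith⟩ (by
      rw [Real.dist_eq, add_sub_cancel_left]; linarith)
    rw [Real.dist_eq] at h5
    have h6 : h * c i * (deriv (cgf' μ) (θ i + h * c i) - deriv (cgf' μ) (θ i)) ≤ d * (η / (2*K)) := by
      refine (le_abs_self _).trans ?_
      rw [abs_mul]
      exact mul_le_mul h2 h5.le (abs_nonneg _) hd0.le
    have h7 : d * (η / (2*K)) = h * η / 2 := by rw [hh]; field_simp
    linarith
  calc ∫⁻ x in {x | n * η ≤ ∑ i, c i * (x i - deriv (cgf' μ) (θ i))}, Zt μ θ x ∂(Measure.pi fun _ : Fin n => μ)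
      ≤ ∫⁻ x in {x | n * η ≤ ∑ i, c i * (x i - deriv (cgf' μ) (θ i))},
        ENNReal.ofReal (Real.exp (∑ i, ((θ i + h * c i) * x i -
          (cgf' μ (θ i) + h * c i * deriv (cgf' μ) (θ i) + h * η)))) ∂(Measure.pi fun _ : Fin n => μ) := by
        refine setLIntegral_mono (by fun_prop) fun x hx => ?_
        refine ENNReal.ofReal_le_ofReal (Real.exp_le_exp.2 ?_)
        have hx' : n * η ≤ ∑ i, c i * (x i - deriv (cgf' μ) (θ i)) := hx
        have e1 : ∑ i, ((θ i + h * c i) * x i - (cgf' μ (θ i) + h * c i * deriv (cgf' μ) (θ i) + h * η)) =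
            ∑ i, (θ i * x i - cgf' μ (θ i)) + (h * ∑ i, c i * (x i - deriv (cgf' μ) (θ i)) - h * (n * η)) := by
          rw [Finset.mul_sum]
          have : h * (n * η) = ∑ i : Fin n, h * η := by simp; ring
          rw [this, ← Finset.sum_sub_distrib, ← Finset.sum_add_distrib]
          exact Finset.sum_congr rfl fun i _ => by ring
        rw [e1]
        have := mul_le_mul_of_nonneg_left hx' hh0.le
        linarith
    _ ≤ _ := setLIntegral_le_lintegral _ _
    _ ≤ _ := by
        rw [lint_exp_lin hI (fun i => θ i + h * c i)
          (fun i => cgf' μ (θ i) + h * c i * deriv (cgf' μ) (θ i) + h * η)]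
        refine ENNReal.ofReal_le_ofReal (Real.exp_le_exp.2 ?_)
        calc _ ≤ ∑ i : Fin n, (- (h * η / 2)) := Finset.sum_le_sum fun i _ => by
                have := key i
                linarith
          _ = _ := by simp

theorem tilt_lower (hI : ∀ θ, Integrable (fun x : ℝ => Real.exp (θ * x)) μ) {n : ℕ} (θ : Fin n → ℝ)
    {e0 ε L κ : ℝ} (hE : ∑ i, (θ i * deriv (cgf' μ) (θ i) - cgf' μ (θ i)) ≤ n * e0)
    {ι : Type*} [Fintype ι] (D : ι → Set (Fin n → ℝ))
    (hD : ∀ j, ∫⁻ x in D j, Zt μ θ x ∂(Measure.pi fun _ : Fin n => μ) ≤ ENNReal.ofReal (Real.exp (-(n * κ))))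
    (hθ : ∫⁻ x in {x | n * ε ≤ ∑ i, θ i * (x i - deriv (cgf' μ) (θ i))}, Zt μ θ x ∂(Measure.pi fun _ : Fin n => μ) ≤
        ENNReal.ofReal (Real.exp (-(n * κ))))
    (A B : Set (Fin n → ℝ)) (hB : (Measure.pi fun _ : Fin n => μ) B ≤ 2 * ENNReal.ofReal (Real.exp (-(n * L))))
    (hcov : ∀ x, x ∉ B → (∀ j, x ∉ D j) → x ∈ A) :
    1 ≤ ENNReal.ofReal (Real.exp (n * (e0 + ε))) * (Measure.pi fun _ : Fin n => μ) A +
      ((Fintype.card ι + 1) * ENNReal.ofReal (Real.exp (-(n * κ))) +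
      ENNReal.ofReal (Real.exp (n * (e0 + ε))) * (2 * ENNReal.ofReal (Real.exp (-(n * L))))) := by
  set P := Measure.pi fun _ : Fin n => μ
  set T := {x : Fin n → ℝ | n * ε ≤ ∑ i, θ i * (x i - deriv (cgf' μ) (θ i))} with hT
  have hZ : ∀ x ∉ T, Zt μ θ x ≤ ENNReal.ofReal (Real.exp (n * (e0 + ε))) := by
    intro x hx
    have hx' : ∑ i, θ i * (x i - deriv (cgf' μ) (θ i)) < n * ε := by simpa [hT] using hx
    refine ENNReal.ofReal_le_ofReal (Real.exp_le_exp.2 ?_)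
    have : ∑ i, (θ i * x i - cgf' μ (θ i)) = ∑ i, θ i * (x i - deriv (cgf' μ) (θ i)) +
      ∑ i, (θ i * deriv (cgf' μ) (θ i) - cgf' μ (θ i)) := by
      rw [← Finset.sum_add_distrib]; exact Finset.sum_congr rfl fun i _ => by ring
    rw [this]; linarith
  have hset : ∀ S : Set (Fin n → ℝ), ∫⁻ x in S ∩ Tᶜ, Zt μ θ x ∂P ≤ ENNReal.ofReal (Real.exp (n * (e0 + ε))) * P S := by
    intro S
    calc ∫⁻ x in S ∩ Tᶜ, Zt μ θ x ∂P ≤ ∫⁻ x in S ∩ Tᶜ, ENNReal.ofReal (Real.exp (n * (e0 + ε))) ∂P :=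
          setLIntegral_mono measurable_const fun x hx => hZ x hx.2
      _ = ENNReal.ofReal (Real.exp (n * (e0 + ε))) * P (S ∩ Tᶜ) := setLIntegral_const _ _
      _ ≤ _ := by gcongr; exact inter_subset_left
  have hun : (univ : Set (Fin n → ℝ)) ⊆ (A ∩ Tᶜ) ∪ ((T ∪ ⋃ j, D j) ∪ (B ∩ Tᶜ)) := by
    intro x _
    by_cases h1 : x ∈ T
    · right; left; left; exact h1
    by_cases h2 : x ∈ B
    · right; right; exact ⟨h2, h1⟩
    by_cases h3 : ∃ j, x ∈ D j
    · right; left; right; exact mem_iUnion.2 h3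
    · left; exact ⟨hcov x h2 (by simpa using h3), h1⟩
  calc 1 = ∫⁻ x in univ, Zt μ θ x ∂P := by rw [setLIntegral_univ, lint_Zt hI]
    _ ≤ ∫⁻ x in (A ∩ Tᶜ) ∪ ((T ∪ ⋃ j, D j) ∪ (B ∩ Tᶜ)), Zt μ θ x ∂P := lintegral_mono_set hun
    _ ≤ ∫⁻ x in A ∩ Tᶜ, Zt μ θ x ∂P + ((∫⁻ x in T, Zt μ θ x ∂P + ∑ j, ∫⁻ x in D j, Zt μ θ x ∂P) + ∫⁻ x in B ∩ Tᶜ, Zt μ θ x ∂P) := by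
        refine (lintegral_union_le _ _ _).trans ?_
        gcongr
        refine (lintegral_union_le _ _ _).trans ?_
        gcongr
        refine (lintegral_union_le _ _ _).trans ?_
        gcongr
        refine (lintegral_iUnion_le _ _).trans ?_
        rw [tsum_fintype]
    _ ≤ _ := by
        refine add_le_add (hset A) (add_le_add ?_ ((hset B).trans ?_))
        · rw [add_mul, one_mul, add_comm]
          refine add_le_add ?_ hθ
          refine (Finset.sum_le_sum fun j _ => hD j).trans ?_
          simp
        · gcongr

end

section
open MeasureTheory Filter Set
open scoped ENNReal NNReal

variable {μ : Measure ℝ} [IsProbabilityMeasure μ]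

/-- truncation -/
noncomputable def clipJ (μ : Measure ℝ) (J y : ℝ) : ℝ :=
  max (deriv (cgf' μ) (-J)) (min (deriv (cgf' μ) J) y)

theorem clipJ_near {J y z : ℝ} (h1 : deriv (cgf' μ) (-J) ≤ z) (h2 : z ≤ deriv (cgf' μ) J) :
    |clipJ μ J y - y| ≤ |z - y| := by
  unfold clipJ
  set a := deriv (cgf' μ) (-J)
  set b := deriv (cgf' μ) J
  rcases le_total b y with h | h
  · rw [min_eq_left h, max_eq_right (h1.trans h2), abs_of_nonpos (by linarith), abs_of_nonpos (by linarith)]; linarith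
  · rw [min_eq_right h]
    rcases le_total a y with h' | h'
    · rw [max_eq_right h']; simp
    · rw [max_eq_left h', abs_of_nonneg (by linarith), abs_of_nonneg (by linarith)]; linarith

theorem clipJ_mem (hI : ∀ θ, Integrable (fun x : ℝ => Real.exp (θ * x)) μ) {J : ℝ} (hJ : 0 ≤ J) (y : ℝ) :
    deriv (cgf' μ) (-J) ≤ clipJ μ J y ∧ clipJ μ J y ≤ deriv (cgf' μ) J :=
  ⟨le_max_left _ _, max_le (cgf_mono hI (by linarith)) (min_le_left _ _)⟩

theorem clipJ_gamma (hI : ∀ θ, Integrable (fun x : ℝ => Real.exp (θ * x)) μ) {J : ℝ} (hJ : 0 ≤ J) (y : ℝ) :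
    gammaBeta μ (clipJ μ J y) ≤ gammaBeta μ y := by
  unfold clipJ
  have hab : deriv (cgf' μ) (-J) ≤ deriv (cgf' μ) J := cgf_mono hI (by linarith)
  rcases le_total (deriv (cgf' μ) J) y with h | h
  · rw [min_eq_left h, max_eq_right hab]; exact gamma_clip_pos hI hJ h
  · rw [min_eq_right h]
    rcases le_total (deriv (cgf' μ) (-J)) y with h' | h'
    · rw [max_eq_right h']
    · rw [max_eq_left h']; exact gamma_clip_neg hI (by linarith) h'

theorem clipJ_tendsto (hI : ∀ θ, Integrable (fun x : ℝ => Real.exp (θ * x)) μ) {y : ℝ} (hy : y ∈ closure (Ncal μ)) :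
    Tendsto (fun J : ℕ => clipJ μ J y) atTop (nhds y) := by
  rw [Metric.tendsto_atTop]
  intro ε hε
  obtain ⟨z, ⟨θ, rfl⟩, hz⟩ := Metric.mem_closure_iff.1 hy ε hε
  obtain ⟨J0, hJ0⟩ := exists_nat_ge |θ|
  refine ⟨J0, fun J hJ => ?_⟩
  have hJ' : |θ| ≤ J := hJ0.trans (by exact_mod_cast hJ)
  have h3 := abs_le.1 hJ'
  rw [Real.dist_eq]
  refine (clipJ_near (z := deriv (cgf' μ) θ) (cgf_mono hI h3.1) (cgf_mono hI h3.2)).trans_lt ?_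
  rwa [abs_sub_comm, ← Real.dist_eq]

theorem clip_approx {v : ℕ} (G : SimpleGraph (Fin v)) [DecidableRel G.Adj] {W : ℝ → ℝ → ℝ}
    (hWm : Measurable (Function.uncurry W)) {p : ℝ≥0∞}
    (hp : 1 ≤ p) (hpt : p ≠ ⊤) (hI : ∀ θ, Integrable (fun x : ℝ => Real.exp (θ * x)) μ)
    (hintg : ∀ f : ℝ → ℝ, Measurable f → ∫⁻ u, ‖f u‖ₑ ^ p.toReal ∂unif01 ≠ ⊤ →
      Integrable (fun x : Fin v → ℝ => edgeProd G (fun a b => W (x a) (x b)) * ∏ a, f (x a)) (PV v))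
    {f : ℝ → ℝ} (hf : f ∈ Lcal μ p) :
    Tendsto (fun J : ℕ => G1 G W (fun u => clipJ μ J (f u))) atTop (nhds (G1 G W f)) := by
  obtain ⟨hfm, hfc, hfp⟩ := hf
  have hp0 : p ≠ 0 := (zero_lt_one.trans_le hp).ne'
  set g : ℝ → ℝ := fun u => 2 * |f u| + |deriv (cgf' μ) 0| with hg
  have hgm : Measurable g := by
    have : Measurable fun u => |f u| := measurable_norm.comp hfm
    fun_prop
  have hmem : MemLp f p unif01 := ⟨hfm.aestronglyMeasurable, hfp⟩
  have hgp : MemLp g p unif01 := (hmem.norm.const_mul 2).add (memLp_const _)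
  have hgi := hintg g hgm
    (lintegral_rpow_enorm_lt_top_of_eLpNorm_lt_top hp0 hpt hgp.2).ne
  have hcm : ∀ J : ℝ, Measurable (clipJ μ J) := fun J => by unfold clipJ; fun_prop
  have hb : ∀ (J : ℕ) u, |clipJ μ J (f u)| ≤ g u := by
    intro J u
    have hJ : (0:ℝ) ≤ J := Nat.cast_nonneg J
    have h1 := clipJ_near (μ := μ) (J := J) (y := f u) (z := deriv (cgf' μ) 0) (cgf_mono hI (by linarith))
      (cgf_mono hI hJ)
    have h2 := abs_sub (deriv (cgf' μ) 0) (f u)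
    have h3 := abs_sub_abs_le_abs_sub (clipJ μ J (f u)) (f u)
    simp only [hg]; linarith
  have hg0 : ∀ u, 0 ≤ g u := fun u => by positivity
  unfold G1
  refine tendsto_integral_of_dominated_convergence _ (fun J => ?_) hgi.norm (fun J => ?_) ?_
  · exact ((edgeProd_meas G hWm).mul (prod_meas ((hcm J).comp hfm))).aestronglyMeasurable
  · refine Eventually.of_forall fun x => ?_
    rw [norm_mul, norm_mul]
    gcongr
    rw [Real.norm_eq_abs, Real.norm_eq_abs, Finset.abs_prod, Finset.abs_prod]
    refine Finset.prod_le_prod (fun _ _ => abs_nonneg _) fun a _ => ?_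
    rw [abs_of_nonneg (hg0 _)]; exact hb J _
  · have hae : ∀ᵐ u ∂unif01, f u ∈ closure (Ncal μ) := by
      unfold unif01
      exact (ae_restrict_iff' measurableSet_Icc).2 (Eventually.of_forall hfc)
    have : ∀ a : Fin v, ∀ᵐ x ∂(Measure.pi fun _ : Fin v => unif01), f (x a) ∈ closure (Ncal μ) := fun a =>
      (measurePreserving_eval (fun _ : Fin v => unif01) a).quasiMeasurePreserving.ae hae
    filter_upwards [ae_all_iff.2 this] with x hx
    exact (tendsto_finsetProd _ fun a _ => clipJ_tendsto hI (hx a)).const_mul _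

end

section
open MeasureTheory Filter Set
open scoped ENNReal NNReal

variable {μ : Measure ℝ} [IsProbabilityMeasure μ]

/-- uniform continuity of block sums on bounded sets -/
theorem blockSum_unif {v : ℕ} {ι : Type*} [Fintype ι] (φ : (Fin v → ι) → ℝ) (R : ℝ) {ε : ℝ} (hε : 0 < ε) :
    ∃ η > 0, ∀ b b' : ι → ℝ, (∀ j, |b j| ≤ R) → (∀ j, |b' j| ≤ R) → (∀ j, |b j - b' j| ≤ η) →
      |blockSum φ b - blockSum φ b'| ≤ ε := by
  have hc : IsCompact (Set.pi univ fun _ : ι => Icc (-R) R) := isCompact_univ_pi fun _ => isCompact_Icc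
  have := hc.uniformContinuousOn_of_continuous (blockSum_continuous φ).continuousOn
  obtain ⟨δ, hδ, H⟩ := Metric.uniformContinuousOn_iff.1 this ε hε
  refine ⟨δ/2, by positivity, fun b b' h1 h2 h3 => ?_⟩
  have := H b (by rw [Set.mem_univ_pi]; exact fun j => abs_le.1 (h1 j)) b'
    (by rw [Set.mem_univ_pi]; exact fun j => abs_le.1 (h2 j)) (by
      refine lt_of_le_of_lt ((dist_pi_le_iff (by positivity)).2 fun j => ?_) (half_lt_self hδ)
      rw [Real.dist_eq]; exact h3 j)
  rw [Real.dist_eq] at this; exact this.le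

theorem blockInt_between {ι : Type*} [MeasurableSpace ι] [MeasurableSingletonClass ι] {τ : ℝ → ι}
    (hτ : Measurable τ) {f : ℝ → ℝ} (hf : Integrable f unif01) {a b : ℝ}
    (h : ∀ u, a ≤ f u ∧ f u ≤ b) (i : ι) : cw τ i * a ≤ blockInt τ f i ∧ blockInt τ f i ≤ cw τ i * b := by
  rw [← blockInt_const τ a i, ← blockInt_const τ b i]
  unfold blockInt
  exact ⟨integral_mono (integrable_const _) hf.integrableOn fun u => (h u).1,
    integral_mono hf.integrableOn (integrable_const _) fun u => (h u).2⟩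

theorem lower_bdd {v : ℕ} (G : SimpleGraph (Fin v)) [DecidableRel G.Adj] {W : ℝ → ℝ → ℝ}
    {Q : ∀ n : ℕ, Fin n → Fin n → ℝ} {C : ℝ} (hC : CoreHyp G W Q μ C)
    (hI : ∀ θ, Integrable (fun x : ℝ => Real.exp (θ * x)) μ) {J : ℝ} (hJ : 0 ≤ J) {f : ℝ → ℝ} (hfm : Measurable f)
    (hfJ : ∀ u, deriv (cgf' μ) (-J) ≤ f u ∧ f u ≤ deriv (cgf' μ) J) {e0 ε : ℝ} (he0 : 0 ≤ e0) (hε : 0 < ε)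
    (hfe : ∫⁻ u, gammaBeta μ (f u) ∂unif01 ≤ ENNReal.ofReal e0) {ρ : ℝ} (hρ : 0 < ρ) :
    ∀ᶠ n : ℕ in atTop, ENNReal.ofReal (1/2 * Real.exp (-(n * (e0 + ε)))) ≤ (Measure.pi fun _ : Fin n => μ)
      {x | |Ustat G (fun y : Fin v → ℝ => ∏ a, y a) n (Q n) x - G1 G W f| ≤ ρ} := by
  classical
  obtain ⟨N, k, φ, h1, h2, h3, h4, h5⟩ := hC (e0 + ε + 1) (ρ/8) (by linarith) (by linarith)
  have hmono : ENNReal.ofReal e0 ≤ ENNReal.ofReal (e0 + ε + 1) := ENNReal.ofReal_le_ofReal (by linarith)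
  obtain ⟨η, hη, Hη⟩ := blockSum_unif φ (1 + (e0 + ε + 1 + C)) (ε := ρ/8) (by linarith)
  obtain ⟨κ, hκ, Hκ⟩ := tilt_conc hI J (K := max J 1) (η := min η ε) (lt_max_of_lt_right one_pos) (lt_min hη hε)
  have hNf := h2 f hfm (hfe.trans hmono)
  have hfi := (h1 f hfm hNf).1
  -- numeric condition
  have hnum : Tendsto (fun n : ℕ => (Fintype.card ((Fin k → Bool) × Bool) + 1 : ℝ) * Real.exp (-(n * κ)) + 2 * Real.exp (-(n:ℝ)))
      atTop (nhds 0) := by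
    have t1 : Tendsto (fun n : ℕ => Real.exp (-((n:ℝ) * κ))) atTop (nhds 0) :=
      Real.tendsto_exp_neg_atTop_nhds_zero.comp (tendsto_natCast_atTop_atTop.atTop_mul_const hκ)
    have t2 : Tendsto (fun n : ℕ => Real.exp (-(n:ℝ))) atTop (nhds 0) :=
      Real.tendsto_exp_neg_atTop_nhds_zero.comp tendsto_natCast_atTop_atTop
    have := (t1.const_mul (Fintype.card ((Fin k → Bool) × Bool) + 1 : ℝ)).add (t2.const_mul 2)
    simpa using this
  filter_upwards [h5, eventually_ge_atTop 1, hnum.eventually (gt_mem_nhds (show (0:ℝ) < 1/2 by norm_num))]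
    with n ⟨τ, hτ, hu, h6, h7⟩ hn hn2
  have hn0 : (0:ℝ) < n := by exact_mod_cast hn
  have hcw : ∀ i, cw τ i = (n:ℝ)⁻¹ := cw_unif hu
  set m : Fin n → ℝ := fun i => n * blockInt τ f i with hm
  have hmJ : ∀ i, ∃ θ ∈ Icc (-J) J, deriv (cgf' μ) θ = m i := by
    intro i
    obtain ⟨a1, a2⟩ := blockInt_between hτ hfi hfJ i
    rw [hcw] at a1 a2
    have b1 : deriv (cgf' μ) (-J) ≤ m i := by
      calc deriv (cgf' μ) (-J) = n * ((n:ℝ)⁻¹ * deriv (cgf' μ) (-J)) := by field_simp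
        _ ≤ _ := by simp only [hm]; gcongr
    have b2 : m i ≤ deriv (cgf' μ) J := by
      calc m i ≤ n * ((n:ℝ)⁻¹ * deriv (cgf' μ) J) := by simp only [hm]; gcongr
        _ = _ := by field_simp
    exact intermediate_value_Icc (by linarith) (cgf_diff2 hI).continuous.continuousOn ⟨b1, b2⟩
  choose θ hθ hθm using hmJ
  -- the averaged function
  set fn : ℝ → ℝ := fun u => m (τ u) with hfn
  have hfnm : Measurable fn := comp_tau_meas hτ m
  have hbl : blockInt τ fn = blockInt τ f := by
    funext i; rw [hfn, blockInt_comp hτ hu m i]; simp only [hm]; field_simp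
  have hfne : ∫⁻ u, gammaBeta μ (fn u) ∂unif01 ≤ ENNReal.ofReal e0 := by
    have := legendre (μ := μ) hτ (blockInt τ f) (fun j hj => blockInt_null _ _ _ hj)
      (fun θ => fenchel hτ hfi he0 hfe θ)
    convert this using 4 with u
    rw [hcw]; simp only [hfn, hm]; field_simp
  have hNfn := h2 fn hfnm (hfne.trans hmono)
  have hfni := (h1 fn hfnm hNfn)
  have hG : G1 G (fun x y => Q n (τ x) (τ y)) fn = G1 G (fun x y => Q n (τ x) (τ y)) f := by
    rw [G1_step G hτ (Q n) hfni.1, G1_step G hτ (Q n) hfi, hbl]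
  have hE : ∑ i, (θ i * deriv (cgf' μ) (θ i) - cgf' μ (θ i)) ≤ n * e0 := by
    have := fenchel hτ hfi he0 hfe θ
    have h8 := mul_le_mul_of_nonneg_left this hn0.le
    rw [Finset.mul_sum] at h8
    refine le_trans (le_of_eq (Finset.sum_congr rfl fun i _ => ?_)) h8
    rw [hcw, hθm]; simp only [hm]; field_simp
  -- linear statistics
  set c : (Fin k → Bool) → Fin n → ℝ := fun j i =>
    n * blockInt τ (fun u => (Pi.single j 1 : (Fin k → Bool) → ℝ) (ind k u)) i with hc
  have hcb : ∀ j i, |c j i| ≤ 1 := by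
    intro j i
    obtain ⟨a1, a2⟩ := blockInt_between hτ (cell_integrable (ind_meas k) (Pi.single j 1 : (Fin k → Bool) → ℝ))
      (a := 0) (b := 1) (fun u => by
        by_cases h : ind k u = j
        · rw [h]; simp
        · rw [Pi.single_eq_of_ne h]; simp) i
    rw [hcw] at a2
    rw [abs_of_nonneg (by simp only [hc]; exact mul_nonneg hn0.le (by simpa using a1))]
    calc c j i ≤ n * ((n:ℝ)⁻¹ * 1) := by simp only [hc]; gcongr
      _ = 1 := by field_simp
  have hbx : ∀ (x : Fin n → ℝ) j, n * blockInt (ind k) (fun u => x (τ u)) j = ∑ i, c j i * x i := by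
    intro x j
    have := exchange (ind_meas k) hτ (Pi.single j 1 : (Fin k → Bool) → ℝ) x
    have e : ∑ j', (Pi.single j 1 : (Fin k → Bool) → ℝ) j' * blockInt (ind k) (fun u => x (τ u)) j' =
        blockInt (ind k) (fun u => x (τ u)) j := by
      rw [Finset.sum_eq_single j]
      · simp
      · intro b _ hb; rw [Pi.single_eq_of_ne hb, zero_mul]
      · simp
    rw [← e, this, Finset.mul_sum]
    exact Finset.sum_congr rfl fun i _ => by simp only [hc]; ring
  set D : (Fin k → Bool) × Bool → Set (Fin n → ℝ) := fun jb =>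
    {x | n * min η ε ≤ ∑ i, (if jb.2 then c jb.1 i else - c jb.1 i) * (x i - deriv (cgf' μ) (θ i))} with hD
  have hθJ : ∀ i, |θ i| ≤ J := fun i => abs_le.2 (hθ i)
  have key := tilt_lower hI θ (ε := ε) (L := e0 + ε + 1) (κ := κ) hE D
    (fun jb => Hκ n θ _ hθJ fun i => by
      refine le_trans ?_ (le_max_right J 1)
      split_ifs
      · exact hcb _ _
      · rw [abs_neg]; exact hcb _ _)
    ((lintegral_mono_set (fun x hx => by
      simp only [Set.mem_ofPred_eq] at hx ⊢
      refine le_trans ?_ hx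
      gcongr; exact min_le_right _ _)).trans (Hκ n θ θ hθJ fun i => (hθJ i).trans (le_max_left _ _)))
    {x | |Ustat G (fun y : Fin v → ℝ => ∏ a, y a) n (Q n) x - G1 G W f| ≤ ρ}
    {x | ¬ N (fun u => x (τ u))} (h3 n hn τ hτ hu) (by
      intro x hx1 hx2
      have hxN : N (fun u => x (τ u)) := by simpa using hx1
      have hxm := comp_tau_meas hτ x
      obtain ⟨hxi, hxR⟩ := h1 _ hxm hxN
      have hdev : ∀ j, |blockInt (ind k) (fun u => x (τ u)) j - blockInt (ind k) fn j| ≤ η := by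
        intro j
        have e1 : n * (blockInt (ind k) (fun u => x (τ u)) j - blockInt (ind k) fn j) =
            ∑ i, c j i * (x i - deriv (cgf' μ) (θ i)) := by
          rw [mul_sub, hbx x j, hfn, hbx m j, ← Finset.sum_sub_distrib]
          exact Finset.sum_congr rfl fun i _ => by rw [hθm]; ring
        have p1 := hx2 (j, true)
        have p2 := hx2 (j, false)
        simp only [hD, Set.mem_ofPred_eq, not_le, if_true, Bool.false_eq_true, if_false, neg_mul, Finset.sum_neg_distrib] at p1 p2
        rw [← e1] at p1 p2
        have hle : (n:ℝ) * min η ε ≤ n * η := by gcongr; exact min_le_left _ _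
        rw [abs_le]
        constructor
        · have : n * (-(blockInt (ind k) (fun u => x (τ u)) j - blockInt (ind k) fn j)) ≤ n * η := by linarith
          have := le_of_mul_le_mul_left this hn0
          linarith
        · have : n * (blockInt (ind k) (fun u => x (τ u)) j - blockInt (ind k) fn j) ≤ n * η := by linarith
          exact le_of_mul_le_mul_left this hn0
      have q1 := h7 x hxN
      have q2 := h4 _ hxm hxN
      have q3 := Hη _ _ (fun j => (blockInt_abs_le _ hxi j).trans hxR)
        (fun j => (blockInt_abs_le _ hfni.1 j).trans hfni.2) hdev
      have q4 := h4 _ hfnm hNfn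
      have q5 := h6 _ hfnm hNfn
      have q6 := h6 _ hfm hNf
      rw [hG] at q5
      simp only [Set.mem_ofPred_eq]
      rw [abs_le] at *
      constructor <;> linarith [q1.1, q1.2, q2.1, q2.2, q3.1, q3.2, q4.1, q4.2, q5.1, q5.2, q6.1, q6.2])
  set A := (Measure.pi fun _ : Fin n => μ)
    {x | |Ustat G (fun y : Fin v → ℝ => ∏ a, y a) n (Q n) x - G1 G W f| ≤ ρ}
  have hAt : A ≠ ⊤ := measure_ne_top _ _
  have hA : A = ENNReal.ofReal A.toReal := (ENNReal.ofReal_toReal hAt).symm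
  rw [hA] at key ⊢
  refine ENNReal.ofReal_le_ofReal ?_
  have hA0 : 0 ≤ A.toReal := ENNReal.toReal_nonneg
  have hk : ((Fintype.card ((Fin k → Bool) × Bool) : ℝ≥0∞) + 1) =
      ENNReal.ofReal (Fintype.card ((Fin k → Bool) × Bool) + 1 : ℝ) := by
    rw [ENNReal.ofReal_add (by positivity) (by norm_num), ENNReal.ofReal_natCast, ENNReal.ofReal_one]
  rw [hk, ← ENNReal.ofReal_mul (Real.exp_pos _).le, ← ENNReal.ofReal_mul (by positivity),
    show (2:ℝ≥0∞) = ENNReal.ofReal 2 by simp, ← ENNReal.ofReal_mul (by norm_num),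
    ← ENNReal.ofReal_mul (by positivity), ← ENNReal.ofReal_add (by positivity) (by positivity),
    ← ENNReal.ofReal_add (by positivity) (by positivity), ← ENNReal.ofReal_one,
    ENNReal.ofReal_le_ofReal_iff (by positivity)] at key
  have e2 : Real.exp (n * (e0 + ε)) * (2 * Real.exp (-(n * (e0 + ε + 1)))) = 2 * Real.exp (-(n:ℝ)) := by
    rw [mul_left_comm, ← Real.exp_add]; congr 2; ring
  rw [e2] at key
  have e3 : 1/2 ≤ Real.exp (n * (e0 + ε)) * A.toReal := by linarith
  calc 1/2 * Real.exp (-(n * (e0 + ε))) ≤ (Real.exp (n * (e0 + ε)) * A.toReal) * Real.exp (-(n * (e0 + ε))) := by gcongr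
    _ = A.toReal * (Real.exp (n * (e0 + ε)) * Real.exp (-(n * (e0 + ε)))) := by ring
    _ = A.toReal := by rw [← Real.exp_add]; simp

end

section
open MeasureTheory Filter Set
open scoped ENNReal NNReal

theorem log_scale_tendsto (a z : ℝ) :
    Tendsto (fun n : ℕ => (((n:ℝ)⁻¹ * (a + n * z) : ℝ) : EReal)) atTop (nhds (z : EReal)) := by
  refine (continuous_coe_real_ereal.tendsto z).comp ?_
  have h1 : Tendsto (fun n : ℕ => (n:ℝ)⁻¹ * a + z) atTop (nhds (0 * a + z)) :=
    (tendsto_inv_atTop_nhds_zero_nat.mul_const a).add_const z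
  rw [zero_mul, zero_add] at h1
  refine h1.congr' ?_
  filter_upwards [eventually_ge_atTop 1] with n hn
  have : (n:ℝ) ≠ 0 := by positivity
  field_simp

theorem log_scale_eq {a : ℝ} (ha : 0 < a) (z : ℝ) (n : ℕ) :
    (((n : ℝ)⁻¹ : ℝ) : EReal) * ENNReal.log (ENNReal.ofReal (a * Real.exp (n * z))) =
      (((n:ℝ)⁻¹ * (Real.log a + n * z) : ℝ) : EReal) := by
  rw [ENNReal.log_ofReal_of_pos (by positivity), Real.log_mul ha.ne' (Real.exp_pos _).ne', Real.log_exp,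
    ← EReal.coe_mul]

theorem limsup_log_le {P : ℕ → ℝ≥0∞} {K : ℕ} {z : ℝ}
    (h : ∀ᶠ n : ℕ in atTop, P n ≤ K * ENNReal.ofReal (Real.exp (n * z))) :
    Filter.atTop.limsup (fun n : ℕ => (((n : ℝ)⁻¹ : ℝ) : EReal) * ENNReal.log (P n)) ≤ z := by
  rw [← (log_scale_tendsto (Real.log ((K:ℝ)+1)) z).limsup_eq]
  refine limsup_le_limsup ?_
  filter_upwards [h] with n hn
  rw [← log_scale_eq (by positivity)]
  refine mul_le_mul_of_nonneg_left (ENNReal.log_monotone (hn.trans ?_)) (by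
    exact_mod_cast (by positivity : (0:ℝ) ≤ (n:ℝ)⁻¹))
  rw [ENNReal.ofReal_mul (by positivity)]
  gcongr
  rw [← ENNReal.ofReal_natCast]
  exact ENNReal.ofReal_le_ofReal (by linarith)

theorem le_liminf_log {P : ℕ → ℝ≥0∞} {z : ℝ}
    (h : ∀ᶠ n : ℕ in atTop, ENNReal.ofReal (1/2 * Real.exp (n * z)) ≤ P n) :
    (z : EReal) ≤ Filter.atTop.liminf (fun n : ℕ => (((n : ℝ)⁻¹ : ℝ) : EReal) * ENNReal.log (P n)) := by
  rw [← (log_scale_tendsto (Real.log (1/2)) z).liminf_eq]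
  refine liminf_le_liminf ?_
  filter_upwards [h] with n hn
  rw [← log_scale_eq (by positivity)]
  exact mul_le_mul_of_nonneg_left (ENNReal.log_monotone hn) (by
    exact_mod_cast (by positivity : (0:ℝ) ≤ (n:ℝ)⁻¹))

theorem coe_lt_ereal_iff {z : ℝ} (hz : 0 ≤ z) {a : ℝ≥0∞} : (z : EReal) < (a : EReal) ↔ ENNReal.ofReal z < a := by
  rw [← EReal.coe_ennreal_lt_coe_ennreal_iff, EReal.coe_ennreal_ofReal, max_eq_left hz]

theorem ereal_lt_coe_iff {z : ℝ} (hz : 0 ≤ z) {a : ℝ≥0∞} : (a : EReal) < (z : EReal) ↔ a < ENNReal.ofReal z := by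
  rw [← EReal.coe_ennreal_lt_coe_ennreal_iff, EReal.coe_ennreal_ofReal, max_eq_left hz]

theorem lower {μ : Measure ℝ} [IsProbabilityMeasure μ]
    {v : ℕ} (G : SimpleGraph (Fin v)) [DecidableRel G.Adj] {W : ℝ → ℝ → ℝ}
    (hWm : Measurable (Function.uncurry W))
    {Q : ∀ n : ℕ, Fin n → Fin n → ℝ} {C : ℝ} (hC : CoreHyp G W Q μ C) {p : ℝ≥0∞}
    (hp : 1 ≤ p) (hpt : p ≠ ⊤) (hI : ∀ θ, Integrable (fun x : ℝ => Real.exp (θ * x)) μ)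
    (hintg : ∀ f : ℝ → ℝ, Measurable f → ∫⁻ u, ‖f u‖ₑ ^ p.toReal ∂unif01 ≠ ⊤ →
      Integrable (fun x : Fin v → ℝ => edgeProd G (fun a b => W (x a) (x b)) * ∏ a, f (x a)) (PV v))
    {F : Set ℝ} {t : ℝ} (ht : t ∈ interior F) {z : ℝ} (hz : 0 ≤ z) (hlt : rate1 G W μ p t < ENNReal.ofReal z) :
    ∀ᶠ n : ℕ in atTop, ENNReal.ofReal (1/2 * Real.exp (n * (-z))) ≤ (Measure.pi fun _ : Fin n => μ)
      {x | Ustat G (fun y : Fin v → ℝ => ∏ a, y a) n (Q n) x ∈ F} := by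
  unfold rate1 at hlt
  obtain ⟨⟨f, hfL, hfe, hfG⟩, hlt⟩ := iInf_lt_iff.1 hlt
  simp only at hlt
  obtain ⟨ρ, hρ, hball⟩ := Metric.mem_nhds_iff.1 (mem_interior_iff_mem_nhds.1 ht)
  have hca := clip_approx G hWm hp hpt hI hintg hfL
  obtain ⟨J, hJ⟩ := (Metric.tendsto_nhds.1 hca (ρ/2) (half_pos hρ)).exists
  rw [hfG, Real.dist_eq] at hJ
  have he0 : (∫⁻ u, gammaBeta μ (f u) ∂unif01).toReal < z := (ENNReal.lt_ofReal_iff_toReal_lt hfe).1 hlt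
  have hJ0 : (0:ℝ) ≤ J := Nat.cast_nonneg J
  have hm : Measurable fun u => clipJ μ J (f u) := by
    have := hfL.1
    unfold clipJ; fun_prop
  have := lower_bdd G hC hI hJ0 hm (fun u => clipJ_mem hI hJ0 (f u))
    (e0 := (∫⁻ u, gammaBeta μ (f u) ∂unif01).toReal) ENNReal.toReal_nonneg (sub_pos.2 he0) (by
      rw [ENNReal.ofReal_toReal hfe]
      exact lintegral_mono fun u => clipJ_gamma hI hJ0 (f u)) (ρ := ρ/3) (by positivity)
  filter_upwards [this] with n hn
  rw [show (n:ℝ) * -z = -(n * ((∫⁻ u, gammaBeta μ (f u) ∂unif01).toReal +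
    (z - (∫⁻ u, gammaBeta μ (f u) ∂unif01).toReal))) by ring]
  refine hn.trans (measure_mono fun x hx => hball ?_)
  have hx' : |Ustat G (fun y : Fin v → ℝ => ∏ a, y a) n (Q n) x - G1 G W (fun u => clipJ μ J (f u))| ≤ ρ/3 := hx
  rw [Metric.mem_ball, Real.dist_eq]
  rw [abs_lt] at hJ ⊢; rw [abs_le] at hx'
  constructor <;> linarith [hx'.1, hx'.2, hJ.1, hJ.2]


end

/-- Corollary 1.2: LDP for random multilinear forms. -/
theorem ldp_multilinear_forms
    (μ : Measure ℝ) [IsProbabilityMeasure μ]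
    (hnondeg : ∀ x : ℝ, μ ≠ Measure.dirac x)
    {v : ℕ} (hv : 2 ≤ v) (G : SimpleGraph (Fin v)) [DecidableRel G.Adj]
    (Q : ∀ n : ℕ, Fin n → Fin n → ℝ)
    (hQsymm : ∀ n i j, Q n i j = Q n j i) (hQzero : ∀ n i, Q n i i = 0)
    (W : ℝ → ℝ → ℝ) (hWmeas : Measurable (Function.uncurry W))
    (hWsymm : ∀ x y, W x y = W y x) (hWL1 : kerNorm W 1 ≠ ⊤)
    (hcut : Tendsto (fun n => weakCutDist (stepKernel n (Q n)) W) atTop (nhds 0))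
    (p : ℝ≥0∞) (hp : 1 ≤ p) (hTail : TailCond μ (fun x => |x|) p)
    (q : ℝ≥0∞) (hq : 1 < q) (hpq : p⁻¹ + q⁻¹ ≤ 1)
    (hnorm : Filter.atTop.limsup
        (fun n => kerNorm (stepKernel n (Q n)) (q * (G.maxDegree : ℝ≥0∞))) ≠ ⊤) :
    (∀ f ∈ Lcal μ p,
      Integrable (fun x : Fin v → ℝ => edgeProd G (fun a b => W (x a) (x b)) * ∏ a, f (x a))
        (Measure.pi fun _ : Fin v => unif01)) ∧
    SatisfiesLDP (fun n => Measure.pi fun _ : Fin n => μ)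
      (fun n x => Ustat G (fun y : Fin v → ℝ => ∏ a, y a) n (Q n) x)
      (rate1 G W μ p) := by
  have hpt : p ≠ ⊤ := by
    rintro rfl
    unfold TailCond at hTail
    rw [if_pos rfl] at hTail
    obtain ⟨C, hC⟩ := hTail
    have := hC (|C| + 1)
    have h2 := le_abs_self (|C| + 1)
    have h3 := le_abs_self C
    linarith
  have hTC : TC μ p.toReal := by
    unfold TailCond at hTail
    rw [if_neg hpt] at hTail
    exact hTail
  have hI := hTC.expInt (toReal_one_le hp hpt)
  have hp0 : p ≠ 0 := (zero_lt_one.trans_le hp).ne'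
  have hr : q * (G.maxDegree : ℝ≥0∞) = 0 ∨ 1 ≤ q * (G.maxDegree : ℝ≥0∞) := by
    rcases Nat.eq_zero_or_pos G.maxDegree with h | h
    · left; simp [h]
    · right
      exact one_le_mul hq.le (by exact_mod_cast h)
  obtain ⟨B, hBt, hWB, hτ, hS⟩ := dpack Q hWmeas hWL1 hcut hr hnorm
  have hCore : CoreHyp G W Q μ (logMom μ p.toReal 1) := fun L ε hL hε =>
    core G hp hpt hq hpq hBt hTC hWmeas hWB hτ hS hL hε
  have hintg : ∀ f : ℝ → ℝ, Measurable f → ∫⁻ u, ‖f u‖ₑ ^ p.toReal ∂unif01 ≠ ⊤ →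
      Integrable (fun x : Fin v → ℝ => edgeProd G (fun a b => W (x a) (x b)) * ∏ a, f (x a)) (PV v) :=
    fun f hf hfp => G1_integrable G hWmeas hp hpt hq hpq hWB hBt hf hfp
  refine ⟨fun f hf => hintg f hf.1 (lintegral_rpow_enorm_lt_top_of_eLpNorm_lt_top hp0 hpt hf.2.2).ne, ?_, ?_⟩
  · intro c hc
    have := good_rate G hp hpt hTC hCore.step (c := c.toReal) ENNReal.toReal_nonneg
    rwa [ENNReal.ofReal_toReal hc] at this
  · intro F _
    constructor
    · rw [EReal.neg_le]
      refine le_iInf₂ fun t ht => ?_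
      refine EReal.le_of_forall_lt_iff_le.1 fun z hz => ?_
      have hz0 : 0 ≤ z := by
        have h0 : (0:EReal) ≤ ((rate1 G W μ p t : ℝ≥0∞) : EReal) := EReal.coe_ennreal_nonneg _
        exact_mod_cast (h0.trans_lt hz).le
      rw [EReal.neg_le, ← EReal.coe_neg]
      exact le_liminf_log (lower G hWmeas hCore hp hpt hI hintg ht hz0 ((ereal_lt_coe_iff hz0).1 hz))
    · refine EReal.le_of_forall_lt_iff_le.1 fun z hz => ?_
      rcases le_or_gt 0 z with h0 | h0
      · refine limsup_log_le (K := 1) (Eventually.of_forall fun n => ?_)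
        refine prob_le_one.trans ?_
        rw [Nat.cast_one, one_mul, ← ENNReal.ofReal_one]
        exact ENNReal.ofReal_le_ofReal (Real.one_le_exp (by positivity))
      · have hz' : ((-z : ℝ) : EReal) < ⨅ x ∈ closure F, ((rate1 G W μ p x : ℝ≥0∞) : EReal) := by
          rw [EReal.coe_neg]; exact EReal.neg_lt_comm.1 hz
        obtain ⟨K, hK⟩ := upper G hCore hp hpt hTC (ℓ := -z) (by linarith) isClosed_closure (F := closure F)
          (fun t ht => (coe_lt_ereal_iff (by linarith)).1 (hz'.trans_le (iInf₂_le t ht)))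
        refine limsup_log_le (K := K) ?_
        filter_upwards [hK] with n hn
        refine le_trans (measure_mono ?_) (hn.trans (le_of_eq ?_))
        · intro x hx
          exact subset_closure (s := F) hx
        · congr 3; ring
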